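/- The finitely presented group H1 is finite of order 2^18 * 3^9 * 5^2 * 7 * 11 * 13, and its automorphism group MulAut H1 has the same cardinality: |Aut(H1)| = |H1| = 2^18 * 3^9 * 5^2 * 7 * 11 * 13. -/

import Mathlib

inductive GenH : Type
  | a | b | c | d | e | f | g | h | i | z

def sa : FreeGroup GenH := FreeGroup.of GenH.a
def sb : FreeGroup GenH := FreeGroup.of GenH.b
def sc : FreeGroup GenH := FreeGroup.of GenH.c
def sd : FreeGroup GenH := FreeGroup.of GenH.d
def se : FreeGroup GenH := FreeGroup.of GenH.e
def sf : FreeGroup GenH := FreeGroup.of GenH.f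
def sg : FreeGroup GenH := FreeGroup.of GenH.g
def sh : FreeGroup GenH := FreeGroup.of GenH.h
def si : FreeGroup GenH := FreeGroup.of GenH.i
def sz : FreeGroup GenH := FreeGroup.of GenH.z

/-- The relators of the presentation of the 2-fold cover `2.Fi22`. -/
def relsH : Set (FreeGroup GenH) :=
  { sa ^ 2, sb ^ 2, sc ^ 2, sd ^ 2, se ^ 2, sf ^ 2, sg ^ 2, sh ^ 2, si ^ 2,
    (sa * sb) ^ 3, (sb * sc) ^ 3 * sz⁻¹, (sc * sd) ^ 3, (sd * se) ^ 3,
    (se * sf) ^ 3 * sz⁻¹, (sf * sg) ^ 3 * sz⁻¹,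
    (sa * sc) ^ 2, (sa * sd) ^ 2, (sa * se) ^ 2, (sa * sf) ^ 2, (sa * sg) ^ 2,
    (sa * sh) ^ 2, (sa * si) ^ 2,
    (sb * sd) ^ 2, (sb * se) ^ 2, (sb * sf) ^ 2, (sb * sg) ^ 2, (sb * sh) ^ 2, (sb * si) ^ 2,
    (sc * se) ^ 2, (sc * sf) ^ 2, (sc * sg) ^ 2, (sc * sh) ^ 2, (sc * si) ^ 2,
    (sd * sf) ^ 2, (sd * sg) ^ 2, (se * sg) ^ 2, (se * sh) ^ 2, (se * si) ^ 2,
    (sd * sh) ^ 3, (sh * si) ^ 3,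
    (sd * si) ^ 2, (sf * sh) ^ 2, (sf * si) ^ 2, (sg * sh) ^ 2, (sg * si) ^ 2,
    (sd * sc * sb * sd * se * sf * sd * sh * si) ^ 10,
    (sa * sb * sc * sd * se * sf * sh) ^ 9,
    (sb * sc * sd * se * sf * sg * sh) ^ 9,
    sz ^ 2,
    sz * sa * sz⁻¹ * sa⁻¹, sz * sb * sz⁻¹ * sb⁻¹, sz * sc * sz⁻¹ * sc⁻¹,
    sz * sd * sz⁻¹ * sd⁻¹, sz * se * sz⁻¹ * se⁻¹, sz * sf * sz⁻¹ * sf⁻¹,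
    sz * sg * sz⁻¹ * sg⁻¹, sz * sh * sz⁻¹ * sh⁻¹, sz * si * sz⁻¹ * si⁻¹ }

/-- The presented group `H1` (the 2-fold cover `2.Fi22`). -/
abbrev H1 := PresentedGroup relsH

set_option linter.all false

namespace Fi22

noncomputable section

/-- Digits in base twelve, the branching degree of the tables. -/
inductive Dig | d0 | d1 | d2 | d3 | d4 | d5 | d6 | d7 | d8 | d9 | d10 | d11
  deriving DecidableEq

/-- The nine Coxeter letters. -/
inductive Ltr | a | b | c | d | e | f | g | h | i
  deriving DecidableEq

structure Nd (α : Type) where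
  x0 : α
  x1 : α
  x2 : α
  x3 : α
  x4 : α
  x5 : α
  x6 : α
  x7 : α
  x8 : α
  x9 : α
  x10 : α
  x11 : α

/-- A point: its number together with its four base twelve digits. -/
structure Pt where
  c : Nat
  p1 : Dig
  p2 : Dig
  p3 : Dig
  p4 : Dig

/-- A table entry: undefined, or a signed point. -/
inductive En | no | yes (s : Bool) (p : Pt)

structure Rw where
  y0 : En
  y1 : En
  y2 : En
  y3 : En
  y4 : En
  y5 : En
  y6 : En
  y7 : En
  y8 : En

def Rw.get (d : Ltr) : Rw → En :=
  Ltr.rec (motive := fun _ => Rw → En) Rw.y0 Rw.y1 Rw.y2 Rw.y3 Rw.y4 Rw.y5 Rw.y6 Rw.y7 Rw.y8 d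

abbrev T0 := Rw

abbrev T1 := Nd T0

def get1 (d : Dig) : T1 → T0 :=
  Dig.rec (motive := fun _ => T1 → T0) Nd.x0 Nd.x1 Nd.x2 Nd.x3 Nd.x4 Nd.x5 Nd.x6 Nd.x7 Nd.x8 Nd.x9 Nd.x10 Nd.x11 d

abbrev T2 := Nd T1

def get2 (d : Dig) : T2 → T1 :=
  Dig.rec (motive := fun _ => T2 → T1) Nd.x0 Nd.x1 Nd.x2 Nd.x3 Nd.x4 Nd.x5 Nd.x6 Nd.x7 Nd.x8 Nd.x9 Nd.x10 Nd.x11 d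

abbrev T3 := Nd T2

def get3 (d : Dig) : T3 → T2 :=
  Dig.rec (motive := fun _ => T3 → T2) Nd.x0 Nd.x1 Nd.x2 Nd.x3 Nd.x4 Nd.x5 Nd.x6 Nd.x7 Nd.x8 Nd.x9 Nd.x10 Nd.x11 d

abbrev T4 := Nd T3

def get4 (d : Dig) : T4 → T3 :=
  Dig.rec (motive := fun _ => T4 → T3) Nd.x0 Nd.x1 Nd.x2 Nd.x3 Nd.x4 Nd.x5 Nd.x6 Nd.x7 Nd.x8 Nd.x9 Nd.x10 Nd.x11 d

def Nd.upd0 {α : Type} (t : Nd α) (f : α → (α → Bool) → Bool) (k : Nd α → Bool) : Bool :=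
  Nd.rec (motive := fun _ => Bool) (fun x0 x1 x2 x3 x4 x5 x6 x7 x8 x9 x10 x11 => f x0 (fun w => k (Nd.mk w x1 x2 x3 x4 x5 x6 x7 x8 x9 x10 x11))) t

def Nd.upd1 {α : Type} (t : Nd α) (f : α → (α → Bool) → Bool) (k : Nd α → Bool) : Bool :=
  Nd.rec (motive := fun _ => Bool) (fun x0 x1 x2 x3 x4 x5 x6 x7 x8 x9 x10 x11 => f x1 (fun w => k (Nd.mk x0 w x2 x3 x4 x5 x6 x7 x8 x9 x10 x11))) t

def Nd.upd2 {α : Type} (t : Nd α) (f : α → (α → Bool) → Bool) (k : Nd α → Bool) : Bool :=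
  Nd.rec (motive := fun _ => Bool) (fun x0 x1 x2 x3 x4 x5 x6 x7 x8 x9 x10 x11 => f x2 (fun w => k (Nd.mk x0 x1 w x3 x4 x5 x6 x7 x8 x9 x10 x11))) t

def Nd.upd3 {α : Type} (t : Nd α) (f : α → (α → Bool) → Bool) (k : Nd α → Bool) : Bool :=
  Nd.rec (motive := fun _ => Bool) (fun x0 x1 x2 x3 x4 x5 x6 x7 x8 x9 x10 x11 => f x3 (fun w => k (Nd.mk x0 x1 x2 w x4 x5 x6 x7 x8 x9 x10 x11))) t

def Nd.upd4 {α : Type} (t : Nd α) (f : α → (α → Bool) → Bool) (k : Nd α → Bool) : Bool :=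
  Nd.rec (motive := fun _ => Bool) (fun x0 x1 x2 x3 x4 x5 x6 x7 x8 x9 x10 x11 => f x4 (fun w => k (Nd.mk x0 x1 x2 x3 w x5 x6 x7 x8 x9 x10 x11))) t

def Nd.upd5 {α : Type} (t : Nd α) (f : α → (α → Bool) → Bool) (k : Nd α → Bool) : Bool :=
  Nd.rec (motive := fun _ => Bool) (fun x0 x1 x2 x3 x4 x5 x6 x7 x8 x9 x10 x11 => f x5 (fun w => k (Nd.mk x0 x1 x2 x3 x4 w x6 x7 x8 x9 x10 x11))) t

def Nd.upd6 {α : Type} (t : Nd α) (f : α → (α → Bool) → Bool) (k : Nd α → Bool) : Bool :=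
  Nd.rec (motive := fun _ => Bool) (fun x0 x1 x2 x3 x4 x5 x6 x7 x8 x9 x10 x11 => f x6 (fun w => k (Nd.mk x0 x1 x2 x3 x4 x5 w x7 x8 x9 x10 x11))) t

def Nd.upd7 {α : Type} (t : Nd α) (f : α → (α → Bool) → Bool) (k : Nd α → Bool) : Bool :=
  Nd.rec (motive := fun _ => Bool) (fun x0 x1 x2 x3 x4 x5 x6 x7 x8 x9 x10 x11 => f x7 (fun w => k (Nd.mk x0 x1 x2 x3 x4 x5 x6 w x8 x9 x10 x11))) t

def Nd.upd8 {α : Type} (t : Nd α) (f : α → (α → Bool) → Bool) (k : Nd α → Bool) : Bool :=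
  Nd.rec (motive := fun _ => Bool) (fun x0 x1 x2 x3 x4 x5 x6 x7 x8 x9 x10 x11 => f x8 (fun w => k (Nd.mk x0 x1 x2 x3 x4 x5 x6 x7 w x9 x10 x11))) t

def Nd.upd9 {α : Type} (t : Nd α) (f : α → (α → Bool) → Bool) (k : Nd α → Bool) : Bool :=
  Nd.rec (motive := fun _ => Bool) (fun x0 x1 x2 x3 x4 x5 x6 x7 x8 x9 x10 x11 => f x9 (fun w => k (Nd.mk x0 x1 x2 x3 x4 x5 x6 x7 x8 w x10 x11))) t

def Nd.upd10 {α : Type} (t : Nd α) (f : α → (α → Bool) → Bool) (k : Nd α → Bool) : Bool :=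
  Nd.rec (motive := fun _ => Bool) (fun x0 x1 x2 x3 x4 x5 x6 x7 x8 x9 x10 x11 => f x10 (fun w => k (Nd.mk x0 x1 x2 x3 x4 x5 x6 x7 x8 x9 w x11))) t

def Nd.upd11 {α : Type} (t : Nd α) (f : α → (α → Bool) → Bool) (k : Nd α → Bool) : Bool :=
  Nd.rec (motive := fun _ => Bool) (fun x0 x1 x2 x3 x4 x5 x6 x7 x8 x9 x10 x11 => f x11 (fun w => k (Nd.mk x0 x1 x2 x3 x4 x5 x6 x7 x8 x9 x10 w))) t

def Rw.upd0 (w : En) (k : Rw → Bool) (t : Rw) : Bool :=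
  Rw.rec (motive := fun _ => Bool) (fun y0 y1 y2 y3 y4 y5 y6 y7 y8 => k (Rw.mk w y1 y2 y3 y4 y5 y6 y7 y8)) t

def Rw.upd1 (w : En) (k : Rw → Bool) (t : Rw) : Bool :=
  Rw.rec (motive := fun _ => Bool) (fun y0 y1 y2 y3 y4 y5 y6 y7 y8 => k (Rw.mk y0 w y2 y3 y4 y5 y6 y7 y8)) t

def Rw.upd2 (w : En) (k : Rw → Bool) (t : Rw) : Bool :=
  Rw.rec (motive := fun _ => Bool) (fun y0 y1 y2 y3 y4 y5 y6 y7 y8 => k (Rw.mk y0 y1 w y3 y4 y5 y6 y7 y8)) t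

def Rw.upd3 (w : En) (k : Rw → Bool) (t : Rw) : Bool :=
  Rw.rec (motive := fun _ => Bool) (fun y0 y1 y2 y3 y4 y5 y6 y7 y8 => k (Rw.mk y0 y1 y2 w y4 y5 y6 y7 y8)) t

def Rw.upd4 (w : En) (k : Rw → Bool) (t : Rw) : Bool :=
  Rw.rec (motive := fun _ => Bool) (fun y0 y1 y2 y3 y4 y5 y6 y7 y8 => k (Rw.mk y0 y1 y2 y3 w y5 y6 y7 y8)) t

def Rw.upd5 (w : En) (k : Rw → Bool) (t : Rw) : Bool :=
  Rw.rec (motive := fun _ => Bool) (fun y0 y1 y2 y3 y4 y5 y6 y7 y8 => k (Rw.mk y0 y1 y2 y3 y4 w y6 y7 y8)) t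

def Rw.upd6 (w : En) (k : Rw → Bool) (t : Rw) : Bool :=
  Rw.rec (motive := fun _ => Bool) (fun y0 y1 y2 y3 y4 y5 y6 y7 y8 => k (Rw.mk y0 y1 y2 y3 y4 y5 w y7 y8)) t

def Rw.upd7 (w : En) (k : Rw → Bool) (t : Rw) : Bool :=
  Rw.rec (motive := fun _ => Bool) (fun y0 y1 y2 y3 y4 y5 y6 y7 y8 => k (Rw.mk y0 y1 y2 y3 y4 y5 y6 w y8)) t

def Rw.upd8 (w : En) (k : Rw → Bool) (t : Rw) : Bool :=
  Rw.rec (motive := fun _ => Bool) (fun y0 y1 y2 y3 y4 y5 y6 y7 y8 => k (Rw.mk y0 y1 y2 y3 y4 y5 y6 y7 w)) t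

def Rw.upd (d : Ltr) : (En → (Rw → Bool) → Rw → Bool) :=
  Ltr.rec (motive := fun _ => (En → (Rw → Bool) → Rw → Bool)) Rw.upd0 Rw.upd1 Rw.upd2 Rw.upd3 Rw.upd4 Rw.upd5 Rw.upd6 Rw.upd7 Rw.upd8 d

def upd1 (d : Dig) : T1 → (T0 → (T0 → Bool) → Bool) → (T1 → Bool) → Bool :=
  Dig.rec (motive := fun _ => T1 → (T0 → (T0 → Bool) → Bool) → (T1 → Bool) → Bool)
    Nd.upd0 Nd.upd1 Nd.upd2 Nd.upd3 Nd.upd4 Nd.upd5 Nd.upd6 Nd.upd7 Nd.upd8 Nd.upd9 Nd.upd10 Nd.upd11 d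

def upd2 (d : Dig) : T2 → (T1 → (T1 → Bool) → Bool) → (T2 → Bool) → Bool :=
  Dig.rec (motive := fun _ => T2 → (T1 → (T1 → Bool) → Bool) → (T2 → Bool) → Bool)
    Nd.upd0 Nd.upd1 Nd.upd2 Nd.upd3 Nd.upd4 Nd.upd5 Nd.upd6 Nd.upd7 Nd.upd8 Nd.upd9 Nd.upd10 Nd.upd11 d

def upd3 (d : Dig) : T3 → (T2 → (T2 → Bool) → Bool) → (T3 → Bool) → Bool :=
  Dig.rec (motive := fun _ => T3 → (T2 → (T2 → Bool) → Bool) → (T3 → Bool) → Bool)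
    Nd.upd0 Nd.upd1 Nd.upd2 Nd.upd3 Nd.upd4 Nd.upd5 Nd.upd6 Nd.upd7 Nd.upd8 Nd.upd9 Nd.upd10 Nd.upd11 d

def upd4 (d : Dig) : T4 → (T3 → (T3 → Bool) → Bool) → (T4 → Bool) → Bool :=
  Dig.rec (motive := fun _ => T4 → (T3 → (T3 → Bool) → Bool) → (T4 → Bool) → Bool)
    Nd.upd0 Nd.upd1 Nd.upd2 Nd.upd3 Nd.upd4 Nd.upd5 Nd.upd6 Nd.upd7 Nd.upd8 Nd.upd9 Nd.upd10 Nd.upd11 d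

abbrev Tb := T4

def Tb.row (t : Tb) (p : Pt) : Rw :=
  Pt.rec (motive := fun _ => Rw) (fun _ p1 p2 p3 p4 => (get1 p4 (get2 p3 (get3 p2 (get4 p1 t))))) p

def Tb.get (t : Tb) (p : Pt) (g : Ltr) : En := Rw.get g (Tb.row t p)

def Tb.set (t : Tb) (p : Pt) (g : Ltr) (e : En) (k : Tb → Bool) : Bool :=
  Pt.rec (motive := fun _ => Bool) (fun _ p1 p2 p3 p4 => (fun t1 k => upd4 p1 t1 (fun t2 k => upd3 p2 t2 (fun t3 k => upd2 p3 t3 (fun t4 k => upd1 p4 t4 (fun r k => Rw.upd g e k r) k) k) k) k) t k) p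

def Dig.suc (d : Dig) (k : Dig → Bool) (ov : Bool) : Bool :=
  Dig.rec (motive := fun _ => Bool) (k Dig.d1) (k Dig.d2) (k Dig.d3) (k Dig.d4) (k Dig.d5) (k Dig.d6) (k Dig.d7) (k Dig.d8) (k Dig.d9) (k Dig.d10) (k Dig.d11) ov d

/-- Continue with the value of `n`, normalised by the kernel. -/
def force (n : Nat) (k : Nat → Bool) : Bool :=
  Nat.rec (motive := fun _ => Bool) (k 0) (fun m _ => k (Nat.succ m)) n

def Pt.suc (p : Pt) (k : Pt → Bool) : Bool :=
  Pt.rec (motive := fun _ => Bool) (fun c0 p1 p2 p3 p4 => force (Nat.add c0 1) fun c =>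
    (Dig.suc p4 (fun q => k (Pt.mk c p1 p2 p3 q)) (Dig.suc p3 (fun q => k (Pt.mk c p1 p2 q Dig.d0)) (Dig.suc p2 (fun q => k (Pt.mk c p1 q Dig.d0 Dig.d0)) (Dig.suc p1 (fun q => k (Pt.mk c q Dig.d0 Dig.d0 Dig.d0)) false))))) p

def Pt.zero : Pt := Pt.mk 0 Dig.d0 Dig.d0 Dig.d0 Dig.d0

def emp0 : Rw := Rw.mk En.no En.no En.no En.no En.no En.no En.no En.no En.no

def emp1 : T1 := .mk emp0 emp0 emp0 emp0 emp0 emp0 emp0 emp0 emp0 emp0 emp0 emp0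

def emp2 : T2 := .mk emp1 emp1 emp1 emp1 emp1 emp1 emp1 emp1 emp1 emp1 emp1 emp1

def emp3 : T3 := .mk emp2 emp2 emp2 emp2 emp2 emp2 emp2 emp2 emp2 emp2 emp2 emp2

def emp4 : T4 := .mk emp3 emp3 emp3 emp3 emp3 emp3 emp3 emp3 emp3 emp3 emp3 emp3

abbrev emp : Tb := emp4

def Dig.val (d : Dig) : Nat :=
  Dig.rec (motive := fun _ => Nat) 0 1 2 3 4 5 6 7 8 9 10 11 d

def dig (n : Nat) : Dig :=
  match n with
  | 0 => .d0 | 1 => .d1 | 2 => .d2 | 3 => .d3 | 4 => .d4 | 5 => .d5 | 6 => .d6 | 7 => .d7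
  | 8 => .d8 | 9 => .d9 | 10 => .d10 | _ => .d11

theorem dig_val (d : Dig) : dig d.val = d := by cases d <;> rfl

theorem Dig.val_lt (d : Dig) : d.val < 12 := by cases d <;> decide

theorem val_dig {n : Nat} (h : n < 12) : (dig n).val = n := by
  interval_cases n <;> rfl

theorem Dig.suc_spec {d : Dig} {k : Dig → Bool} {ov : Bool} (h : Dig.suc d k ov = true) :
    (∃ q : Dig, q.val = d.val + 1 ∧ k q = true) ∨ (d.val = 11 ∧ ov = true) := by
  cases d
  all_goals first
    | exact Or.inl ⟨_, rfl, h⟩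
    | exact Or.inr ⟨rfl, h⟩

theorem force_eq (n : Nat) (k : Nat → Bool) : force n k = k n := by cases n <;> rfl

/-- The number of a point agrees with its digits. -/
def Good (p : Pt) : Prop := p.c = ((p.p1.val * 12 + p.p2.val) * 12 + p.p3.val) * 12 + p.p4.val

/-- The point with a given number. -/
def pt (c : Nat) : Pt := ⟨c, dig (c / 1728), dig (c / 144 % 12), dig (c / 12 % 12), dig (c % 12)⟩

theorem good_pt {c : Nat} (h : c < 20736) : Good (pt c) := by
  have h1 : c / 1728 < 12 := by omega
  have h2 : c / 144 % 12 < 12 := by omega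
  have h3 : c / 12 % 12 < 12 := by omega
  have h4 : c % 12 < 12 := by omega
  simp only [Good, pt, val_dig h1, val_dig h2, val_dig h3, val_dig h4]
  omega

theorem Good.eq_pt {p : Pt} (h : Good p) : pt p.c = p := by
  obtain ⟨c, p1, p2, p3, p4⟩ := p
  simp only [Good] at h
  have h1 := p1.val_lt
  have h2 := p2.val_lt
  have h3 := p3.val_lt
  have h4 := p4.val_lt
  have e1 : c / 1728 = p1.val := by omega
  have e2 : c / 144 % 12 = p2.val := by omega
  have e3 : c / 12 % 12 = p3.val := by omega
  have e4 : c % 12 = p4.val := by omega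
  simp only [pt, e1, e2, e3, e4, dig_val]

theorem Good.lt {p : Pt} (h : Good p) : p.c < 20736 := by
  have h1 := p.p1.val_lt
  have h2 := p.p2.val_lt
  have h3 := p.p3.val_lt
  have h4 := p.p4.val_lt
  simp only [Good] at h
  omega

theorem good_zero : Good Pt.zero := rfl

theorem Good.suc_spec {p : Pt} (hp : Good p) {k : Pt → Bool} (h : Pt.suc p k = true) :
    ∃ q, Good q ∧ q.c = p.c + 1 ∧ k q = true := by
  obtain ⟨c, p1, p2, p3, p4⟩ := p
  simp only [Good] at hp
  simp only [Pt.suc, force_eq] at h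
  rcases Dig.suc_spec h with ⟨q, hq, h⟩ | ⟨h4, h⟩
  · exact ⟨_, by simp only [Good, hq, hp]; rfl, rfl, h⟩
  rcases Dig.suc_spec h with ⟨q, hq, h⟩ | ⟨h3, h⟩
  · exact ⟨_, by simp only [Good, hq, hp, h4, show Dig.d0.val = 0 from rfl, Nat.add_eq]; ring, rfl, h⟩
  rcases Dig.suc_spec h with ⟨q, hq, h⟩ | ⟨h2, h⟩
  · exact ⟨_, by simp only [Good, hq, hp, h3, h4, show Dig.d0.val = 0 from rfl, Nat.add_eq]; ring, rfl, h⟩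
  rcases Dig.suc_spec h with ⟨q, hq, h⟩ | ⟨h1, h⟩
  · exact ⟨_, by simp only [Good, hq, hp, h2, h3, h4, show Dig.d0.val = 0 from rfl, Nat.add_eq]; ring, rfl, h⟩
  · exact absurd h Bool.false_ne_true

def Nd.get {α : Type} (d : Dig) (t : Nd α) : α :=
  Dig.rec (motive := fun _ => Nd α → α) Nd.x0 Nd.x1 Nd.x2 Nd.x3 Nd.x4 Nd.x5 Nd.x6 Nd.x7 Nd.x8
    Nd.x9 Nd.x10 Nd.x11 d t

def Nd.upd {α : Type} (d : Dig) :
    Nd α → (α → (α → Bool) → Bool) → (Nd α → Bool) → Bool :=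
  Dig.rec (motive := fun _ => Nd α → (α → (α → Bool) → Bool) → (Nd α → Bool) → Bool)
    Nd.upd0 Nd.upd1 Nd.upd2 Nd.upd3 Nd.upd4 Nd.upd5 Nd.upd6 Nd.upd7 Nd.upd8 Nd.upd9 Nd.upd10
    Nd.upd11 d

theorem Nd.upd_spec {α : Type} (d : Dig) (t : Nd α) (f : α → (α → Bool) → Bool)
    (k : Nd α → Bool) (h : Nd.upd d t f k = true) :
    ∃ k' : α → Bool, f (t.get d) k' = true ∧ ∀ w, k' w = true → ∃ t' : Nd α, k t' = true ∧
      t'.get d = w ∧ ∀ d', d' ≠ d → t'.get d' = t.get d' := by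
  cases d <;>
  exact ⟨_, h, fun w hw => ⟨_, hw, rfl, fun d' hd' => by cases d' <;> first | rfl | exact absurd rfl hd'⟩⟩

theorem Rw.upd_spec (g : Ltr) (r : Rw) (e : En) (k : Rw → Bool) (h : Rw.upd g e k r = true) :
    ∃ r' : Rw, k r' = true ∧ Rw.get g r' = e ∧ ∀ g', g' ≠ g → Rw.get g' r' = Rw.get g' r := by
  cases g <;>
  exact ⟨_, h, rfl, fun g' hg' => by cases g' <;> first | rfl | exact absurd rfl hg'⟩

/-- The content of a table, as a function of the number of the point. -/
def F (t : Tb) (c : Nat) (g : Ltr) : En := if c < 20736 then Tb.get t (pt c) g else .no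

theorem Good.get_eq {p : Pt} (hp : Good p) (t : Tb) (g : Ltr) : Tb.get t p g = F t p.c g := by
  rw [F, if_pos hp.lt, hp.eq_pt]

theorem Tb.set_digits (t : Tb) (c : Nat) (p1 p2 p3 p4 : Dig) (g : Ltr) (e : En) (k : Tb → Bool)
    (h : Tb.set t ⟨c, p1, p2, p3, p4⟩ g e k = true) :
    ∃ t', k t' = true ∧ ∀ c' q1 q2 q3 q4 g', Tb.get t' ⟨c', q1, q2, q3, q4⟩ g' =
      if (q1 = p1 ∧ q2 = p2 ∧ q3 = p3 ∧ q4 = p4) ∧ g' = g then e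
      else Tb.get t ⟨c', q1, q2, q3, q4⟩ g' := by
  obtain ⟨k1, h1, f1⟩ := Nd.upd_spec p1 t _ k h
  obtain ⟨k2, h2, f2⟩ := Nd.upd_spec p2 _ _ k1 h1
  obtain ⟨k3, h3, f3⟩ := Nd.upd_spec p3 _ _ k2 h2
  obtain ⟨k4, h4, f4⟩ := Nd.upd_spec p4 _ _ k3 h3
  obtain ⟨r, hr, r1, r2⟩ := Rw.upd_spec g _ e k4 h4
  obtain ⟨t4, h4', a4, b4⟩ := f4 _ hr
  obtain ⟨t3, h3', a3, b3⟩ := f3 _ h4'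
  obtain ⟨t2, h2', a2, b2⟩ := f2 _ h3'
  obtain ⟨t1, h1', a1, b1⟩ := f1 _ h2'
  refine ⟨t1, h1', fun c' q1 q2 q3 q4 g' => ?_⟩
  change Rw.get g' (Nd.get q4 (Nd.get q3 (Nd.get q2 (Nd.get q1 t1)))) =
    if _ then e else Rw.get g' (Nd.get q4 (Nd.get q3 (Nd.get q2 (Nd.get q1 t))))
  by_cases e1 : q1 = p1
  · subst e1
    rw [a1]
    by_cases e2 : q2 = p2
    · subst e2
      rw [a2]
      by_cases e3 : q3 = p3
      · subst e3
        rw [a3]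
        by_cases e4 : q4 = p4
        · subst e4
          rw [a4]
          by_cases e5 : g' = g
          · subst e5
            simp [r1]
          · rw [r2 _ e5]
            simp [e5]
        · rw [b4 _ e4]
          simp [e4]
      · rw [b3 _ e3]
        simp [e3]
    · rw [b2 _ e2]
      simp [e2]
  · rw [b1 _ e1]
    simp [e1]

theorem Good.set_spec {p : Pt} (hp : Good p) {t : Tb} {g : Ltr} {e : En} {k : Tb → Bool}
    (h : Tb.set t p g e k = true) :
    ∃ t', k t' = true ∧ ∀ c g', F t' c g' = if c = p.c ∧ g' = g then e else F t c g' := by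
  obtain ⟨t', hk, ht⟩ := Tb.set_digits t p.c p.p1 p.p2 p.p3 p.p4 g e k h
  refine ⟨t', hk, fun c g' => ?_⟩
  by_cases hc : c < 20736
  · have key : (pt c).p1 = p.p1 ∧ (pt c).p2 = p.p2 ∧ (pt c).p3 = p.p3 ∧ (pt c).p4 = p.p4 ↔
        c = p.c := by
      constructor
      · rintro ⟨h1, h2, h3, h4⟩
        have := good_pt hc
        simp only [Good, h1, h2, h3, h4] at this
        exact this.trans hp.symm
      · rintro rfl
        rw [hp.eq_pt]
        exact ⟨rfl, rfl, rfl, rfl⟩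
    simp only [F, if_pos hc]
    refine (ht c _ _ _ _ g').trans ?_
    simp only [pt] at key
    simp only [key]
    rfl
  · have : ¬(c = p.c ∧ g' = g) := fun h' => hc (h'.1 ▸ hp.lt)
    simp only [F, if_neg hc, if_neg this]

theorem F_emp (c : Nat) (g : Ltr) : F emp c g = .no := by
  have h0 : Rw.get g emp0 = .no := by cases g <;> rfl
  have h1 (d : Dig) : Nd.get d emp1 = emp0 := by cases d <;> rfl
  have h2 (d : Dig) : Nd.get d emp2 = emp1 := by cases d <;> rfl
  have h3 (d : Dig) : Nd.get d emp3 = emp2 := by cases d <;> rfl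
  have h4 (d : Dig) : Nd.get d emp4 = emp3 := by cases d <;> rfl
  rw [F]
  split_ifs
  · change Rw.get g (Nd.get _ (Nd.get _ (Nd.get _ (Nd.get _ emp4)))) = _
    rw [h4, h3, h2, h1, h0]
  · rfl

/-- The relation of two Coxeter letters: equal, commuting, or adjacent in the diagram. -/
inductive Cp | eq | com | adj

def Ltr.cmpA (g : Ltr) : Cp :=
  Ltr.rec (motive := fun _ => Cp) .eq .adj .com .com .com .com .com .com .com g

def Ltr.cmpB (g : Ltr) : Cp :=
  Ltr.rec (motive := fun _ => Cp) .adj .eq .adj .com .com .com .com .com .com g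

def Ltr.cmpC (g : Ltr) : Cp :=
  Ltr.rec (motive := fun _ => Cp) .com .adj .eq .adj .com .com .com .com .com g

def Ltr.cmpD (g : Ltr) : Cp :=
  Ltr.rec (motive := fun _ => Cp) .com .com .adj .eq .adj .com .com .adj .com g

def Ltr.cmpE (g : Ltr) : Cp :=
  Ltr.rec (motive := fun _ => Cp) .com .com .com .adj .eq .adj .com .com .com g

def Ltr.cmpF (g : Ltr) : Cp :=
  Ltr.rec (motive := fun _ => Cp) .com .com .com .com .adj .eq .adj .com .com g

def Ltr.cmpG (g : Ltr) : Cp :=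
  Ltr.rec (motive := fun _ => Cp) .com .com .com .com .com .adj .eq .com .com g

def Ltr.cmpH (g : Ltr) : Cp :=
  Ltr.rec (motive := fun _ => Cp) .com .com .com .adj .com .com .com .eq .adj g

def Ltr.cmpI (g : Ltr) : Cp :=
  Ltr.rec (motive := fun _ => Cp) .com .com .com .com .com .com .com .adj .eq g

def Ltr.cmp (l : Ltr) : Ltr → Cp :=
  Ltr.rec (motive := fun _ => Ltr → Cp) Ltr.cmpA Ltr.cmpB Ltr.cmpC Ltr.cmpD Ltr.cmpE Ltr.cmpF Ltr.cmpG Ltr.cmpH Ltr.cmpI l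

theorem Ltr.eq_of_cmp {x y : Ltr} (h : Ltr.cmp x y = .eq) : x = y := by
  cases x <;> cases y <;> first | rfl | exact absurd h (by intro h; cases h)

theorem Ltr.cmp_self (x : Ltr) : Ltr.cmp x x = .eq := by cases x <;> rfl

/-- The Coxeter relations of the diagram, for a family of elements of a group. -/
structure Cox {M : Type*} [Group M] (s : Ltr → M) : Prop where
  sq : ∀ x, s x * s x = 1
  com : ∀ x y, Ltr.cmp x y = .com → s x * s y = s y * s x
  adj : ∀ x y, Ltr.cmp x y = .adj → s x * s y * s x = s y * s x * s y

/-- The value of a word, the first letter acting first. -/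
def ev {M : Type*} [Group M] (s : Ltr → M) : List Ltr → M
  | [] => 1
  | l :: w => ev s w * s l

def powL (n : Nat) (w : List Ltr) : List Ltr :=
  Nat.rec (motive := fun _ => List Ltr) [] (fun _ r => w ++ r) n

def revL (w : List Ltr) : List Ltr :=
  List.rec (motive := fun _ => List Ltr) [] (fun l _ r => r ++ [l]) w

section Ev

variable {M : Type*} [Group M] {s : Ltr → M}

theorem ev_append (v w : List Ltr) : ev s (v ++ w) = ev s w * ev s v := by
  induction v with
  | nil => simp [ev]
  | cons l v ih => simp [ev, ih, mul_assoc]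

theorem ev_powL (n : Nat) (w : List Ltr) : ev s (powL n w) = ev s w ^ n := by
  induction n with
  | zero => simp [powL, ev]
  | succ n ih =>
    change ev s (w ++ powL n w) = _
    rw [ev_append, ih, pow_succ]

theorem Cox.ev_revL (hs : Cox s) (w : List Ltr) : ev s (revL w) = (ev s w)⁻¹ := by
  induction w with
  | nil => simp [ev, revL]
  | cons l w ih =>
    change ev s (revL w ++ [l]) = _
    rw [ev_append, ih]
    simp only [ev, mul_inv_rev, one_mul]
    rw [inv_eq_of_mul_eq_one_right (hs.sq l)]

end Ev

structure RW where
  s : Bool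
  w : List Ltr

abbrev Hs := List Nat

/-- The state of an enumeration: table, next new point, current block of hints, and further
hints. -/
structure St where
  t : Tb
  nx : Pt
  c : Nat
  hs : Hs

abbrev Ks := St → Bool

abbrev Kp := St → Bool → Pt → Bool

/-- Exclusive or, in continuation passing style. -/
def bx (s s' : Bool) (k : Bool → Bool) : Bool :=
  Bool.rec (motive := fun _ => Bool) (k s)
    (Bool.rec (motive := fun _ => Bool) (k true) (k false) s) s'

def popGo (t : Tb) (nx : Pt) (c : Nat) (hs : Hs) (k : Nat → St → Bool) : Bool :=
  force (Nat.div c 16) fun c' => k (Nat.mod c 16) (St.mk t nx c' hs)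

/-- Read the next hint. -/
def pop (st : St) (k : Nat → St → Bool) : Bool :=
  St.rec (motive := fun _ => Bool) (fun t nx c hs =>
    cond (Nat.beq c 1)
      (List.rec (motive := fun _ => Bool) false (fun x xs _ => popGo t nx x xs k) hs)
      (popGo t nx c hs k)) st

/-- Decode a hint: either a letter, or the number of a long relator. -/
def dec (n : Nat) (k : Ltr → Bool) (kl : Nat → Bool) : Bool :=
  Nat.rec (motive := fun _ => Bool) (k .a) (fun n _ =>
  Nat.rec (motive := fun _ => Bool) (k .b) (fun n _ =>
  Nat.rec (motive := fun _ => Bool) (k .c) (fun n _ =>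
  Nat.rec (motive := fun _ => Bool) (k .d) (fun n _ =>
  Nat.rec (motive := fun _ => Bool) (k .e) (fun n _ =>
  Nat.rec (motive := fun _ => Bool) (k .f) (fun n _ =>
  Nat.rec (motive := fun _ => Bool) (k .g) (fun n _ =>
  Nat.rec (motive := fun _ => Bool) (k .h) (fun n _ =>
  Nat.rec (motive := fun _ => Bool) (k .i) (fun n _ => kl n) n) n) n) n) n) n) n) n) n

abbrev EnsT := Pt → Ltr → St → Kp → Bool

/-- Enter `g : α ↦ x` and `g : x ↦ α` into the table. -/
def St.set2 (st : St) (α : Pt) (g : Ltr) (s : Bool) (x : Pt) (k : Ks) : Bool :=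
  St.rec (motive := fun _ => Bool) (fun t nx c hs =>
   Tb.set t α g (.yes s x) fun t => Tb.set t x g (.yes s α) fun t => k (St.mk t nx c hs)) st

/-- Trace a word. -/
def tr (ens : EnsT) (w : List Ltr) : St → Bool → Pt → Kp → Bool :=
  List.rec (motive := fun _ => St → Bool → Pt → Kp → Bool) (fun st s x k => k st s x)
    (fun l _ ih st s x k => ens x l st fun st s' y => bx s s' fun s => ih st s y k) w

def fin2 (α : Pt) (g : Ltr) (k : Kp) : Kp :=
  fun st s x => St.set2 st α g s x fun st => k st s x

/-- Define the image of `α` under `g` as a new point. -/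
def defn (α : Pt) (g : Ltr) (st : St) (k : Kp) : Bool :=
  St.rec (motive := fun _ => Bool) (fun t nx c hs =>
    Tb.set t α g (.yes false nx) fun t => Tb.set t nx g (.yes false α) fun t =>
      Pt.suc nx fun nx' => k (St.mk t nx' c hs) false nx) st

def rotw (n : Nat) (w : List Ltr) : List Ltr := List.drop n w ++ List.take n w

def nthR (rl : List RW) : Nat → RW :=
  List.rec (motive := fun _ => Nat → RW) (fun _ => .mk false [])
    (fun x _ ih n => Nat.rec (motive := fun _ => RW) x (fun m _ => ih m) n) rl

def hdtr (ens : EnsT) (α : Pt) (g : Ltr) (s : Bool) (w : List Ltr) (st : St) (k : Kp) : Bool :=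
  List.rec (motive := fun _ => Bool) false (fun l w _ =>
    Cp.rec (motive := fun _ => Bool) (tr ens w st s α (fin2 α g k)) false false (Ltr.cmp l g)) w

/-- Deduce the image of `α` under `g` from a rotation of a long relator. -/
def longD (rl : List RW) (ens : EnsT) (α : Pt) (g : Ltr) (k : Kp) (st : St) (j : Nat) : Bool :=
  pop st fun d1 st => pop st fun d2 st =>
    RW.rec (motive := fun _ => Bool)
      (fun s w => hdtr ens α g s (rotw (Nat.add (Nat.mul 16 d1) d2) w) st k) (nthR rl j)

/-- Deduce the image of `α` under `g` from the Coxeter relation of `l` and `g`; for `l = g`, define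
a new point. -/
def shortD (ens : EnsT) (α : Pt) (g : Ltr) (k : Kp) (st : St) (l : Ltr) : Bool :=
  Cp.rec (motive := fun _ => Bool) (defn α g st k)
    (tr ens [l, g, l] st false α (fin2 α g k))
    (tr ens [l, g, l, g, l] st false α (fin2 α g k)) (Ltr.cmp l g)

def ded (rl : List RW) (ens : EnsT) (α : Pt) (g : Ltr) (st : St) (k : Kp) : Bool :=
  pop st fun d st => dec d (shortD ens α g k st) (longD rl ens α g k st)

/-- Look up the image of `α` under `g`; if it is not known, deduce it as the hints say. -/
def ens (rl : List RW) (n : Nat) : EnsT :=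
  Nat.rec (motive := fun _ => EnsT) (fun _ _ _ _ => false)
    (fun _ ih α g st k =>
      En.rec (motive := fun _ => Bool) (ded rl ih α g st k) (k st) (Tb.get (St.t st) α g)) n

def ensL (rl : List RW) (α : Pt) (gs : List Ltr) : St → Ks → Bool :=
  List.rec (motive := fun _ => St → Ks → Bool) (fun st k => k st)
    (fun g _ ih st k => ens rl 12 α g st fun st _ _ => ih st k) gs

def loop (rl : List RW) (gs : List Ltr) (n : Nat) : Pt → St → Ks → Bool :=
  Nat.rec (motive := fun _ => Pt → St → Ks → Bool) (fun _ st k => k st)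
    (fun _ ih α st k => cond (Nat.ble (Nat.succ α.c) st.nx.c)
      (ensL rl α gs st fun st => Pt.suc α fun α => ih α st k) false) n

def setL (sub : List Ltr) : Tb → (Tb → Bool) → Bool :=
  List.rec (motive := fun _ => Tb → (Tb → Bool) → Bool) (fun t k => k t)
    (fun g _ ih t k => Tb.set t Pt.zero g (.yes false Pt.zero) fun t => ih t k) sub

/-- Enumerate the cosets of the subgroup generated by `sub` in the group generated by `gs`, as the
hints `hs` say. Continue with the table, if there are `n` cosets. -/
def run (rl : List RW) (gs sub : List Ltr) (n : Nat) (hs : Hs) (k : Tb → Bool) : Bool :=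
  setL sub emp fun t => Pt.suc Pt.zero fun nx =>
    loop rl gs n Pt.zero (St.mk t nx 1 hs) fun st => cond (Nat.beq st.nx.c n) (k st.t) false

theorem bx_eq (s s' : Bool) (k : Bool → Bool) : bx s s' k = k (s ^^ s') := by
  cases s <;> cases s' <;> rfl

section Soundness

variable {M : Type*} [Group M] (s : Ltr → M) (K : Subgroup M)

/-- The word `w` takes the coset of `x c` to the coset of `x c'`. -/
def RelW (x : ℕ → M) (c : ℕ) (w : List Ltr) (c' : ℕ) : Prop := (x c')⁻¹ * ev s w * x c ∈ K

/-- The table of the state is correct, if the point `c` is taken to be the coset `x c * K`. -/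
structure Inv (x : ℕ → M) (st : St) : Prop where
  good : Good st.nx
  tab : ∀ c g b β, F st.t c g = .yes b β →
    Good β ∧ β.c < st.nx.c ∧ c < st.nx.c ∧ RelW s K x c [g] β.c

structure Ext (x : ℕ → M) (st : St) (x' : ℕ → M) (st' : St) : Prop where
  le : st.nx.c ≤ st'.nx.c
  eq : ∀ c < st.nx.c, x' c = x c
  mono : ∀ c g, F st.t c g ≠ .no → F st'.t c g ≠ .no

structure Old (st : St) (α : Pt) : Prop where
  good : Good α
  lt : α.c < st.nx.c

variable {s K}

theorem Ext.refl (x : ℕ → M) (st : St) : Ext x st x st := ⟨le_rfl, fun _ _ => rfl, fun _ _ => id⟩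

theorem Ext.trans {x x' x'' : ℕ → M} {st st' st'' : St} (h : Ext x st x' st')
    (h' : Ext x' st' x'' st'') : Ext x st x'' st'' :=
  ⟨h.le.trans h'.le, fun c hc => (h'.eq c (hc.trans_le h.le)).trans (h.eq c hc),
    fun c g hc => h'.mono c g (h.mono c g hc)⟩

theorem Ext.old {x x' : ℕ → M} {st st' : St} (h : Ext x st x' st') {α : Pt} (hα : Old st α) :
    Old st' α := ⟨hα.good, hα.lt.trans_le h.le⟩

theorem Ext.relW {x x' : ℕ → M} {st st' : St} (h : Ext x st x' st') {α β : Pt} (hα : Old st α)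
    (hβ : Old st β) {w : List Ltr} (hr : RelW s K x α.c w β.c) : RelW s K x' α.c w β.c := by
  rwa [RelW, h.eq _ hα.lt, h.eq _ hβ.lt]

theorem RelW.cons {x : ℕ → M} {c c' c'' : ℕ} {l : Ltr} {w : List Ltr} (h : RelW s K x c [l] c')
    (h' : RelW s K x c' w c'') : RelW s K x c (l :: w) c'' := by
  have := K.mul_mem h' h
  simp only [ev, one_mul] at this
  have e : (x c'')⁻¹ * ev s w * x c' * ((x c')⁻¹ * s l * x c) =
    (x c'')⁻¹ * ev s (l :: w) * x c := by simp only [ev]; group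
  rwa [e] at this

theorem RelW.symm (hs : Cox s) {x : ℕ → M} {c c' : ℕ} {g : Ltr} (h : RelW s K x c [g] c') :
    RelW s K x c' [g] c := by
  have := K.inv_mem h
  simp only [ev, one_mul, mul_inv_rev, inv_inv, inv_eq_of_mul_eq_one_right (hs.sq g),
    ← mul_assoc] at this
  simpa only [RelW, ev, one_mul] using this

theorem RelW.of_ev_eq {x : ℕ → M} {c c' : ℕ} {w w' : List Ltr} (e : ev s w = ev s w')
    (h : RelW s K x c w c') : RelW s K x c w' c' := by
  rwa [RelW, ← e]

theorem pop_spec {st : St} {k : Nat → St → Bool} (h : pop st k = true) :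
    ∃ n st', k n st' = true ∧ st'.t = st.t ∧ st'.nx = st.nx := by
  obtain ⟨t, nx, c, hs⟩ := st
  simp only [pop] at h
  cases hc : Nat.beq c 1 with
  | false =>
    rw [hc] at h
    simp only [cond_false, popGo, force_eq] at h
    exact ⟨_, _, h, rfl, rfl⟩
  | true =>
    rw [hc] at h
    cases hs with
    | nil => exact absurd h Bool.false_ne_true
    | cons y ys =>
      simp only [cond_true, popGo, force_eq] at h
      exact ⟨_, _, h, rfl, rfl⟩

theorem dec_spec {n : Nat} {k : Ltr → Bool} {kl : Nat → Bool} (h : dec n k kl = true) :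
    (∃ l, k l = true) ∨ ∃ j, kl j = true := by
  match n, h with
  | 0, h | 1, h | 2, h | 3, h | 4, h | 5, h | 6, h | 7, h | 8, h => exact Or.inl ⟨_, h⟩
  | n + 9, h => exact Or.inr ⟨n, h⟩

theorem Inv.set2 (hs : Cox s) {x : ℕ → M} {st : St} (hi : Inv s K x st) {α β : Pt}
    (hα : Old st α) (hβ : Old st β) {g : Ltr} {b : Bool} (hr : RelW s K x α.c [g] β.c) {k : Ks}
    (h : St.set2 st α g b β k = true) :
    ∃ st', Inv s K x st' ∧ Ext x st x st' ∧ F st'.t α.c g ≠ .no ∧ k st' = true := by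
  obtain ⟨t, nx, c, hl⟩ := st
  obtain ⟨t1, h, e1⟩ := hα.good.set_spec h
  obtain ⟨t2, h, e2⟩ := hβ.good.set_spec h
  refine ⟨⟨t2, nx, c, hl⟩, ⟨hi.good, fun c' g' b' γ e => ?_⟩,
    ⟨le_rfl, fun _ _ => rfl, fun c' g' e => ?_⟩, ?_, h⟩
  · simp only [e1, e2] at e
    split_ifs at e with h1 h2
    · obtain ⟨rfl, rfl⟩ := h1
      cases e
      exact ⟨hα.good, hα.lt, hβ.lt, hr.symm hs⟩
    · obtain ⟨rfl, rfl⟩ := h2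
      cases e
      exact ⟨hβ.good, hβ.lt, hα.lt, hr⟩
    · exact hi.tab c' g' b' γ e
  · simp only [e1, e2]
    split_ifs
    · exact En.noConfusion
    · exact En.noConfusion
    · exact e
  · simp only [e1, e2]
    by_cases h1 : α.c = β.c
    · simp [h1]
    · simp [h1]

variable (s K) in
def EnsOK (ens : EnsT) : Prop := ∀ (x : ℕ → M) (st : St) (α : Pt) (g : Ltr) (k : Kp),
  Inv s K x st → Old st α → ens α g st k = true → ∃ x' st' b β, Inv s K x' st' ∧
    Ext x st x' st' ∧ Old st' β ∧ RelW s K x' α.c [g] β.c ∧ F st'.t α.c g ≠ .no ∧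
    k st' b β = true

theorem EnsOK.tr {ens : EnsT} (he : EnsOK s K ens) (w : List Ltr) : ∀ (x : ℕ → M) (st : St)
    (b : Bool) (α : Pt) (k : Kp), Inv s K x st → Old st α → tr ens w st b α k = true →
    ∃ x' st' b' β, Inv s K x' st' ∧ Ext x st x' st' ∧ Old st' β ∧ RelW s K x' α.c w β.c ∧
    k st' b' β = true := by
  induction w with
  | nil =>
    intro x st b α k hi hα h
    exact ⟨x, st, b, α, hi, .refl _ _, hα, by simp [RelW, ev, K.one_mem], h⟩
  | cons l w ih =>
    intro x st b α k hi hα h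
    obtain ⟨x1, st1, b1, β1, hi1, e1, o1, r1, -, h⟩ := he x st α l _ hi hα h
    rw [bx_eq] at h
    obtain ⟨x2, st2, b2, β2, hi2, e2, o2, r2, h⟩ := ih x1 st1 _ β1 k hi1 o1 h
    exact ⟨x2, st2, b2, β2, hi2, e1.trans e2, o2,
      (e2.relW (e1.old hα) o1 r1).cons r2, h⟩

theorem EnsOK.tr_fin2 {ens : EnsT} (hs : Cox s) (he : EnsOK s K ens) {w : List Ltr} {g : Ltr}
    (hw : ev s w = s g) {x : ℕ → M} {st : St} {b : Bool} {α : Pt} {k : Kp} (hi : Inv s K x st)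
    (hα : Old st α) (h : Fi22.tr ens w st b α (fin2 α g k) = true) :
    ∃ x' st' b β, Inv s K x' st' ∧ Ext x st x' st' ∧ Old st' β ∧ RelW s K x' α.c [g] β.c ∧
      F st'.t α.c g ≠ .no ∧ k st' b β = true := by
  obtain ⟨x1, st1, b1, β, hi1, e1, o1, r1, h⟩ := he.tr w x st b α _ hi hα h
  have r := r1.of_ev_eq (w' := [g]) (by simpa [ev] using hw)
  obtain ⟨st2, hi2, e2, f2, h⟩ := hi1.set2 hs (e1.old hα) o1 r h
  exact ⟨x1, st2, b1, β, hi2, e1.trans e2, e2.old o1, r, f2, h⟩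

theorem Inv.defn (hs : Cox s) {x : ℕ → M} {st : St} (hi : Inv s K x st) {α : Pt}
    (hα : Old st α) {g : Ltr} {k : Kp} (h : defn α g st k = true) :
    ∃ x' st' b β, Inv s K x' st' ∧ Ext x st x' st' ∧ Old st' β ∧ RelW s K x' α.c [g] β.c ∧
      F st'.t α.c g ≠ .no ∧ k st' b β = true := by
  obtain ⟨t, nx, c, hl⟩ := st
  obtain ⟨t1, h, e1⟩ := hα.good.set_spec h
  obtain ⟨t2, h, e2⟩ := Good.set_spec hi.good h
  obtain ⟨nx', g', n', h⟩ := Good.suc_spec hi.good h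
  have hα0 : α.c < nx.c := hα.lt
  have hne : α.c ≠ nx.c := hα0.ne
  simp only at n' e1 e2
  set x' : ℕ → M := Function.update x nx.c (s g * x α.c) with hx'
  have hx (c : ℕ) (hc : c < nx.c) : x' c = x c := Function.update_of_ne hc.ne _ _
  have hr : RelW s K x' α.c [g] nx.c := by
    rw [RelW, hx _ hα0, hx', Function.update_self]
    simp [ev, K.one_mem]
  refine ⟨x', ⟨t2, nx', c, hl⟩, false, nx, ⟨g', fun c' g'' b' γ e => ?_⟩,
    ⟨by simp [n'], hx, fun c' g'' e => ?_⟩, ⟨hi.good, by simp [n']⟩, hr, ?_, h⟩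
  · simp only [e1, e2] at e
    simp only [n']
    split_ifs at e with h1 h2
    · obtain ⟨rfl, rfl⟩ := h1
      cases e
      exact ⟨hα.good, by omega, by omega, hr.symm hs⟩
    · obtain ⟨rfl, rfl⟩ := h2
      cases e
      exact ⟨hi.good, by omega, by omega, hr⟩
    · obtain ⟨i1, i2, i3, i4⟩ := hi.tab c' g'' b' γ e
      simp only at i2 i3
      refine ⟨i1, by omega, by omega, ?_⟩
      rwa [RelW, hx _ i2, hx _ i3]
  · simp only [e1, e2]
    split_ifs
    · exact En.noConfusion
    · exact En.noConfusion
    · exact e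
  · simp [e1, e2, hne]

theorem ev_rotw (n : ℕ) {w : List Ltr} (h : ev s w = 1) : ev s (rotw n w) = 1 := by
  rw [← List.take_append_drop n w, ev_append] at h
  rw [rotw, ev_append]
  exact mul_eq_one_comm.mp h

variable (s) in
def RelOK (rl : List RW) : Prop := ∀ r ∈ rl, ev s r.w = 1

theorem RelOK.nthR {rl : List RW} (h : RelOK s rl) (n : ℕ) : ev s (Fi22.nthR rl n).w = 1 := by
  induction rl generalizing n with
  | nil => rfl
  | cons r rl ih =>
    cases n with
    | zero => exact h r (by simp)
    | succ n => exact ih (fun r' hr' => h r' (by simp [hr'])) n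

theorem EnsOK.ded (hs : Cox s) {rl : List RW} (hrl : RelOK s rl) {ens : EnsT}
    (he : EnsOK s K ens) {x : ℕ → M} {st : St} (hi : Inv s K x st) {α : Pt} (hα : Old st α)
    {g : Ltr} {k : Kp} (h : ded rl ens α g st k = true) :
    ∃ x' st' b β, Inv s K x' st' ∧ Ext x st x' st' ∧ Old st' β ∧ RelW s K x' α.c [g] β.c ∧
      F st'.t α.c g ≠ .no ∧ k st' b β = true := by
  have key (st₁ : St) (h1 : st₁.t = st.t) (h2 : st₁.nx = st.nx) :
      Inv s K x st₁ ∧ Ext x st x st₁ ∧ Old st₁ α := by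
    refine ⟨⟨h2 ▸ hi.good, ?_⟩, ⟨h2 ▸ le_rfl, fun _ _ => rfl, ?_⟩, hα.good, h2 ▸ hα.lt⟩
    · rw [h1, h2]
      exact hi.tab
    · rw [h1]
      exact fun _ _ => id
  have key' {st₁ : St} (he : Ext x st x st₁) {x' st' b β} (h' : Inv s K x' st' ∧
      Ext x st₁ x' st' ∧ Old st' β ∧ RelW s K x' α.c [g] β.c ∧
      F st'.t α.c g ≠ .no ∧ k st' b β = true) : Inv s K x' st' ∧ Ext x st x' st' ∧ Old st' β ∧
      RelW s K x' α.c [g] β.c ∧ F st'.t α.c g ≠ .no ∧ k st' b β = true :=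
    ⟨h'.1, he.trans h'.2.1, h'.2.2⟩
  obtain ⟨d, st1, h, a1, b1⟩ := pop_spec h
  rcases dec_spec h with ⟨l, h⟩ | ⟨j, h⟩
  · obtain ⟨i1, e1, o1⟩ := key st1 a1 b1
    rw [shortD] at h
    cases hc : Ltr.cmp l g with
    | eq =>
      rw [hc] at h
      obtain ⟨x', st', b, β, r⟩ := i1.defn hs o1 h
      exact ⟨x', st', b, β, key' e1 r⟩
    | com =>
      rw [hc] at h
      have hw : ev s [l, g, l] = s g := by
        simp only [ev, one_mul]
        rw [hs.com l g hc, mul_assoc, hs.sq, mul_one]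
      obtain ⟨x', st', b, β, r⟩ := he.tr_fin2 hs hw i1 o1 h
      exact ⟨x', st', b, β, key' e1 r⟩
    | adj =>
      rw [hc] at h
      have hw : ev s [l, g, l, g, l] = s g := by
        simp only [ev, one_mul]
        rw [hs.adj l g hc, mul_assoc (s g * s l) (s g), hs.sq, mul_one, mul_assoc, hs.sq, mul_one]
      obtain ⟨x', st', b, β, r⟩ := he.tr_fin2 hs hw i1 o1 h
      exact ⟨x', st', b, β, key' e1 r⟩
  · obtain ⟨d1, st2, h, a2, b2⟩ := pop_spec h
    obtain ⟨d2, st3, h, a3, b3⟩ := pop_spec h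
    obtain ⟨i1, e1, o1⟩ := key st3 (a3.trans (a2.trans a1)) (b3.trans (b2.trans b1))
    have hw := ev_rotw (Nat.add (Nat.mul 16 d1) d2) (hrl.nthR j)
    generalize Fi22.nthR rl j = r at h hw
    obtain ⟨b, w⟩ := r
    simp only at h hw
    generalize rotw _ w = w' at h hw
    cases w' with
    | nil => exact absurd h Bool.false_ne_true
    | cons l w' =>
      simp only [hdtr] at h
      cases hc : Ltr.cmp l g with
      | com => rw [hc] at h; exact absurd h Bool.false_ne_true
      | adj => rw [hc] at h; exact absurd h Bool.false_ne_true
      | eq =>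
        rw [hc] at h
        obtain rfl := Ltr.eq_of_cmp hc
        have hw' : ev s w' = s l := by
          rw [ev] at hw
          rw [eq_inv_of_mul_eq_one_left hw, inv_eq_of_mul_eq_one_right (hs.sq l)]
        obtain ⟨x', st', b, β, r⟩ := he.tr_fin2 hs hw' i1 o1 h
        exact ⟨x', st', b, β, key' e1 r⟩

theorem ensOK (hs : Cox s) {rl : List RW} (hrl : RelOK s rl) (n : ℕ) :
    EnsOK s K (ens rl n) := by
  induction n with
  | zero => exact fun x st α g k _ _ h => absurd h Bool.false_ne_true
  | succ n ih =>
    intro x st α g k hi hα h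
    change En.rec (motive := fun _ => Bool) (ded rl (ens rl n) α g st k) (k st)
      (Tb.get (St.t st) α g) = true at h
    rw [hα.good.get_eq] at h
    cases hF : F st.t α.c g with
    | no =>
      rw [hF] at h
      exact ih.ded hs hrl hi hα h
    | yes b β =>
      rw [hF] at h
      obtain ⟨h1, h2, h3, h4⟩ := hi.tab _ _ _ _ hF
      exact ⟨x, st, b, β, hi, .refl _ _, ⟨h1, h2⟩, h4, by simp [hF], h⟩

theorem ensL_spec (hs : Cox s) {rl : List RW} (hrl : RelOK s rl) {α : Pt} (gs : List Ltr) :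
    ∀ (x : ℕ → M) (st : St) (k : Ks), Inv s K x st → Old st α → ensL rl α gs st k = true →
    ∃ x' st', Inv s K x' st' ∧ Ext x st x' st' ∧ (∀ g ∈ gs, F st'.t α.c g ≠ .no) ∧
      k st' = true := by
  induction gs with
  | nil =>
    intro x st k hi hα h
    exact ⟨x, st, hi, .refl _ _, by simp, h⟩
  | cons g gs ih =>
    intro x st k hi hα h
    obtain ⟨x1, st1, b1, β, i1, e1, o1, r1, f1, h⟩ := ensOK hs hrl 12 x st α g _ hi hα h
    obtain ⟨x2, st2, i2, e2, f2, h⟩ := ih x1 st1 k i1 (e1.old hα) h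
    exact ⟨x2, st2, i2, e1.trans e2, by
      simpa using ⟨e2.mono _ _ f1, f2⟩, h⟩

theorem loop_spec (hs : Cox s) {rl : List RW} (hrl : RelOK s rl) (gs : List Ltr) (n : ℕ) :
    ∀ (x : ℕ → M) (st : St) (α : Pt) (k : Ks), Inv s K x st → Good α →
    (∀ c < α.c, ∀ g ∈ gs, F st.t c g ≠ .no) → loop rl gs n α st k = true →
    ∃ x' st', Inv s K x' st' ∧ Ext x st x' st' ∧
      (∀ c < α.c + n, ∀ g ∈ gs, F st'.t c g ≠ .no) ∧ k st' = true := by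
  induction n with
  | zero =>
    intro x st α k hi hα hF h
    exact ⟨x, st, hi, .refl _ _, hF, h⟩
  | succ n ih =>
    intro x st α k hi hα hF h
    change cond (Nat.ble (Nat.succ α.c) st.nx.c)
      (ensL rl α gs st fun st => Pt.suc α fun α => loop rl gs n α st k) false = true at h
    cases hc : Nat.ble (Nat.succ α.c) st.nx.c with
    | false => rw [hc] at h; exact absurd h Bool.false_ne_true
    | true =>
      rw [hc] at h
      obtain ⟨x1, st1, i1, e1, f1, h⟩ :=
        ensL_spec hs hrl gs x st _ hi ⟨hα, Nat.le_of_ble_eq_true hc⟩ h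
      obtain ⟨β, hβ, hc, h⟩ := hα.suc_spec h
      obtain ⟨x2, st2, i2, e2, f2, h⟩ := ih x1 st1 β k i1 hβ (fun c hc' g hg => by
        rcases Nat.lt_or_ge c α.c with h' | h'
        · exact e1.mono _ _ (hF c h' g hg)
        · obtain rfl : c = α.c := by omega
          exact f1 g hg) h
      exact ⟨x2, st2, i2, e1.trans e2, fun c hc' => f2 c (by omega), h⟩

theorem setL_spec (P : ℕ → Ltr → Bool → Pt → Prop) {sub : List Ltr}
    (hP : ∀ g ∈ sub, P 0 g false Pt.zero) : ∀ (t : Tb) (k : Tb → Bool),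
    (∀ c g b β, F t c g = .yes b β → P c g b β) → setL sub t k = true →
    ∃ t', k t' = true ∧ ∀ c g b β, F t' c g = .yes b β → P c g b β := by
  induction sub with
  | nil => exact fun t k ht h => ⟨t, h, ht⟩
  | cons g sub ih =>
    intro t k ht h
    change Tb.set t Pt.zero g (.yes false Pt.zero) (fun t => setL sub t k) = true at h
    obtain ⟨t1, h, e1⟩ := good_zero.set_spec h
    refine ih (fun g hg => hP g (by simp [hg])) t1 k (fun c g' b β e => ?_) h
    rw [e1] at e
    split_ifs at e with h1
    · obtain ⟨rfl, rfl⟩ := h1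
      cases e
      exact hP _ (by simp)
    · exact ht c g' b β e

/-- The result of an enumeration of `n` cosets: a complete and correct coset table. -/
structure IsTable (s : Ltr → M) (K : Subgroup M) (gs : List Ltr) (n : ℕ) (x : ℕ → M) (t : Tb) :
    Prop where
  pos : 0 < n
  one : x 0 = 1
  tab : ∀ c g b β, F t c g = .yes b β → Good β ∧ β.c < n ∧ c < n ∧ RelW s K x c [g] β.c
  full : ∀ c < n, ∀ g ∈ gs, F t c g ≠ .no

theorem run_spec (hs : Cox s) {rl : List RW} (hrl : RelOK s rl) {gs sub : List Ltr}
    (hK : ∀ g ∈ sub, s g ∈ K) {n : ℕ} {hl : Hs} {k : Tb → Bool}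
    (h : run rl gs sub n hl k = true) : ∃ x t, IsTable s K gs n x t ∧ k t = true := by
  obtain ⟨t1, h, e1⟩ := setL_spec (sub := sub) (fun c g _ β => c = 0 ∧ β = Pt.zero ∧ s g ∈ K)
    (fun g hg => ⟨rfl, rfl, hK g hg⟩) emp _ (fun c g b β e => by simp [F_emp] at e) h
  obtain ⟨nx, g1, c1, h⟩ := good_zero.suc_spec h
  have hc1 : nx.c = 1 := c1
  have hi : Inv s K (fun _ => 1) (St.mk t1 nx 1 hl) := by
    refine ⟨g1, fun c g b β e => ?_⟩
    obtain ⟨rfl, rfl, hg⟩ := e1 c g b β e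
    refine ⟨good_zero, ?_, ?_, ?_⟩
    · simp [hc1, Pt.zero]
    · simp [hc1]
    · simpa [RelW, ev] using hg
  obtain ⟨x, st, i, e, f, h⟩ := loop_spec hs hrl gs n _ _ Pt.zero _ hi good_zero
    (fun c hc => absurd hc (Nat.not_lt_zero c)) h
  cases hn : Nat.beq st.nx.c n with
  | false => rw [hn] at h; exact absurd h Bool.false_ne_true
  | true =>
    rw [hn] at h
    have hn' := Nat.eq_of_beq_eq_true hn
    have hp : 0 < nx.c := by omega
    refine ⟨x, st.t, ⟨?_, e.eq 0 hp, ?_, fun c hc => f c ?_⟩, h⟩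
    · have := e.le
      simp only at this
      omega
    · rw [← hn']
      exact i.tab
    · simpa [Pt.zero] using hc

/-- The index of a subgroup is at most the number of points of a coset table. -/
theorem IsTable.card_le (hs : Cox s) {gs : List Ltr} {n : ℕ} {x : ℕ → M} {t : Tb}
    (ht : IsTable s K gs n x t) (hK : Finite K) :
    Finite (Subgroup.closure (Set.image s {g | g ∈ gs})) ∧
      Nat.card (Subgroup.closure (Set.image s {g | g ∈ gs})) ≤ n * Nat.card K := by
  let f : Fin n × K → M := fun p => x p.1 * p.2
  have hsub : (Subgroup.closure (Set.image s {g | g ∈ gs}) : Set M) ⊆ Set.range f := by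
    intro y hy
    have step (g : Ltr) (hg : g ∈ gs) (y : M) (hy : y ∈ Set.range f) : s g * y ∈ Set.range f := by
      obtain ⟨⟨c, k⟩, rfl⟩ := hy
      cases hF : F t c g with
      | no => exact absurd hF (ht.full c c.2 g hg)
      | yes b β =>
        obtain ⟨-, h2, -, h4⟩ := ht.tab c g b β hF
        refine ⟨⟨⟨β.c, h2⟩, ⟨_, K.mul_mem h4 k.2⟩⟩, ?_⟩
        simp [f, ev, mul_assoc]
    induction hy using Subgroup.closure_induction_left with
    | one => exact ⟨⟨⟨0, ht.pos⟩, 1⟩, by simp [f, ht.one]⟩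
    | mul_left z hz y _ ih =>
      obtain ⟨g, hg, rfl⟩ := hz
      exact step g hg y ih
    | inv_mul_cancel z hz y _ ih =>
      obtain ⟨g, hg, rfl⟩ := hz
      rw [inv_eq_of_mul_eq_one_right (hs.sq g)]
      exact step g hg y ih
  have hfin : Finite (Fin n × K) := inferInstance
  refine ⟨(Set.finite_range f).subset hsub, ?_⟩
  calc Nat.card (Subgroup.closure (Set.image s {g | g ∈ gs})) ≤ Nat.card (Set.range f) :=
        Nat.card_mono (Set.finite_range f) hsub
    _ ≤ Nat.card (Fin n × K) := Finite.card_range_le f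
    _ = n * Nat.card K := by simp

end Soundness

def wR : List Ltr := powL 4 [.b, .c, .d, .h, .e, .f, .d, .e, .c, .d, .h, .i]

def wE : List Ltr := [.a, .b, .c, .d, .e, .f, .h]

def wE' : List Ltr := [.b, .c, .d, .e, .f, .g, .h]

def wU : List Ltr := powL 9 wE

def wV : List Ltr := powL 9 wE'

def rls : List RW :=
  [.mk false wR, .mk false (revL wR), .mk false wU, .mk false (revL wU), .mk true wV,
    .mk true (revL wV)]

/-- Look up the image of the signed point `(s, x)` under `g`. -/
def app (t : Tb) (g : Ltr) (s : Bool) (x : Pt) (k : Bool → Pt → Bool) : Bool :=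
  En.rec (motive := fun _ => Bool) false (fun b β => bx s b fun s => k s β) (Tb.get t x g)

/-- Look up the image of a signed point under a word. -/
def appW (t : Tb) (w : List Ltr) : Bool → Pt → (Bool → Pt → Bool) → Bool :=
  List.rec (motive := fun _ => Bool → Pt → (Bool → Pt → Bool) → Bool) (fun s x k => k s x)
    (fun l _ ih s x k => app t l s x fun s y => ih s y k) w

/-- The point `α` with sign `s` is `β`. -/
def is (s : Bool) (α : Nat) (s' : Bool) (β : Pt) : Bool :=
  bx s s' fun d => cond d false (Nat.beq β.c α)

/-- Conjunction over a list. -/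
def allL {A : Type} (l : List A) (P : A → Bool) : Bool :=
  List.rec (motive := fun _ => Bool) true (fun x _ ih => cond (P x) ih false) l

/-- Conjunction over `n` consecutive points. -/
def allP (n : Nat) : Pt → (Pt → Bool) → Bool :=
  Nat.rec (motive := fun _ => Pt → (Pt → Bool) → Bool) (fun _ _ => true)
    (fun _ ih α P => cond (P α) (Pt.suc α fun α => ih α P) false) n

/-- A letter together with the image of a point. -/
structure Im where
  g : Ltr
  s : Bool
  p : Pt

/-- Check the relation of two letters at the number `α`, given their images. -/
def dih (t : Tb) (x y : Im) : Bool :=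
  Im.rec (motive := fun _ => Bool) (fun g s β => Im.rec (motive := fun _ => Bool) (fun h s' γ =>
    Cp.rec (motive := fun _ => Bool) true
      (app t h s β fun s β => app t g s' γ fun s' γ => is s β.c s' γ)
      (appW t [h, g] s β fun s β => appW t [g, h] s' γ fun s' γ => is s β.c s' γ)
      (Ltr.cmp g h)) y) x

def dihs (t : Tb) (l : List Im) : Bool :=
  List.rec (motive := fun _ => Bool) true (fun x l ih => cond (allL l (dih t x)) ih false) l

/-- Check that the letters in `l` act as involutions on `α`, without changing the sign if they fix
`α`; continue with the images that are not smaller than `α`. -/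
def invs (t : Tb) (α : Pt) (l : List Ltr) : List Im → (List Im → Bool) → Bool :=
  List.rec (motive := fun _ => List Im → (List Im → Bool) → Bool) (fun m k => k m)
    (fun g _ ih m k => app t g false α fun s β =>
      cond (app t g s β (is false α.c)) (cond (Nat.ble α.c β.c)
        (cond (cond (Nat.beq α.c β.c) s false) false (ih (.mk g s β :: m) k)) (ih m k)) false) l

/-- Check at `α` that `w ^ n` is trivial, or the sign change if `e` is true, unless a smaller power
takes `α` to a smaller point. -/
def walk (t : Tb) (w : List Ltr) (e : Bool) (α : Nat) (n : Nat) : Bool → Pt → Bool :=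
  Nat.rec (motive := fun _ => Bool → Pt → Bool) (is e α)
    (fun _ ih s β => appW t w s β fun s γ => cond (Nat.ble α γ.c) (ih s γ) true) n

def wH : List Ltr := [.d, .c, .b, .d, .e, .f, .d, .h, .i]

def lts : List Ltr := [.a, .b, .c, .d, .e, .f, .g, .h, .i]

/-- Check that the table describes an action of the group. -/
def chk (sv : Bool) (t : Tb) (α : Pt) : Bool :=
  cond (invs t α lts [] (dihs t)) (cond (walk t wH false α.c 10 false α)
    (cond (walk t wE false α.c 9 false α) (walk t wE' sv α.c 9 false α) false) false) false

/-! ### Permutations described by a table -/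

/-- The table is complete on the first `n` points. -/
def Tot (t : Tb) (n : ℕ) : Prop := ∀ c < n, ∀ g, ∃ b β, F t c g = .yes b β ∧ Good β ∧ β.c < n

theorem mem_lts (g : Ltr) : g ∈ lts := by cases g <;> decide

theorem IsTable.tot {M : Type*} [Group M] {s : Ltr → M} {K : Subgroup M} {n : ℕ} {x : ℕ → M} {t : Tb}
    (h : IsTable s K lts n x t) : Tot t n := by
  intro c hc g
  cases e : F t c g with
  | no => exact absurd e (h.full c hc g (mem_lts g))
  | yes b β => exact ⟨b, β, rfl, (h.tab c g b β e).1, (h.tab c g b β e).2.1⟩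

/-- The map of signed points given by a letter. -/
def actF (t : Tb) (n : ℕ) (g : Ltr) (x : ℕ × Bool) : ℕ × Bool :=
  if x.1 < n then En.casesOn (F t x.1 g) x fun b β => (β.c, x.2 ^^ b) else x

/-- The map of signed points given by a word. -/
def actW (t : Tb) (n : ℕ) (w : List Ltr) (x : ℕ × Bool) : ℕ × Bool :=
  w.foldl (fun x g => actF t n g x) x

def flip : Equiv.Perm (ℕ × Bool) := (Equiv.refl ℕ).prodCongr Equiv.boolNot

@[simp] theorem flip_apply (x : ℕ × Bool) : flip x = (x.1, !x.2) := rfl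

section Act

variable {t : Tb} {n : ℕ}

theorem actF_flip (g : Ltr) (x : ℕ × Bool) : actF t n g (flip x) = flip (actF t n g x) := by
  by_cases h : x.1 < n
  · simp only [actF, flip_apply, h, if_true]
    cases F t x.1 g <;> simp
  · simp [actF, h]

theorem cond_eq_true {p q : Bool} (h : cond p q false = true) : p = true ∧ q = true := by
  cases p
  · cases h
  · exact ⟨rfl, h⟩

theorem allP_spec {P : Pt → Bool} (n : ℕ) : ∀ {α : Pt}, Good α → allP n α P = true →
    ∀ c, α.c ≤ c → c < α.c + n → P (pt c) = true := by
  induction n with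
  | zero => intros; omega
  | succ n ih =>
    intro α hα h c h1 h2
    change cond (P α) (Pt.suc α fun α => allP n α P) false = true at h
    obtain ⟨hP, h⟩ := cond_eq_true h
    obtain ⟨q, hq, e, h⟩ := hα.suc_spec h
    rcases h1.eq_or_lt with rfl | h1
    · rwa [hα.eq_pt]
    · exact ih hq h c (by omega) (by omega)

theorem allL_spec {A : Type} {l : List A} {P : A → Bool} (h : allL l P = true) : ∀ x ∈ l, P x = true := by
  induction l with
  | nil => simp
  | cons x l ih =>
    change cond (P x) (allL l P) false = true at h
    obtain ⟨hP, h⟩ := cond_eq_true h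
    simp only [List.mem_cons, forall_eq_or_imp]
    exact ⟨hP, ih h⟩

variable (ht : Tot t n)
include ht

theorem app_spec {g : Ltr} {s : Bool} {x : Pt} {k : Bool → Pt → Bool} (hx : Good x) (hn : x.c < n)
    (h : app t g s x k = true) :
    ∃ s' β, Good β ∧ β.c < n ∧ actF t n g (x.c, s) = (β.c, s') ∧ k s' β = true := by
  obtain ⟨b, β, e, h1, h2⟩ := ht x.c hn g
  unfold app at h
  rw [hx.get_eq, e] at h
  simp only [bx_eq] at h
  exact ⟨_, β, h1, h2, by simp [actF, hn, e], h⟩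

theorem appW_spec {w : List Ltr} {k : Bool → Pt → Bool} : ∀ {s : Bool} {x : Pt}, Good x → x.c < n →
    appW t w s x k = true →
    ∃ s' β, Good β ∧ β.c < n ∧ actW t n w (x.c, s) = (β.c, s') ∧ k s' β = true := by
  induction w with
  | nil => exact fun {s x} hx hn h => ⟨s, x, hx, hn, rfl, h⟩
  | cons l w ih =>
    intro s x hx hn h
    change app t l s x (fun s y => appW t w s y k) = true at h
    obtain ⟨s1, β, h1, h2, h3, h⟩ := app_spec ht hx hn h
    obtain ⟨s2, γ, h4, h5, h6, h⟩ := ih h1 h2 h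
    exact ⟨s2, γ, h4, h5, by simpa [actW, h3] using h6, h⟩

end Act

theorem is_spec {s : Bool} {α : ℕ} {s' : Bool} {β : Pt} (h : is s α s' β = true) : (β.c, s') = (α, s) := by
  unfold is at h
  rw [bx_eq] at h
  cases s <;> cases s' <;> first | (cases h; done) | exact congrArg (·, _) (Nat.eq_of_beq_eq_true h)

/-- A permutation is trivial if, at each point, it is so or it is normalized by a permutation that
takes the point to a smaller one. -/
theorem eq_one_of_local {n : ℕ} {ρ : Equiv.Perm (ℕ × Bool)} (hf : Commute ρ flip)
    (ho : ∀ c, n ≤ c → ρ (c, false) = (c, false))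
    (h : ∀ c < n, ρ (c, false) = (c, false) ∨ ∃ τ : Equiv.Perm (ℕ × Bool),
      (τ (c, false)).1 < c ∧ (τ * ρ = ρ * τ ∨ τ * ρ = ρ⁻¹ * τ)) : ρ = 1 := by
  have key (c : ℕ) : ∀ s, ρ (c, s) = (c, s) := by
    induction c using Nat.strong_induction_on with
    | _ c ih =>
      have h0 : ρ (c, false) = (c, false) := by
        rcases lt_or_ge c n with hc | hc
        · rcases h c hc with h | ⟨τ, h1, h2⟩
          · exact h
          · have h3 : ρ (τ (c, false)) = τ (c, false) := ih _ h1 _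
            apply τ.injective
            rcases h2 with h2 | h2
            · rw [← Equiv.Perm.mul_apply, h2, Equiv.Perm.mul_apply, h3]
            · rw [← Equiv.Perm.mul_apply, h2, Equiv.Perm.mul_apply, Equiv.Perm.inv_eq_iff_eq, h3]
        · exact ho c hc
      intro s
      cases s
      · exact h0
      · have := congrArg (· (c, false)) hf.eq
        simpa [h0] using this
  ext x <;> simp [key]

section Check

variable {t : Tb} {n : ℕ} (ht : Tot t n)

/-- A letter with the correct image of the point `α`. -/
structure ImOK (t : Tb) (n α : ℕ) (x : Im) : Prop where
  good : Good x.p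
  lt : x.p.c < n
  eq : actF t n x.g (α, false) = (x.p.c, x.s)

include ht

theorem invs_spec {α : Pt} (hα : Good α) (hn : α.c < n) {k : List Im → Bool} (l : List Ltr) :
    ∀ {m : List Im}, (∀ x ∈ m, ImOK t n α.c x) → invs t α l m k = true →
    (∀ g ∈ l, actF t n g (actF t n g (α.c, false)) = (α.c, false) ∧
      actF t n g (α.c, false) ≠ (α.c, true)) ∧
    ∃ m', m ⊆ m' ∧ (∀ x ∈ m', ImOK t n α.c x) ∧
      (∀ g ∈ l, (actF t n g (α.c, false)).1 < α.c ∨ ∃ x ∈ m', x.g = g) ∧ k m' = true := by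
  induction l with
  | nil => exact fun {m} hm h => ⟨by simp, m, fun _ => id, hm, by simp, h⟩
  | cons g l ih =>
    intro m hm h
    change app t g false α (fun s β =>
      cond (app t g s β (is false α.c)) (cond (Nat.ble α.c β.c)
        (cond (cond (Nat.beq α.c β.c) s false) false (invs t α l (.mk g s β :: m) k))
        (invs t α l m k)) false) = true at h
    obtain ⟨s, β, h1, h2, h3, h⟩ := app_spec ht hα hn h
    obtain ⟨h4, h⟩ := cond_eq_true h
    obtain ⟨s', γ, -, -, h5, h4⟩ := app_spec ht h1 h2 h4
    have h6 : actF t n g (actF t n g (α.c, false)) = (α.c, false) := by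
      rw [h3, h5, is_spec h4]
    cases hb : Nat.ble α.c β.c with
    | false =>
      rw [hb] at h
      have h7 : ¬ α.c ≤ β.c := fun h' => by
        rw [Nat.ble_eq_true_of_le h'] at hb
        cases hb
      obtain ⟨h8, m', h9, h10, h11, h12⟩ := ih hm h
      simp only [List.mem_cons, forall_eq_or_imp]
      refine ⟨⟨⟨h6, fun e => ?_⟩, h8⟩, m', h9, h10, ⟨.inl ?_, h11⟩, h12⟩
      · rw [h3, Prod.mk.injEq] at e
        omega
      · rw [h3]
        omega
    | true =>
      rw [hb] at h
      change cond (cond (Nat.beq α.c β.c) s false) false _ = true at h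
      cases hs : cond (Nat.beq α.c β.c) s false with
      | true =>
        rw [hs] at h
        cases h
      | false =>
        rw [hs] at h
        obtain ⟨h8, m', h9, h10, h11, h12⟩ := ih (m := .mk g s β :: m) (by
          simp only [List.mem_cons, forall_eq_or_imp]
          exact ⟨⟨h1, h2, h3⟩, hm⟩) h
        simp only [List.mem_cons, forall_eq_or_imp]
        refine ⟨⟨⟨h6, fun e => ?_⟩, h8⟩, m', fun x hx => h9 (List.mem_cons_of_mem _ hx), h10,
          ⟨.inr ⟨_, h9 List.mem_cons_self, rfl⟩, h11⟩, h12⟩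
        rw [h3, Prod.mk.injEq] at e
        rw [← e.1, e.2, Nat.beq_refl] at hs
        cases hs

/-- The relation of two letters holds at `x`. -/
def DihAt (t : Tb) (n : ℕ) (g h : Ltr) (x : ℕ × Bool) : Prop :=
  (Ltr.cmp g h = .com → actW t n [g, h] x = actW t n [h, g] x) ∧
    (Ltr.cmp g h = .adj → actW t n [g, h, g] x = actW t n [h, g, h] x)

theorem dih_spec {α : ℕ} {x y : Im} (hx : ImOK t n α x) (hy : ImOK t n α y)
    (h : dih t x y = true) : DihAt t n x.g y.g (α, false) := by
  obtain ⟨g, s, β⟩ := x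
  obtain ⟨g', s', γ⟩ := y
  obtain ⟨h1, h2, h3⟩ := hx
  obtain ⟨h4, h5, h6⟩ := hy
  simp only at h1 h2 h3 h4 h5 h6
  constructor
  · intro e
    simp only [dih, e] at h
    obtain ⟨s1, β1, -, -, e1, h⟩ := app_spec ht h1 h2 h
    obtain ⟨s2, β2, -, -, e2, h⟩ := app_spec ht h4 h5 h
    simp [actW, h3, h6, e1, e2, is_spec h]
  · intro e
    simp only [dih, e] at h
    obtain ⟨s1, β1, -, -, e1, h⟩ := appW_spec ht h1 h2 h
    obtain ⟨s2, β2, -, -, e2, h⟩ := appW_spec ht h4 h5 h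
    simp only [actW, List.foldl] at e1 e2 ⊢
    rw [h3, h6, e1, e2, is_spec h]

omit ht in
theorem Ltr.cmp_symm (g h : Ltr) : Ltr.cmp g h = Ltr.cmp h g := by cases g <;> cases h <;> rfl

omit ht in
theorem DihAt.symm {g h : Ltr} {x : ℕ × Bool} (H : DihAt t n g h x) : DihAt t n h g x := by
  unfold DihAt at *
  rw [Ltr.cmp_symm]
  exact ⟨fun e => (H.1 e).symm, fun e => (H.2 e).symm⟩

theorem dihs_spec {α : ℕ} {l : List Im} (hl : ∀ x ∈ l, ImOK t n α x) (h : dihs t l = true) :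
    ∀ x ∈ l, ∀ y ∈ l, x.g ≠ y.g → DihAt t n x.g y.g (α, false) := by
  induction l with
  | nil => simp
  | cons x l ih =>
    obtain ⟨h1, h⟩ := cond_eq_true (p := allL l (dih t x)) (q := dihs t l) h
    simp only [List.mem_cons, forall_eq_or_imp] at hl ⊢
    have h2 := allL_spec h1
    refine ⟨⟨fun h => absurd rfl h, fun y hy _ => dih_spec ht hl.1 (hl.2 y hy) (h2 y hy)⟩,
      fun y hy => ⟨fun _ => (dih_spec ht hl.1 (hl.2 y hy) (h2 y hy)).symm, ?_⟩⟩
    exact ih hl.2 h y hy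

omit ht in
theorem actW_append (v w : List Ltr) (x : ℕ × Bool) :
    actW t n (v ++ w) x = actW t n w (actW t n v x) := List.foldl_append

theorem walk_spec {w : List Ltr} {e : Bool} {α : ℕ} (m : ℕ) : ∀ {s : Bool} {β : Pt}, Good β → β.c < n →
    walk t w e α m s β = true →
    actW t n (powL m w) (β.c, s) = (α, e) ∨ ∃ j, (actW t n (powL j w) (β.c, s)).1 < α := by
  induction m with
  | zero => exact fun {s β} _ _ h => .inl (is_spec h)
  | succ m ih =>
    intro s β h1 h2 h
    change appW t w s β (fun s γ => cond (Nat.ble α γ.c) (walk t w e α m s γ) true) = true at h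
    obtain ⟨s', γ, h3, h4, h5, h⟩ := appW_spec ht h1 h2 h
    have hp (j : ℕ) : actW t n (powL (j + 1) w) (β.c, s) = actW t n (powL j w) (γ.c, s') := by
      change actW t n (w ++ powL j w) _ = _
      rw [actW_append, h5]
    cases hb : Nat.ble α γ.c with
    | false =>
      have h7 : ¬ α ≤ γ.c := fun h' => by
        rw [Nat.ble_eq_true_of_le h'] at hb
        cases hb
      refine .inr ⟨1, ?_⟩
      rw [hp]
      simpa [powL, actW] using h7
    | true =>
      rw [hb] at h
      rcases ih h3 h4 h with h | ⟨j, h⟩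
      · exact .inl (by rw [hp, h])
      · exact .inr ⟨j + 1, by rwa [hp]⟩

end Check

/-- A family of elements satisfying the relations of the presentation, up to a change of signs. -/
structure Rep {M : Type*} [Group M] (s : Ltr → M) (ζ : M) : Prop where
  cox : Cox s
  sq : ζ * ζ = 1
  com : ∀ l, ζ * s l = s l * ζ
  hex : ev s wH ^ 10 = 1
  u : ev s wE ^ 9 = 1
  v : ev s wE' ^ 9 = ζ

/-- The permutations given by a table of involutions. -/
def act {t : Tb} {n : ℕ} (h : ∀ g, Function.Involutive (actF t n g)) (g : Ltr) :
    Equiv.Perm (ℕ × Bool) := (h g).toPerm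

section Act

variable {t : Tb} {n : ℕ} (h : ∀ g, Function.Involutive (actF t n g))

theorem act_apply (g : Ltr) (x : ℕ × Bool) : act h g x = actF t n g x := rfl

theorem ev_act (w : List Ltr) (x : ℕ × Bool) : ev (act h) w x = actW t n w x := by
  induction w generalizing x with
  | nil => rfl
  | cons l w ih => exact ih _

theorem commute_flip (w : List Ltr) : Commute (ev (act h) w) flip := by
  induction w with
  | nil => exact Commute.one_left _
  | cons l w ih =>
    refine ih.mul_left (Equiv.ext fun x => ?_)
    exact actF_flip l x

theorem ev_act_of_le (w : List Ltr) {c : ℕ} (hc : n ≤ c) (b : Bool) : ev (act h) w (c, b) = (c, b) := by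
  induction w with
  | nil => rfl
  | cons l w ih =>
    change ev (act h) w (actF t n l (c, b)) = _
    rw [actF, if_neg (by simpa using hc), ih]

theorem act_sq (g : Ltr) : act h g * act h g = 1 := Equiv.ext (h g)

end Act

theorem involutive_of_chk {t : Tb} {n : ℕ} (ht : Tot t n) {sv : Bool}
    (hn : n ≤ 20736) (h : ∀ c < n, chk sv t (pt c) = true) :
    (∀ g, Function.Involutive (actF t n g)) ∧ ∀ g x, actF t n g x ≠ flip x := by
  have key (g : Ltr) (c : ℕ) (hc : c < n) := by
    obtain ⟨h1, -⟩ := cond_eq_true (h c hc)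
    exact (invs_spec ht (α := pt c) (good_pt (hc.trans_le hn)) hc lts (m := []) (by simp) h1).1 g
      (mem_lts g)
  have hge (g : Ltr) (c : ℕ) (hc : ¬ c < n) (b : Bool) : actF t n g (c, b) = (c, b) := if_neg hc
  refine ⟨fun g => ?_, fun g => ?_⟩
  · rintro ⟨c, b⟩
    by_cases hc : c < n
    · have h1 : actF t n g (actF t n g (c, false)) = (c, false) := (key g c hc).1
      cases b
      · exact h1
      · rw [show (c, true) = flip (c, false) from rfl, actF_flip, actF_flip, h1]
    · rw [hge g c hc, hge g c hc]
  · rintro ⟨c, b⟩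
    by_cases hc : c < n
    · have h1 : actF t n g (c, false) ≠ (c, true) := (key g c hc).2
      cases b
      · exact h1
      · rw [show (c, true) = flip (c, false) from rfl, actF_flip]
        exact fun e => h1 (flip.injective e)
    · rw [hge g c hc]
      simp

/-- The change of sign on the first `n` points, if `e` is true. -/
def zeta (n : ℕ) (e : Bool) : Equiv.Perm (ℕ × Bool) :=
  Function.Involutive.toPerm (fun x => (x.1, x.2 ^^ (e && decide (x.1 < n))))
    (fun x => by simp)

theorem zeta_apply (n : ℕ) (e : Bool) (x : ℕ × Bool) :
    zeta n e x = (x.1, x.2 ^^ (e && decide (x.1 < n))) := rfl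

theorem zeta_false (n : ℕ) : zeta n false = 1 := by
  ext x <;> simp [zeta_apply]

theorem zeta_mul_self (n : ℕ) (e : Bool) : zeta n e * zeta n e = 1 := by
  ext x <;> simp [zeta_apply]

theorem zeta_commute_flip (n : ℕ) (e : Bool) : Commute (zeta n e) flip := by
  refine Equiv.ext fun x => ?_
  simp [zeta_apply]

theorem zeta_commute_act {t : Tb} {n : ℕ} (ht : Tot t n)
    (h : ∀ g, Function.Involutive (actF t n g)) (e : Bool) (g : Ltr) :
    Commute (zeta n e) (act h g) := by
  refine Equiv.ext fun x => ?_
  simp only [Equiv.Perm.mul_apply, act_apply, zeta_apply]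
  by_cases hx : x.1 < n
  · obtain ⟨b, β, e1, -, h2⟩ := ht x.1 hx g
    simp [actF, hx, e1, h2]
    grind
  · simp [actF, hx]

theorem zeta_commute_ev {t : Tb} {n : ℕ} (ht : Tot t n)
    (h : ∀ g, Function.Involutive (actF t n g)) (e : Bool) (w : List Ltr) :
    Commute (zeta n e) (ev (act h) w) := by
  induction w with
  | nil => exact Commute.one_right _
  | cons l w ih => exact ih.mul_right (zeta_commute_act ht h e l)

theorem pow_eq_zeta_of_walk {t : Tb} {n : ℕ} (ht : Tot t n)
    (h : ∀ g, Function.Involutive (actF t n g)) (hn : n ≤ 20736) {w : List Ltr} {e : Bool} (m : ℕ)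
    (hw : ∀ c < n, walk t w e c m false (pt c) = true) : ev (act h) w ^ m = zeta n e := by
  have hz (w : List Ltr) : Commute (zeta n e) (ev (act h) w) := zeta_commute_ev ht h e w
  suffices H : zeta n e * ev (act h) (powL m w) = 1 by
    rw [← ev_powL, ← mul_right_inj (zeta n e), H, zeta_mul_self]
  refine eq_one_of_local (n := n) ((zeta_commute_flip n e).mul_left (commute_flip h _))
    (fun c hc => ?_) fun c hc => ?_
  · rw [Equiv.Perm.mul_apply, ev_act_of_le h _ hc, zeta_apply]
    simp [hc]
  · rcases walk_spec ht m (good_pt (hc.trans_le hn)) hc (hw c hc) with h1 | ⟨j, h1⟩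
    · left
      rw [Equiv.Perm.mul_apply, ev_act]
      refine (congrArg _ h1).trans ?_
      simp [zeta_apply, hc]
    · refine .inr ⟨ev (act h) (powL j w), by rwa [ev_act], .inl ?_⟩
      refine ((hz _).symm.mul_right ?_).eq
      rw [ev_powL, ev_powL]
      exact Commute.pow_pow_self _ _ _

theorem rep_of_chk {t : Tb} {n : ℕ} (ht : Tot t n) {sv : Bool} (hn : n ≤ 20736)
    (hc : ∀ c < n, chk sv t (pt c) = true) (h : ∀ g, Function.Involutive (actF t n g)) :
    Rep (act h) (zeta n sv) := by
  have hcd (c : ℕ) (hl : c < n) : invs t (pt c) lts [] (dihs t) = true ∧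
      walk t wH false c 10 false (pt c) = true ∧ walk t wE false c 9 false (pt c) = true ∧
      walk t wE' sv c 9 false (pt c) = true := by
    obtain ⟨h1, h2⟩ := cond_eq_true (hc c hl)
    obtain ⟨h2, h3⟩ := cond_eq_true h2
    obtain ⟨h3, h4⟩ := cond_eq_true h3
    exact ⟨h1, h2, h3, h4⟩
  have sq := act_sq h
  have sqm (g : Ltr) (x : Equiv.Perm (ℕ × Bool)) : act h g * (act h g * x) = x := by
    rw [← mul_assoc, sq, one_mul]
  have rel (g g' : Ltr) (hg : g ≠ g') (c : ℕ) (hl : c < n) :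
      DihAt t n g g' (c, false) ∨ (act h g (c, false)).1 < c ∨ (act h g' (c, false)).1 < c := by
    have hp := good_pt (hl.trans_le hn)
    obtain ⟨-, m, -, h2, h3, h4⟩ := invs_spec ht (α := pt c) hp hl lts (m := []) (by simp) (hcd c hl).1
    rcases h3 g (mem_lts g) with h5 | ⟨x, hx, rfl⟩
    · exact .inr (.inl h5)
    rcases h3 g' (mem_lts g') with h6 | ⟨y, hy, rfl⟩
    · exact .inr (.inr h6)
    · exact .inl (dihs_spec ht h2 h4 x hx y hy hg)
  have ho (w : List Ltr) := fun c (hc : n ≤ c) => ev_act_of_le h w hc false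
  refine ⟨⟨sq, fun g g' e => ?_, fun g g' e => ?_⟩, zeta_mul_self _ _, fun l => zeta_commute_act ht h _ l,
    ?_, ?_, ?_⟩
  · have hne : g ≠ g' := by
      rintro rfl
      rw [Ltr.cmp_self] at e
      cases e
    suffices H : ev (act h) [g, g', g, g'] = 1 by
      have := congrArg (fun x => act h g * act h g' * x) H
      simpa [ev, mul_assoc, sqm, sq] using this.symm
    refine eq_one_of_local (n := n) (commute_flip h _) (ho _) fun c hl => ?_
    rcases rel g g' hne c hl with h1 | h1 | h1
    · left
      change ev (act h) ([g, g'] ++ [g, g']) (c, false) = _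
      rw [ev_append, Equiv.Perm.mul_apply, ev_act h [g, g'] (c, false), h1.1 e, ← ev_act h]
      rw [← Equiv.Perm.mul_apply, ← ev_append]
      simp [ev, mul_assoc, sqm, sq, ← Equiv.Perm.mul_apply]
    · exact .inr ⟨_, h1, .inr (eq_inv_mul_iff_mul_eq.2 (by simp [ev, mul_assoc, sqm, sq]))⟩
    · exact .inr ⟨_, h1, .inr (eq_inv_mul_iff_mul_eq.2 (by simp [ev, mul_assoc, sqm, sq]))⟩
  · have hne : g ≠ g' := by
      rintro rfl
      rw [Ltr.cmp_self] at e
      cases e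
    suffices H : ev (act h) ([g', g, g'] ++ [g, g', g]) = 1 by
      have := congrArg (fun x => act h g * act h g' * act h g * x) H
      simpa [ev, mul_assoc, sqm, sq] using this.symm
    refine eq_one_of_local (n := n) (commute_flip h _) (ho _) fun c hl => ?_
    rcases rel g g' hne c hl with h1 | h1 | h1
    · left
      rw [ev_append, Equiv.Perm.mul_apply, ev_act h [g', g, g'] (c, false), ← h1.2 e, ← ev_act h]
      rw [← Equiv.Perm.mul_apply, ← ev_append]
      simp [ev, mul_assoc, sqm, sq, ← Equiv.Perm.mul_apply]
    · exact .inr ⟨_, h1, .inr (eq_inv_mul_iff_mul_eq.2 (by simp [ev, mul_assoc, sqm, sq]))⟩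
    · exact .inr ⟨_, h1, .inr (eq_inv_mul_iff_mul_eq.2 (by simp [ev, mul_assoc, sqm, sq]))⟩
  · rw [← zeta_false n]
    exact pow_eq_zeta_of_walk ht h hn 10 fun c hl => (hcd c hl).2.1
  · rw [← zeta_false n]
    exact pow_eq_zeta_of_walk ht h hn 9 fun c hl => (hcd c hl).2.2.1
  · exact pow_eq_zeta_of_walk ht h hn 9 fun c hl => (hcd c hl).2.2.2

/-! ### Orbits -/

/-- The image of a point under a word. -/
def im (t : Tb) (w : List Ltr) (x : Pt) (k : Pt → Bool) : Bool := appW t w false x fun _ y => k y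

/-- Mark the point `y` and put it on the list, unless it is marked already; count the marked
points. -/
def push (y : Pt) (l : List Pt) (v : Tb) (c : Nat) (k : List Pt → Tb → Nat → Bool) : Bool :=
  En.rec (motive := fun _ => Bool)
    (Tb.set v y .a (.yes false y) fun v => force (Nat.add c 1) fun c => k (y :: l) v c)
    (fun _ _ => k l v c) (Tb.get v y .a)

/-- Mark the images of `x` under some words. -/
def mark (t : Tb) (W : List (List Ltr)) (x : Pt) :
    List Pt → Tb → Nat → (List Pt → Tb → Nat → Bool) → Bool :=
  List.rec (motive := fun _ => List Pt → Tb → Nat → (List Pt → Tb → Nat → Bool) → Bool)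
    (fun l v c k => k l v c)
    (fun w _ ih l v c k => im t w x fun y => push y l v c fun l v c => ih l v c k) W

/-- Mark the images of the points of a list under the group generated by some words. -/
def dfs (t : Tb) (W : List (List Ltr)) (m : Nat) : List Pt → Tb → Nat → (Nat → Bool) → Bool :=
  Nat.rec (motive := fun _ => List Pt → Tb → Nat → (Nat → Bool) → Bool) (fun _ _ _ _ => false)
    (fun _ ih l v c k => List.rec (motive := fun _ => Bool) (k c)
      (fun x l _ => mark t W x l v c fun l v c => ih l v c k) l) m

/-- Check that there are `m` points in the orbits, under the group generated by the words in `W`,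
of the images of zero under the words in `V`. -/
def cover (t : Tb) (V W : List (List Ltr)) (m : Nat) : Bool :=
  mark t V Pt.zero [] emp 0 fun l v c => dfs t W 4000 l v c (Nat.beq m)

/-- The images of zero under two words agree. -/
def eqW (t : Tb) (v w : List Ltr) : Bool :=
  im t v Pt.zero fun x => im t w Pt.zero fun y => Nat.beq x.c y.c

def neW (t : Tb) (v w : List Ltr) : Bool :=
  im t v Pt.zero fun x => im t w Pt.zero fun y => cond (Nat.beq x.c y.c) false true

/-- A level of a stabilizer chain: a word leading to the base point, generators, and the length of
the orbit. -/
structure Lv where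
  p : List Ltr
  W : List (List Ltr)
  m : Nat

/-- Check a stabilizer chain. -/
def chain (t : Tb) (L : List Lv) : List (List Ltr) → Bool :=
  List.rec (motive := fun _ => List (List Ltr) → Bool) (fun _ => true)
    (fun l _ ih pre => cond (allL l.W fun w => allL pre fun p => eqW t (p ++ w) p)
      (cond (cover t [l.p] l.W l.m) (ih (l.p :: pre)) false) false) L

section Orbit

/-- An action of a group with the generators given by a table. -/
structure Pm {G : Type*} [Group G] (t : Tb) (n : ℕ) (s : Ltr → G) (ρ : G →* Equiv.Perm ℕ) :
    Prop where
  tot : Tot t n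
  pos : 0 < n
  act : ∀ l x, ρ (s l) x = (actF t n l (x, false)).1
  cox : Cox s

variable {G : Type*} [Group G] {t : Tb} {n : ℕ} {s : Ltr → G} {ρ : G →* Equiv.Perm ℕ}

theorem actF_fst (t : Tb) (n : ℕ) (l : Ltr) (x : ℕ) (b b' : Bool) :
    (actF t n l (x, b)).1 = (actF t n l (x, b')).1 := by
  unfold actF
  split_ifs
  · cases F t x l <;> rfl
  · rfl

theorem Pm.ev (h : Pm t n s ρ) (w : List Ltr) : ∀ (x : ℕ) (b : Bool),
    ρ (ev s w) x = (actW t n w (x, b)).1 := by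
  induction w with
  | nil => exact fun x b => by simp [Fi22.ev, actW]
  | cons l w ih =>
    intro x b
    rw [Fi22.ev, map_mul, Equiv.Perm.mul_apply, h.act, actF_fst t n l x false b]
    exact ih _ _

variable (h : Pm t n s ρ)
include h

theorem Pm.im_spec {w : List Ltr} {x : Pt} (hx : Good x) (hn : x.c < n) {k : Pt → Bool}
    (hk : im t w x k = true) : ∃ y, Good y ∧ y.c < n ∧ ρ (Fi22.ev s w) x.c = y.c ∧ k y = true := by
  obtain ⟨b, y, h1, h2, h3, h4⟩ := appW_spec h.tot hx hn hk
  exact ⟨y, h1, h2, by rw [h.ev w _ false, h3], h4⟩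

/-- The marked points of a table, together with a list of points and the number of marked points. -/
structure Marked (n : ℕ) (P : ℕ → Prop) (l : List Pt) (v : Tb) (c : ℕ) (V : Finset ℕ) : Prop where
  mem : ∀ x, F v x .a ≠ .no ↔ x ∈ V
  list : ∀ x ∈ l, Good x ∧ x.c ∈ V
  lt : ∀ x ∈ V, x < n ∧ P x
  card : V.card = c

omit h in
theorem push_spec {P : ℕ → Prop} {y : Pt} (hy : Good y) (hn : y.c < n) (hP : P y.c) {l : List Pt}
    {v : Tb} {c : ℕ} {V : Finset ℕ} (hV : Marked n P l v c V) {k : List Pt → Tb → ℕ → Bool}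
    (hk : push y l v c k = true) : ∃ l' v' c' V', Marked n P l' v' c' V' ∧ k l' v' c' = true := by
  unfold push at hk
  rw [hy.get_eq] at hk
  cases e : F v y.c .a with
  | yes b z =>
    rw [e] at hk
    exact ⟨l, v, c, V, hV, hk⟩
  | no =>
    rw [e] at hk
    obtain ⟨v', hk, hv⟩ := hy.set_spec hk
    rw [force_eq] at hk
    refine ⟨y :: l, v', c + 1, insert y.c V, ⟨fun x => ?_, ?_, ?_, ?_⟩, hk⟩
    · rw [hv, Finset.mem_insert, ← hV.mem]
      by_cases hx : x = y.c <;> simp [hx]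
    · simp only [List.mem_cons, forall_eq_or_imp, Finset.mem_insert, true_or, and_true]
      exact ⟨hy, fun x hx => ⟨(hV.list x hx).1, .inr (hV.list x hx).2⟩⟩
    · simp only [Finset.mem_insert, forall_eq_or_imp]
      exact ⟨⟨hn, hP⟩, hV.lt⟩
    · rw [Finset.card_insert_of_notMem, hV.card]
      rw [← hV.mem, e]
      simp

theorem Pm.mark_spec {P : ℕ → Prop} {x : Pt} (hx : Good x) (hn : x.c < n) (W : List (List Ltr))
    (hP : ∀ w ∈ W, P (ρ (Fi22.ev s w) x.c)) : ∀ {l : List Pt} {v : Tb} {c : ℕ} {V : Finset ℕ},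
    Marked n P l v c V → ∀ {k : List Pt → Tb → ℕ → Bool}, mark t W x l v c k = true →
    ∃ l' v' c' V', Marked n P l' v' c' V' ∧ k l' v' c' = true := by
  induction W with
  | nil => exact fun {l v c V} hV k hk => ⟨l, v, c, V, hV, hk⟩
  | cons w W ih =>
    intro l v c V hV k hk
    simp only [List.mem_cons, forall_eq_or_imp] at hP
    obtain ⟨y, h1, h2, h3, h4⟩ := h.im_spec hx hn
      (k := fun y => push y l v c fun l v c => mark t W x l v c k) hk
    rw [h3] at hP
    obtain ⟨l, v, c, V, h5, h6⟩ := push_spec h1 h2 hP.1 hV h4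
    exact ih hP.2 h5 h6

theorem Pm.dfs_spec {P : ℕ → Prop} (W : List (List Ltr))
    (hP : ∀ w ∈ W, ∀ x, P x → P (ρ (Fi22.ev s w) x)) (m : ℕ) :
    ∀ {l : List Pt} {v : Tb} {c : ℕ} {V : Finset ℕ}, Marked n P l v c V →
    ∀ {k : ℕ → Bool}, dfs t W m l v c k = true →
    ∃ V : Finset ℕ, (∀ x ∈ V, x < n ∧ P x) ∧ k V.card = true := by
  induction m with
  | zero => exact fun _ k hk => by cases hk
  | succ m ih =>
    intro l v c V hV k hk
    cases l with
    | nil => exact ⟨V, hV.lt, by rw [hV.card]; exact hk⟩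
    | cons x l =>
      have hx := hV.list x List.mem_cons_self
      have hx' := hV.lt _ hx.2
      obtain ⟨l, v, c, V, h5, h6⟩ := h.mark_spec (P := P) hx.1 hx'.1 W (fun w hw => hP w hw _ hx'.2)
        ⟨hV.mem, fun y hy => hV.list y (List.mem_cons_of_mem _ hy), hV.lt, hV.card⟩
        (k := fun l v c => dfs t W m l v c k) hk
      exact ih h5 h6

theorem Pm.cover_spec {P : ℕ → Prop} {V W : List (List Ltr)} {m : ℕ} (hc : cover t V W m = true)
    (hV : ∀ v ∈ V, P (ρ (Fi22.ev s v) 0)) (hP : ∀ w ∈ W, ∀ x, P x → P (ρ (Fi22.ev s w) x)) :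
    ∃ V : Finset ℕ, (∀ x ∈ V, x < n ∧ P x) ∧ V.card = m := by
  obtain ⟨l, v, c, V', h1, h2⟩ := h.mark_spec (P := P) good_zero h.pos V hV (l := []) (v := emp)
    (c := 0) (V := ∅) ⟨by simp [F_emp], by simp, by simp, by simp⟩
    (k := fun l v c => dfs t W 4000 l v c (Nat.beq m)) hc
  obtain ⟨V', h3, h4⟩ := h.dfs_spec W hP _ h1 h2
  exact ⟨V', h3, (Nat.eq_of_beq_eq_true h4).symm⟩

theorem Pm.cover_spec_full {P : ℕ → Prop} {V W : List (List Ltr)} (hc : cover t V W n = true)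
    (hV : ∀ v ∈ V, P (ρ (Fi22.ev s v) 0)) (hP : ∀ w ∈ W, ∀ x, P x → P (ρ (Fi22.ev s w) x)) :
    ∀ x < n, P x := by
  obtain ⟨V', h1, h2⟩ := h.cover_spec hc hV hP
  have : V' = Finset.range n := by
    refine Finset.eq_of_subset_of_card_le (fun x hx => by simpa using (h1 x hx).1) (by simp [h2])
  intro x hx
  exact (h1 x (by rw [this]; simpa using hx)).2

theorem Pm.eqW_spec {v w : List Ltr} (hc : eqW t v w = true) :
    ρ (Fi22.ev s v) 0 = ρ (Fi22.ev s w) 0 := by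
  obtain ⟨x, -, -, h1, h2⟩ := h.im_spec good_zero h.pos hc
  obtain ⟨y, -, -, h3, h4⟩ := h.im_spec good_zero h.pos h2
  exact h1.trans ((Nat.eq_of_beq_eq_true h4).trans h3.symm)

theorem Pm.neW_spec {v w : List Ltr} (hc : neW t v w = true) :
    ρ (Fi22.ev s v) 0 ≠ ρ (Fi22.ev s w) 0 := by
  obtain ⟨x, -, -, h1, h2⟩ := h.im_spec good_zero h.pos hc
  obtain ⟨y, -, -, h3, h4⟩ := h.im_spec good_zero h.pos h2
  change ρ _ Pt.zero.c ≠ ρ _ Pt.zero.c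
  rw [h1, h3]
  intro e
  rw [e, Nat.beq_refl] at h4
  cases h4

omit h

/-- The elements fixing the images of zero under some words. -/
def fixW (s : Ltr → G) (ρ : G →* Equiv.Perm ℕ) (P : List (List Ltr)) : Subgroup G where
  carrier := {g | ∀ p ∈ P, ρ g (ρ (ev s p) 0) = ρ (ev s p) 0}
  one_mem' := by simp
  mul_mem' := fun {a b} ha hb p hp => by
    rw [map_mul, Equiv.Perm.mul_apply, hb p hp, ha p hp]
  inv_mem' := fun {a} ha p hp => by
    rw [map_inv, Equiv.Perm.inv_eq_iff_eq, ha p hp]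

theorem mem_fixW {P : List (List Ltr)} {g : G} :
    g ∈ fixW s ρ P ↔ ∀ p ∈ P, ρ g (ρ (ev s p) 0) = ρ (ev s p) 0 := Iff.rfl

/-- A lower bound for the size of a group, by an orbit and a point stabilizer. -/
theorem card_mul_le_card [Finite G] {A B : Subgroup G} {V : Finset ℕ} {q : ℕ}
    (hV : ∀ x ∈ V, ∃ g ∈ A, ρ g q = x) (hB : B ≤ A) (hq : ∀ g ∈ B, ρ g q = q) :
    V.card * Nat.card B ≤ Nat.card A := by
  choose f hf hf' using hV
  rw [show V.card = Nat.card {x // x ∈ V} by simp, ← Nat.card_prod]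
  refine Nat.card_le_card_of_injective
    (fun p : {x // x ∈ V} × B => (⟨f p.1 p.1.2 * p.2, A.mul_mem (hf _ _) (hB p.2.2)⟩ : A)) ?_
  rintro ⟨⟨x, hx⟩, b, hb⟩ ⟨⟨y, hy⟩, c, hc⟩ e
  have e' : f x hx * b = f y hy * c := congrArg Subtype.val e
  have h1 := congrArg (fun g => ρ g q) e'
  simp only [map_mul, Equiv.Perm.mul_apply, hq b hb, hq c hc, hf'] at h1
  subst h1
  simpa using e'

include h

theorem Pm.chain_spec [Finite G] (S : Subgroup G) (L : List Lv) :
    ∀ {pre : List (List Ltr)}, chain t L pre = true → (∀ l ∈ L, ∀ w ∈ l.W, Fi22.ev s w ∈ S) →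
    (L.map Lv.m).prod * Nat.card ↥(S ⊓ fixW s ρ (L.map Lv.p ++ pre)) ≤
      Nat.card ↥(S ⊓ fixW s ρ pre) ∧
    ∀ l ∈ L, ∀ w ∈ l.W, Fi22.ev s w ∈ fixW s ρ pre := by
  induction L with
  | nil => exact fun {pre} _ _ => ⟨by simp, by simp⟩
  | cons l L ih =>
    intro pre hc hS
    obtain ⟨h1, hc⟩ := cond_eq_true (p := allL l.W fun w => allL pre fun p => eqW t (p ++ w) p)
      (q := cond (cover t [l.p] l.W l.m) (chain t L (l.p :: pre)) false) hc
    obtain ⟨h2, hc⟩ := cond_eq_true hc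
    simp only [List.mem_cons, forall_eq_or_imp] at hS
    obtain ⟨h3, h4⟩ := ih hc hS.2
    have h5 : ∀ w ∈ l.W, Fi22.ev s w ∈ fixW s ρ pre := fun w hw p hp => by
      rw [← Equiv.Perm.mul_apply, ← map_mul, ← ev_append]
      exact h.eqW_spec (allL_spec (allL_spec h1 w hw) p hp)
    obtain ⟨V, h6, h7⟩ := h.cover_spec
      (P := fun x => ∃ g ∈ S ⊓ fixW s ρ pre, ρ g (ρ (Fi22.ev s l.p) 0) = x) h2
      (by
        simp only [List.mem_singleton, forall_eq]
        exact ⟨1, one_mem _, by simp⟩)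
      (by
        rintro w hw x ⟨g, hg, rfl⟩
        exact ⟨Fi22.ev s w * g, mul_mem ⟨hS.1 w hw, h5 w hw⟩ hg, by simp⟩)
    refine ⟨?_, ?_⟩
    · have h8 := card_mul_le_card (ρ := ρ) (A := S ⊓ fixW s ρ pre) (B := S ⊓ fixW s ρ (l.p :: pre))
        (fun x hx => (h6 x hx).2) (fun g hg => ⟨hg.1, fun p hp => hg.2 p (List.mem_cons_of_mem _ hp)⟩)
        (fun g hg => hg.2 l.p List.mem_cons_self)
      rw [h7] at h8
      have h9 : fixW s ρ ((l :: L).map Lv.p ++ pre) = fixW s ρ (L.map Lv.p ++ l.p :: pre) := by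
        ext g
        simp only [mem_fixW, List.mem_append, List.mem_cons, List.map_cons]
        grind
      rw [h9, List.map_cons, List.prod_cons, mul_assoc]
      exact (Nat.mul_le_mul_left _ h3).trans h8
    · simp only [List.mem_cons, forall_eq_or_imp]
      exact ⟨h5, fun m hm w hw p hp => h4 m hm w hw p (List.mem_cons_of_mem _ hp)⟩

end Orbit

def lvs : List Lv :=
  [.mk [.b, .a]
      [[.c], [.d], [.e], [.f], [.g], [.h], [.i],
        [.b, .c, .d, .e, .h, .d, .c, .b, .a, .b, .c, .d, .h, .e, .d, .c, .b]] 2816,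
    .mk [.b, .c, .a, .b]
      [[.d], [.e], [.f], [.g], [.h], [.i],
        [.c, .b, .d, .c, .e, .d, .f, .e, .h, .d, .c, .b, .a, .b, .c, .d, .h, .e, .f, .d, .e, .c, .d, .b, .c]] 567,
    .mk [.b, .c, .d, .a, .b, .c]
      [[.e], [.f], [.g], [.h], [.i],
        [.d, .c, .b, .h, .d, .c, .e, .d, .f, .e, .h, .d, .c, .b, .a, .b, .c, .d, .h, .e, .f, .d, .e, .c, .d, .h, .b, .c, .d]] 96,
    .mk [.b, .c, .d, .e, .a, .b, .c, .d]
      [[.f], [.g], [.i],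
        [.e, .d, .c, .b, .h, .d, .c, .e, .d, .f, .e, .h, .d, .c, .b, .a, .b, .c, .d, .h, .e, .f, .d, .e, .c, .d, .h, .b, .c, .d, .e]] 10,
    .mk [.b, .c, .d, .e, .f, .a, .b, .c, .d, .e]
      [[.g], [.i],
        [.h, .d, .c, .b, .e, .d, .c, .h, .d, .e, .i, .h, .d, .c, .b, .a, .b, .c, .d, .h, .i, .e, .d, .h, .c, .d, .e, .b, .c, .d, .h]] 6,
    .mk [.b, .c, .d, .h, .a, .b, .c, .d]
      [[.i]] 2]

def wS : List Ltr :=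
  [.c, .f, .e, .d, .g, .h, .i, .b, .c, .d, .h, .e, .d, .c, .b, .a, .b, .c, .d, .e, .h, .d, .c, .b]

def wN : List Ltr :=
  [.h, .d, .c, .b, .e, .d, .c, .h, .d, .e, .i, .h, .d, .c, .b, .a, .b, .c, .d, .h, .i, .e, .d,
    .h, .c, .d, .e, .b, .c, .d, .h, .e, .d, .c, .b, .g, .f, .e, .d, .c, .h, .d, .e, .i, .h, .d,
    .c, .b, .a, .b, .c, .d, .h, .i, .e, .d, .h, .c, .d, .e, .f, .g, .b, .c, .d, .e, .c, .b, .a,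
    .d, .c, .b, .a, .b, .c, .d, .a, .b, .c, .c, .e, .d, .c, .b, .f, .g, .h, .d, .c, .e, .d, .f,
    .e, .i, .h, .d, .c, .b, .a, .b, .c, .d, .h, .i, .e, .f, .d, .e, .c, .d, .h, .g, .f, .b, .c,
    .d, .e, .c]

def reps : List (List Ltr) :=
  [[], [.b], [.b, .c], [.b, .c, .d], [.b, .c, .a, .b], [.b, .c, .d, .h], [.b, .c, .d, .a, .b],
    [.b, .c, .d, .e, .f], [.b, .c, .d, .h, .e], [.b, .c, .d, .a, .b, .c], [.b, .c, .d, .e, .a, .b],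
    [.b, .c, .d, .h, .a, .b], [.b, .c, .d, .e, .f, .g], [.b, .c, .d, .h, .a, .b, .c],
    [.b, .c, .d, .e, .f, .a, .b], [.b, .c, .d, .h, .e, .a, .b], [.b, .c, .d, .h, .i, .a, .b],
    [.b, .c, .d, .h, .e, .f, .g], [.b, .c, .d, .h, .e, .f, .d], [.b, .c, .d, .h, .i, .a, .b, .c],
    [.b, .c, .d, .e, .f, .g, .a, .b], [.b, .c, .d, .h, .e, .f, .a, .b],
    [.b, .c, .d, .h, .e, .d, .a, .b], [.b, .c, .d, .h, .i, .e, .a, .b],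
    [.b, .c, .d, .h, .e, .f, .g, .d], [.b, .c, .d, .h, .i, .e, .f, .g],
    [.b, .c, .d, .h, .e, .f, .d, .e], [.b, .c, .d, .h, .i, .e, .f, .d],
    [.b, .c, .d, .h, .e, .d, .c, .b], [.b, .c, .d, .e, .f, .a, .b, .c, .d],
    [.b, .c, .d, .e, .f, .g, .a, .b, .c], [.b, .c, .d, .h, .e, .f, .g, .a, .b],
    [.b, .c, .d, .h, .i, .e, .d, .a, .b], [.b, .c, .d, .h, .e, .f, .g, .d, .c],
    [.b, .c, .d, .h, .e, .f, .g, .d, .e], [.b, .c, .d, .h, .i, .e, .f, .g, .d],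
    [.b, .c, .d, .h, .i, .e, .f, .d, .e], [.b, .c, .d, .h, .i, .e, .d, .h, .f],
    [.b, .c, .d, .e, .f, .a, .b, .c, .d, .e], [.b, .c, .d, .h, .e, .f, .g, .d, .a, .b],
    [.b, .c, .d, .h, .i, .e, .f, .g, .a, .b], [.b, .c, .d, .h, .e, .f, .d, .e, .a, .b],
    [.b, .c, .d, .h, .i, .e, .d, .h, .a, .b], [.b, .c, .d, .h, .e, .f, .g, .d, .e, .c],
    [.b, .c, .d, .h, .i, .e, .f, .g, .d, .c], [.b, .c, .d, .h, .i, .e, .d, .h, .f, .g],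
    [.b, .c, .d, .h, .e, .f, .d, .e, .c, .d], [.b, .c, .d, .e, .f, .g, .a, .b, .c, .d, .e],
    [.b, .c, .d, .h, .e, .f, .g, .d, .e, .a, .b], [.b, .c, .d, .h, .i, .e, .f, .g, .d, .a, .b],
    [.b, .c, .d, .h, .i, .e, .f, .d, .e, .a, .b], [.b, .c, .d, .h, .e, .f, .g, .d, .e, .c, .d],
    [.b, .c, .d, .h, .i, .e, .f, .g, .d, .e, .c], [.b, .c, .d, .h, .i, .e, .d, .h, .f, .g, .c],
    [.b, .c, .d, .h, .i, .e, .f, .g, .d, .e, .f], [.b, .c, .d, .h, .e, .f, .d, .e, .c, .d, .h],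
    [.b, .c, .d, .h, .i, .e, .f, .d, .e, .c, .d], [.b, .c, .d, .h, .i, .e, .d, .h, .f, .c, .d],
    [.b, .c, .d, .h, .i, .e, .d, .h, .f, .e, .d], [.b, .c, .d, .h, .e, .f, .g, .d, .e, .f, .a, .b],
    [.b, .c, .d, .h, .i, .e, .f, .g, .d, .e, .a, .b],
    [.b, .c, .d, .h, .e, .f, .g, .d, .e, .f, .c, .d],
    [.b, .c, .d, .h, .e, .f, .d, .e, .c, .d, .h, .g],
    [.b, .c, .d, .h, .i, .e, .f, .g, .d, .e, .c, .d],
    [.b, .c, .d, .h, .i, .e, .d, .h, .f, .g, .c, .d],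
    [.b, .c, .d, .h, .i, .e, .d, .h, .f, .g, .e, .f],
    [.b, .c, .d, .h, .i, .e, .f, .d, .e, .c, .d, .b],
    [.b, .c, .d, .h, .i, .e, .d, .h, .f, .e, .c, .b],
    [.b, .c, .d, .h, .e, .f, .d, .e, .c, .d, .h, .i],
    [.b, .c, .d, .h, .i, .e, .f, .d, .e, .c, .d, .h],
    [.b, .c, .d, .h, .i, .e, .d, .h, .f, .e, .c, .d],
    [.b, .c, .d, .h, .i, .e, .f, .g, .d, .e, .f, .a, .b],
    [.b, .c, .d, .h, .i, .e, .d, .h, .f, .g, .e, .a, .b],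
    [.b, .c, .d, .h, .e, .f, .g, .d, .e, .f, .c, .d, .e],
    [.b, .c, .d, .h, .i, .e, .f, .d, .e, .c, .d, .h, .g],
    [.b, .c, .d, .h, .i, .e, .d, .h, .f, .g, .e, .c, .d],
    [.b, .c, .d, .h, .i, .e, .d, .h, .f, .g, .e, .d, .c],
    [.b, .c, .d, .h, .e, .f, .d, .e, .c, .d, .h, .i, .b],
    [.b, .c, .d, .h, .i, .e, .f, .d, .e, .c, .d, .h, .b],
    [.b, .c, .d, .h, .i, .e, .d, .h, .f, .e, .c, .d, .b],
    [.b, .c, .d, .h, .e, .f, .d, .e, .c, .d, .h, .i, .h],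
    [.b, .c, .d, .h, .i, .e, .f, .d, .e, .c, .d, .h, .d],
    [.b, .c, .d, .h, .i, .e, .d, .h, .f, .e, .c, .d, .c],
    [.b, .c, .d, .h, .i, .e, .d, .h, .f, .c, .d, .e, .d],
    [.b, .c, .d, .h, .i, .e, .d, .h, .c, .d, .e, .f, .g],
    [.b, .c, .d, .h, .i, .e, .d, .h, .f, .g, .e, .f, .a, .b],
    [.b, .c, .d, .h, .i, .e, .d, .h, .f, .e, .d, .c, .a, .b],
    [.b, .c, .d, .h, .e, .f, .g, .d, .e, .f, .c, .d, .e, .b],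
    [.b, .c, .d, .h, .e, .f, .d, .e, .c, .d, .h, .g, .f, .b],
    [.b, .c, .d, .h, .e, .f, .d, .e, .c, .d, .h, .g, .f, .e],
    [.b, .c, .d, .h, .i, .e, .f, .g, .d, .e, .f, .c, .d, .e],
    [.b, .c, .d, .h, .i, .e, .f, .d, .e, .c, .d, .h, .g, .d],
    [.b, .c, .d, .h, .i, .e, .d, .h, .f, .g, .e, .c, .d, .c],
    [.b, .c, .d, .h, .i, .e, .f, .d, .e, .c, .d, .h, .d, .c],
    [.b, .c, .d, .h, .i, .e, .f, .d, .e, .c, .d, .h, .d, .e],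
    [.b, .c, .d, .h, .i, .e, .d, .h, .c, .d, .e, .f, .e, .d],
    [.b, .c, .d, .h, .i, .e, .d, .h, .c, .d, .e, .f, .g, .e],
    [.b, .c, .d, .h, .e, .f, .g, .d, .e, .f, .c, .d, .e, .b, .c],
    [.b, .c, .d, .h, .e, .f, .d, .e, .c, .d, .h, .g, .f, .e, .b],
    [.b, .c, .d, .h, .i, .e, .f, .g, .d, .e, .f, .c, .d, .e, .b],
    [.b, .c, .d, .h, .e, .f, .d, .e, .c, .d, .h, .i, .g, .f, .b],
    [.b, .c, .d, .h, .e, .f, .d, .e, .c, .d, .h, .i, .h, .g, .b],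
    [.b, .c, .d, .h, .i, .e, .d, .h, .f, .g, .c, .d, .e, .d, .b],
    [.b, .c, .d, .h, .e, .f, .d, .e, .c, .d, .h, .g, .f, .e, .d],
    [.b, .c, .d, .h, .e, .f, .d, .e, .c, .d, .h, .i, .g, .f, .e],
    [.b, .c, .d, .h, .i, .e, .f, .d, .e, .c, .d, .h, .g, .f, .e],
    [.b, .c, .d, .h, .i, .e, .d, .h, .f, .g, .e, .f, .c, .d, .c],
    [.b, .c, .d, .h, .i, .e, .d, .h, .f, .g, .e, .f, .c, .d, .e],
    [.b, .c, .d, .h, .i, .e, .d, .h, .f, .g, .c, .d, .e, .d, .c],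
    [.b, .c, .d, .h, .i, .e, .d, .h, .c, .d, .e, .f, .g, .e, .f],
    [.b, .c, .d, .h, .i, .e, .d, .h, .f, .g, .e, .f, .d, .e, .c],
    [.b, .c, .d, .h, .i, .e, .f, .d, .e, .c, .d, .h, .d, .e, .b],
    [.b, .c, .d, .h, .i, .e, .d, .h, .f, .c, .d, .e, .d, .b, .c],
    [.b, .c, .d, .h, .i, .e, .f, .d, .e, .c, .d, .h, .d, .e, .c],
    [.b, .c, .d, .h, .i, .e, .d, .h, .c, .d, .e, .f, .g, .e, .d],
    [.b, .c, .d, .h, .i, .e, .d, .h, .f, .g, .e, .f, .d, .e, .a, .b],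
    [.b, .c, .d, .h, .e, .f, .d, .e, .c, .d, .h, .g, .f, .e, .b, .c],
    [.b, .c, .d, .h, .e, .f, .d, .e, .c, .d, .h, .g, .f, .b, .c, .d],
    [.b, .c, .d, .h, .e, .f, .d, .e, .c, .d, .h, .i, .g, .b, .c, .d],
    [.b, .c, .d, .h, .i, .e, .f, .d, .e, .c, .d, .h, .g, .d, .e, .b],
    [.b, .c, .d, .h, .e, .f, .d, .e, .c, .d, .h, .i, .h, .g, .f, .e],
    [.b, .c, .d, .h, .i, .e, .f, .d, .e, .c, .d, .h, .g, .f, .e, .d],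
    [.b, .c, .d, .h, .i, .e, .f, .d, .e, .c, .d, .h, .g, .f, .d, .e],
    [.b, .c, .d, .h, .i, .e, .d, .h, .f, .g, .e, .f, .c, .d, .c, .b],
    [.b, .c, .d, .h, .i, .e, .d, .h, .f, .g, .e, .f, .d, .e, .c, .d],
    [.b, .c, .d, .h, .i, .e, .f, .d, .e, .c, .d, .h, .b, .c, .d, .c],
    [.b, .c, .d, .h, .i, .e, .d, .h, .c, .d, .e, .f, .e, .d, .c, .b],
    [.b, .c, .d, .h, .i, .e, .d, .h, .f, .g, .e, .f, .d, .e, .c, .a, .b],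
    [.b, .c, .d, .h, .i, .e, .f, .d, .e, .c, .d, .h, .d, .e, .c, .a, .b],
    [.b, .c, .d, .h, .i, .e, .d, .h, .c, .d, .e, .f, .g, .e, .f, .d, .b],
    [.b, .c, .d, .h, .e, .f, .d, .e, .c, .d, .h, .i, .h, .g, .f, .e, .d],
    [.b, .c, .d, .h, .i, .e, .f, .d, .e, .c, .d, .h, .g, .f, .e, .d, .c],
    [.b, .c, .d, .h, .e, .f, .d, .e, .c, .d, .h, .i, .h, .g, .f, .d, .e],
    [.b, .c, .d, .h, .i, .e, .f, .d, .e, .c, .d, .h, .g, .f, .d, .e, .c],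
    [.b, .c, .d, .h, .i, .e, .d, .h, .f, .g, .e, .f, .c, .d, .e, .c, .b],
    [.b, .c, .d, .h, .i, .e, .d, .h, .f, .g, .e, .f, .c, .d, .e, .c, .d],
    [.b, .c, .d, .h, .i, .e, .d, .h, .c, .d, .e, .f, .g, .e, .f, .d, .e],
    [.b, .c, .d, .h, .i, .e, .d, .h, .c, .d, .e, .f, .g, .e, .f, .d, .c],
    [.b, .c, .d, .h, .i, .e, .d, .h, .f, .g, .e, .f, .d, .e, .c, .d, .b],
    [.b, .c, .d, .h, .i, .e, .d, .h, .f, .g, .e, .f, .d, .e, .c, .d, .h],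
    [.b, .c, .d, .h, .e, .f, .d, .e, .c, .d, .h, .i, .h, .b, .c, .d, .c],
    [.b, .c, .d, .h, .i, .e, .d, .h, .f, .g, .e, .f, .c, .d, .e, .c, .a, .b],
    [.b, .c, .d, .h, .i, .e, .d, .h, .f, .g, .e, .f, .d, .e, .c, .d, .a, .b],
    [.b, .c, .d, .h, .e, .f, .d, .e, .c, .d, .h, .i, .g, .f, .e, .d, .h, .d],
    [.b, .c, .d, .h, .e, .f, .d, .e, .c, .d, .h, .i, .h, .g, .f, .e, .d, .c],
    [.b, .c, .d, .h, .e, .f, .d, .e, .c, .d, .h, .i, .h, .g, .f, .d, .e, .d],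
    [.b, .c, .d, .h, .e, .f, .d, .e, .c, .d, .h, .i, .h, .g, .f, .d, .e, .c],
    [.b, .c, .d, .h, .e, .f, .d, .e, .c, .d, .h, .i, .h, .g, .d, .e, .f, .e],
    [.b, .c, .d, .h, .i, .e, .f, .d, .e, .c, .d, .h, .d, .e, .f, .g, .f, .e],
    [.b, .c, .d, .h, .i, .e, .f, .d, .e, .c, .d, .h, .g, .d, .e, .f, .c, .d],
    [.b, .c, .d, .h, .i, .e, .f, .d, .e, .c, .d, .h, .g, .f, .d, .e, .c, .a, .b],
    [.b, .c, .d, .h, .i, .e, .d, .h, .f, .g, .e, .f, .c, .d, .e, .c, .d, .a, .b],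
    [.b, .c, .d, .h, .i, .e, .f, .g, .d, .e, .f, .c, .d, .e, .b, .c, .d, .h, .d],
    [.b, .c, .d, .h, .i, .e, .f, .d, .e, .c, .d, .h, .g, .f, .e, .b, .c, .d, .c],
    [.b, .c, .d, .h, .i, .e, .f, .d, .e, .c, .d, .h, .g, .f, .b, .c, .d, .e, .c],
    [.b, .c, .d, .h, .i, .e, .f, .d, .e, .c, .d, .h, .d, .e, .f, .g, .f, .e, .b],
    [.b, .c, .d, .h, .i, .e, .d, .h, .f, .g, .e, .f, .c, .d, .e, .b, .c, .d, .b],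
    [.b, .c, .d, .h, .i, .e, .f, .d, .e, .c, .d, .h, .g, .f, .d, .e, .c, .d, .c],
    [.b, .c, .d, .h, .i, .e, .f, .d, .e, .c, .d, .h, .d, .e, .f, .g, .f, .e, .d],
    [.b, .c, .d, .h, .e, .f, .d, .e, .c, .d, .h, .i, .h, .g, .f, .d, .e, .c, .d],
    [.b, .c, .d, .h, .e, .f, .d, .e, .c, .d, .h, .i, .h, .d, .e, .f, .g, .f, .e],
    [.b, .c, .d, .h, .i, .e, .f, .d, .e, .c, .d, .h, .g, .d, .e, .f, .e, .c, .d],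
    [.b, .c, .d, .h, .i, .e, .d, .h, .f, .g, .e, .f, .d, .e, .c, .d, .h, .e, .d],
    [.b, .c, .d, .h, .i, .e, .f, .d, .e, .c, .d, .h, .d, .e, .f, .g, .f, .e, .c],
    [.b, .c, .d, .h, .i, .e, .f, .d, .e, .c, .d, .h, .g, .d, .e, .f, .c, .d, .e],
    [.b, .c, .d, .h, .i, .e, .d, .h, .f, .g, .e, .f, .d, .e, .c, .d, .h, .e, .b],
    [.b, .c, .d, .h, .i, .e, .d, .h, .c, .d, .e, .f, .g, .e, .f, .d, .e, .c, .d],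
    [.b, .c, .d, .h, .i, .e, .f, .d, .e, .c, .d, .h, .g, .f, .d, .e, .c, .d, .a, .b],
    [.b, .c, .d, .h, .i, .e, .f, .d, .e, .c, .d, .h, .g, .d, .e, .f, .e, .c, .a, .b],
    [.b, .c, .d, .h, .i, .e, .d, .h, .f, .g, .e, .f, .c, .d, .e, .b, .c, .d, .h, .b],
    [.b, .c, .d, .h, .e, .f, .d, .e, .c, .d, .h, .i, .h, .g, .f, .d, .e, .c, .d, .c],
    [.b, .c, .d, .h, .e, .f, .d, .e, .c, .d, .h, .i, .h, .d, .e, .f, .g, .f, .e, .d],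
    [.b, .c, .d, .h, .i, .e, .f, .d, .e, .c, .d, .h, .g, .d, .e, .f, .e, .c, .d, .c],
    [.b, .c, .d, .h, .i, .e, .d, .h, .f, .g, .e, .f, .d, .e, .c, .d, .h, .e, .d, .c],
    [.b, .c, .d, .h, .e, .f, .d, .e, .c, .d, .h, .i, .h, .g, .d, .e, .f, .e, .c, .d],
    [.b, .c, .d, .h, .e, .f, .d, .e, .c, .d, .h, .i, .h, .d, .e, .f, .g, .f, .e, .c],
    [.b, .c, .d, .h, .i, .e, .f, .d, .e, .c, .d, .h, .g, .f, .d, .e, .c, .d, .b, .c],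
    [.b, .c, .d, .h, .i, .e, .d, .h, .f, .g, .e, .f, .d, .e, .c, .d, .h, .e, .f, .d],
    [.b, .c, .d, .h, .e, .f, .d, .e, .c, .d, .h, .i, .h, .g, .d, .e, .f, .c, .d, .e],
    [.b, .c, .d, .h, .i, .e, .f, .d, .e, .c, .d, .h, .g, .d, .e, .f, .e, .c, .d, .a, .b],
    [.b, .c, .d, .h, .i, .e, .f, .d, .e, .c, .d, .h, .b, .c, .d, .e, .f, .g, .f, .e, .d],
    [.b, .c, .d, .h, .e, .f, .d, .e, .c, .d, .h, .i, .h, .g, .f, .b, .c, .d, .e, .c, .d],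
    [.b, .c, .d, .h, .i, .e, .f, .d, .e, .c, .d, .h, .g, .f, .d, .e, .b, .c, .d, .b, .c],
    [.b, .c, .d, .h, .i, .e, .d, .h, .c, .d, .e, .f, .g, .e, .f, .d, .e, .b, .c, .d, .b],
    [.b, .c, .d, .h, .i, .e, .d, .h, .f, .c, .d, .e, .b, .c, .d, .h, .g, .f, .e, .d, .c],
    [.b, .c, .d, .h, .e, .f, .d, .e, .c, .d, .h, .i, .g, .f, .e, .d, .h, .d, .e, .f, .g],
    [.b, .c, .d, .h, .e, .f, .d, .e, .c, .d, .h, .i, .h, .d, .e, .f, .g, .f, .e, .d, .c],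
    [.b, .c, .d, .h, .i, .e, .d, .h, .f, .g, .e, .f, .d, .e, .c, .d, .h, .i, .e, .f, .d],
    [.b, .c, .d, .h, .i, .e, .d, .h, .f, .g, .e, .f, .c, .d, .e, .b, .c, .d, .h, .d, .b, .c],
    [.b, .c, .d, .h, .i, .e, .d, .h, .f, .c, .d, .e, .b, .c, .d, .h, .g, .f, .e, .c, .d, .b],
    [.b, .c, .d, .h, .i, .e, .d, .h, .f, .g, .e, .f, .c, .d, .e, .b, .c, .d, .h, .b, .c, .d, .c],
    [.b, .c, .d, .h, .i, .e, .d, .h, .f, .g, .e, .f, .c, .d, .e, .b, .c, .d, .h, .f, .g, .d, .e, .c, .b]]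

def bases : List (List Ltr) := List.map Lv.p lvs ++ [[]]

/-- Two words represent the same element: they agree on the base. -/
def sameW (t : Tb) (v w : List Ltr) : Bool := allL bases fun p => eqW t (p ++ v) (p ++ w)

/-- The product of `x ^ i * y` over some exponents. -/
def wFp (x : List Ltr) : List Ltr :=
  x ++ powL 9 wS ++ x ++ wS ++ x ++ powL 7 wS ++ x ++ powL 5 wS ++ x

def cnj (w : List Ltr) : List Ltr := revL w ++ .a :: w

/-- Check the stabilizer chain for the action on 3510 points. -/
def chkS (t : Tb) : Bool :=
  cond (cover t [[]] (List.map (fun l => [l]) lts) 3510) (cond (chain t lvs [[]])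
    (allL lvs fun l => allL l.W fun w => sameW t (w ++ [.a]) (.a :: w)) false) false

def wC : List Ltr := [.b, .c, .a, .b]

def lv1 : List (List Ltr) := List.flatMap Lv.W (List.take 1 lvs)

/-- Check the properties of the action used to bound the automorphism group. -/
def chkA (t : Tb) : Bool :=
  cond (cover t [[.b], wC] lv1 3509) (cond (neW t (.a :: [.b]) ([.b] ++ [.a]))
  (cond (neW t ([.b] ++ .a :: wC) ([.b] ++ wC ++ [.a]))
  (cond (allP 3510 Pt.zero fun x => im t wS x fun y =>
    cond (Nat.beq y.c x.c) (Nat.beq 0 x.c) true)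
  (cond (eqW t wS []) (cond (sameW t (powL 11 wS) []) (cond (sameW t (wS ++ wN) (wN ++ powL 5 wS))
  (cond (allL reps fun w => cond (eqW t w [.b]) true (cond (eqW t (cnj w) []) true
    (neW t (wFp (cnj w)) [])))
  (cond (cover t reps [wS, [.a]] 3510) (cond (cover t [[]] [wS, [.a], cnj [.b]] 3510)
  (cond (neW t (cnj [.b]) []) (eqW t (wFp (cnj [.b])) []) false) false) false) false) false) false)
  false) false) false) false) false

/-- The order of the simple group. -/
def cardG : ℕ := 64561751654400

/-- The stabilizer chain of a group that is not larger than expected. -/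
structure Stab {G : Type*} [Group G] (t : Tb) (s : Ltr → G) (ρ : G →* Equiv.Perm ℕ) : Prop
    extends Pm t 3510 s ρ where
  card : Nat.card G = cardG
  trans : ∀ c < 3510, ∃ g, ρ g 0 = c
  lt : ∀ g, ρ g 0 < 3510
  base : ∀ {g}, (∀ p ∈ bases, ρ g (ρ (Fi22.ev s p) 0) = ρ (Fi22.ev s p) 0) → g = 1
  stab : ∀ g, ρ g 0 = 0 → g ∈ Subgroup.closure {x | ∃ l ∈ lvs, ∃ w ∈ l.W, Fi22.ev s w = x}
  comm : ∀ l ∈ lvs, ∀ w ∈ l.W, Fi22.ev s w * s .a = s .a * Fi22.ev s w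
  gen : ∀ l ∈ lvs, ∀ w ∈ l.W, ρ (Fi22.ev s w) 0 = 0

section Stab

variable {G : Type*} [Group G] {t : Tb} {s : Ltr → G} {ρ : G →* Equiv.Perm ℕ}

theorem sameW_spec (h : Pm t 3510 s ρ)
    (hb : ∀ {g}, (∀ p ∈ bases, ρ g (ρ (ev s p) 0) = ρ (ev s p) 0) → g = 1) {v w : List Ltr}
    (hw : sameW t v w = true) : ev s v = ev s w := by
  refine (inv_mul_eq_one.1 (hb fun p hp => ?_)).symm
  have := h.eqW_spec (allL_spec hw p hp)
  rw [ev_append, ev_append, map_mul, map_mul, Equiv.Perm.mul_apply, Equiv.Perm.mul_apply] at this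
  rw [map_mul, Equiv.Perm.mul_apply, this, ← Equiv.Perm.mul_apply, ← map_mul]
  simp

theorem Pm.stab_of_chk [Finite G] (h : Pm t 3510 s ρ) (hs : Subgroup.closure (Set.range s) = ⊤)
    (hG : Nat.card G ≤ cardG) (hc : chkS t = true) : Stab t s ρ := by
  obtain ⟨h1, hc⟩ := cond_eq_true hc
  obtain ⟨h2, h3⟩ := cond_eq_true hc
  have htr : ∀ c < 3510, ∃ g, ρ g 0 = c := h.cover_spec_full h1 (by simpa using ⟨1, by simp⟩)
    (by
      rintro w - x ⟨g, rfl⟩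
      exact ⟨Fi22.ev s w * g, by simp⟩)
  have hlt : ∀ g, ∀ c < 3510, ρ g c < 3510 := by
    intro g
    have : g ∈ Subgroup.closure (Set.range s) := by rw [hs]; trivial
    induction this using Subgroup.closure_induction_left with
    | one => simp
    | mul_left x hx y hy ih =>
      obtain ⟨l, rfl⟩ := hx
      intro c hc
      obtain ⟨b, β, e1, -, e2⟩ := h.tot _ (ih c hc) l
      rw [map_mul, Equiv.Perm.mul_apply, h.act, actF, if_pos (ih c hc), e1]
      exact e2
    | inv_mul_cancel x hx y hy ih =>
      obtain ⟨l, rfl⟩ := hx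
      intro c hc
      obtain ⟨b, β, e1, -, e2⟩ := h.tot _ (ih c hc) l
      rw [inv_eq_of_mul_eq_one_right (h.cox.sq l), map_mul, Equiv.Perm.mul_apply, h.act, actF,
        if_pos (ih c hc), e1]
      exact e2
  have hprod : 3510 * (lvs.map Lv.m).prod = cardG := rfl
  have hA : 3510 * Nat.card ↥(fixW s ρ [[]]) ≤ Nat.card G := by
    obtain ⟨V, h4, h5⟩ := h.cover_spec (P := fun x => ∃ g ∈ (⊤ : Subgroup G), ρ g 0 = x) h1
      (by simpa using ⟨1, by simp⟩)
      (by
        rintro w - x ⟨g, -, rfl⟩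
        exact ⟨Fi22.ev s w * g, trivial, by simp⟩)
    have := card_mul_le_card (A := ⊤) (B := fixW s ρ [[]]) (fun x hx => (h4 x hx).2) le_top
      (fun g hg => by simpa [mem_fixW, Fi22.ev] using hg)
    rwa [h5, Subgroup.card_top] at this
  obtain ⟨h4, h5⟩ := h.chain_spec ⊤ lvs h2 (by simp)
  obtain ⟨h6, -⟩ := h.chain_spec
    (Subgroup.closure {x | ∃ l ∈ lvs, ∃ w ∈ l.W, Fi22.ev s w = x}) lvs h2
    (fun l hl w hw => Subgroup.subset_closure ⟨l, hl, w, hw, rfl⟩)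
  rw [top_inf_eq, top_inf_eq] at h4
  have hpos : 0 < (lvs.map Lv.m).prod := by decide
  have hb1 : Nat.card ↥(fixW s ρ (lvs.map Lv.p ++ [[]])) = 1 := by
    have h7 : 3510 * ((lvs.map Lv.m).prod * Nat.card ↥(fixW s ρ (lvs.map Lv.p ++ [[]]))) ≤ cardG :=
      ((Nat.mul_le_mul_left _ h4).trans hA).trans hG
    rw [← mul_assoc, hprod] at h7
    have h8 : 0 < Nat.card ↥(fixW s ρ (lvs.map Lv.p ++ [[]])) := Nat.card_pos
    have h9 : cardG = 64561751654400 := rfl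
    rw [h9] at h7
    omega
  have hbase : ∀ {g}, (∀ p ∈ bases, ρ g (ρ (Fi22.ev s p) 0) = ρ (Fi22.ev s p) 0) → g = 1 :=
    fun {g} hg => by
      have : g ∈ fixW s ρ (lvs.map Lv.p ++ [[]]) := hg
      rwa [Subgroup.card_eq_one.1 hb1, Subgroup.mem_bot] at this
  set S := Subgroup.closure {x | ∃ l ∈ lvs, ∃ w ∈ l.W, Fi22.ev s w = x}
  have hle : S ≤ fixW s ρ [[]] := by
    rw [Subgroup.closure_le]
    rintro _ ⟨l, hl, w, hw, rfl⟩
    exact h5 l hl w hw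
  have h10 : (lvs.map Lv.m).prod ≤ Nat.card S := by
    rw [inf_of_le_left hle] at h6
    refine le_trans (Nat.le_mul_of_pos_right _ Nat.card_pos) h6
  have hcS : Nat.card S ≤ Nat.card (fixW s ρ [[]]) := Nat.card_le_card_of_injective _
    (Subgroup.inclusion_injective hle)
  have h11 : Nat.card G = cardG := le_antisymm hG <| by
    rw [← hprod]
    exact (Nat.mul_le_mul_left _ (h10.trans hcS)).trans hA
  have h12 : S = fixW s ρ [[]] := by
    refine Subgroup.eq_of_le_of_card_ge hle ?_
    omega
  refine ⟨h, h11, htr, fun g => hlt g 0 (by norm_num), hbase, fun g hg => ?_, fun l hl w hw => ?_,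
    fun l hl w hw => ?_⟩
  · change g ∈ S
    rw [h12]
    simpa [mem_fixW, Fi22.ev] using hg
  · have := sameW_spec h hbase (allL_spec (allL_spec h3 l hl) w hw)
    rw [ev_append] at this
    simpa [Fi22.ev] using this.symm
  · simpa [mem_fixW, Fi22.ev] using h5 l hl w hw

end Stab

/-- A word in two elements of a group. -/
def fpE {G : Type*} [Group G] (σ x : G) : G :=
  x * (σ ^ 5 * (x * (σ ^ 7 * (x * (σ * (x * (σ ^ 9 * x)))))))

/-- Elements of a group that control its automorphisms. -/
structure Ctl {G : Type*} [Group G] (a σ b : G) : Prop where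
  sq : a * a = 1
  pow : σ ^ 11 = 1
  ne : σ ≠ 1
  com : Commute σ a
  nrm : ∃ m, m * σ = σ ^ 5 * m
  cen : ∀ g, Commute g σ → Commute g a
  not_com : ¬ Commute (b * a * b⁻¹) a
  fp_com : Commute (fpE σ (b * a * b⁻¹)) a
  fp : ∀ g, ¬ Commute (g * a * g⁻¹) a → Commute (fpE σ (g * a * g⁻¹)) a →
    ∃ κ ∈ Subgroup.closure {σ, a}, g * a * g⁻¹ = κ * (b * a * b⁻¹) * κ⁻¹
  gen : Subgroup.closure {σ, a, b * a * b⁻¹} = ⊤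
  center : ∀ g : G, (∀ x, Commute g x) → g = 1

section Ctl

variable {G : Type*} [Group G] {t : Tb} {s : Ltr → G} {ρ : G →* Equiv.Perm ℕ}

theorem Cox.conj_adj (hs : Cox s) {x y : Ltr} (h : Ltr.cmp x y = .adj) : IsConj (s x) (s y) := by
  refine isConj_iff.2 ⟨s x * s y, ?_⟩
  rw [mul_inv_eq_iff_eq_mul, hs.adj x y h, mul_assoc]

theorem Cox.conj (hs : Cox s) (x : Ltr) : IsConj (s .a) (s x) := by
  have hb : IsConj (s .a) (s .b) := hs.conj_adj rfl
  have hc := hb.trans (hs.conj_adj (y := .c) rfl)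
  have hd := hc.trans (hs.conj_adj (y := .d) rfl)
  have he := hd.trans (hs.conj_adj (y := .e) rfl)
  have hf := he.trans (hs.conj_adj (y := .f) rfl)
  have hg := hf.trans (hs.conj_adj (y := .g) rfl)
  have hh := hd.trans (hs.conj_adj (y := .h) rfl)
  have hi := hh.trans (hs.conj_adj (y := .i) rfl)
  cases x
  exacts [IsConj.refl _, hb, hc, hd, he, hf, hg, hh, hi]

theorem ev_cnj (hs : Cox s) (w : List Ltr) : ev s (cnj w) = ev s w * s .a * (ev s w)⁻¹ := by
  rw [cnj, ev_append, hs.ev_revL]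
  rfl

theorem ev_wFp (x : List Ltr) : ev s (wFp x) = fpE (ev s wS) (ev s x) := by
  simp only [wFp, ev_append, ev_powL, fpE]

variable (h : Stab t s ρ)
include h

theorem Stab.commute {g : G} (hg : ρ g 0 = 0) : Commute g (s .a) := by
  have := h.stab g hg; clear hg
  induction this using Subgroup.closure_induction with
  | mem x hx =>
    obtain ⟨l, hl, w, hw, rfl⟩ := hx
    exact h.comm l hl w hw
  | one => exact Commute.one_left _
  | mul x y _ _ hx hy =>
    exact hx.mul_left hy
  | inv x _ hx => exact hx.inv_left

theorem Stab.eq_of_map_zero {g k : G} (e : ρ g 0 = ρ k 0) : g * s .a * g⁻¹ = k * s .a * k⁻¹ := by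
  have := h.commute (g := k⁻¹ * g) (by simp [e])
  rw [mul_inv_eq_iff_eq_mul]
  have h1 : k * (k⁻¹ * g * s .a) = k * (s .a * (k⁻¹ * g)) := congrArg _ this.eq
  simpa [mul_assoc] using h1

theorem Stab.ext {g : G} (hg : ∀ x < 3510, ρ g x = x) : g = 1 :=
  h.base fun p _ => hg _ (h.lt _)

theorem Stab.same {v w : List Ltr} (hw : sameW t v w = true) : Fi22.ev s v = Fi22.ev s w :=
  sameW_spec h.toPm h.base hw

theorem Stab.map_zero_of_commute (hc : cover t [[.b], wC] lv1 3509 = true)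
    (h1 : neW t (.a :: [.b]) ([.b] ++ [.a]) = true)
    (h2 : neW t ([.b] ++ .a :: wC) ([.b] ++ wC ++ [.a]) = true) {g : G} (hg : Commute g (s .a)) :
    ρ g 0 = 0 := by
  have hstab {g k : G} (e : ρ g 0 = ρ k 0) (hg : Commute g (s .a)) : Commute k (s .a) := by
    have h3 := h.eq_of_map_zero e
    rw [hg.eq, mul_assoc, mul_inv_cancel, mul_one, eq_mul_inv_iff_mul_eq] at h3
    exact h3.symm
  have h0 : ∀ l ∈ lv1, ρ (Fi22.ev s l) 0 = 0 ∧ Commute (Fi22.ev s l) (s .a) := by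
    intro w hw
    obtain ⟨l, hl, hw⟩ := List.mem_flatMap.1 hw
    exact ⟨h.gen l (List.mem_of_mem_take hl) w hw, h.comm l (List.mem_of_mem_take hl) w hw⟩
  have hn {w : List Ltr} (hw : ¬ Commute (Fi22.ev s w) (s .a)) :
      ρ (Fi22.ev s w) 0 ≠ 0 ∧ ∀ g, ρ g 0 = ρ (Fi22.ev s w) 0 → ¬ Commute g (s .a) :=
    ⟨fun e => hw (h.commute e), fun g e hg => hw (hstab e hg)⟩
  have hb : ¬ Commute (Fi22.ev s [.b]) (s .a) := fun e => by
    refine h.neW_spec h1 ?_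
    rw [ev_append]
    exact congrArg (ρ · 0) (e.eq.trans (by simp [Fi22.ev]))
  have hw : ¬ Commute (Fi22.ev s wC) (s .a) := fun e => by
    refine h.neW_spec h2 ?_
    rw [List.append_assoc, ev_append, ev_append [.b], ev_append]
    exact congrArg (fun y => ρ (y * Fi22.ev s [.b]) 0) (e.eq.trans (by simp [Fi22.ev]))
  obtain ⟨V, h3, h4⟩ := h.cover_spec
    (P := fun c => c ≠ 0 ∧ ∀ g, ρ g 0 = c → ¬ Commute g (s .a)) hc
    (by
      simp only [List.mem_cons, List.not_mem_nil, or_false, forall_eq_or_imp, forall_eq]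
      exact ⟨hn hb, hn hw⟩)
    (by
      rintro w hw x ⟨hx, hP⟩
      obtain ⟨h5, h6⟩ := h0 w hw
      refine ⟨fun e => hx ((ρ (Fi22.ev s w)).injective (e.trans h5.symm)), fun g hg hg' => ?_⟩
      exact hP ((Fi22.ev s w)⁻¹ * g) (by simp [hg]) (h6.inv_left.mul_left hg'))
  have hV : V = (Finset.range 3510).erase 0 := by
    refine Finset.eq_of_subset_of_card_le (fun x hx => ?_) (by simp [h4])
    obtain ⟨h5, h6, -⟩ := h3 x hx
    simp [h5, h6]
  by_contra hne
  refine (h3 (ρ g 0) ?_).2.2 g rfl hg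
  rw [hV]
  simp [hne, h.lt]

theorem Stab.ctl (hs : Subgroup.closure (Set.range s) = ⊤) (hc : chkA t = true) :
    Ctl (s .a) (Fi22.ev s wS) (s .b) := by
  obtain ⟨h1, hc⟩ := cond_eq_true hc
  obtain ⟨h2, hc⟩ := cond_eq_true hc
  obtain ⟨h3, hc⟩ := cond_eq_true hc
  obtain ⟨h4, hc⟩ := cond_eq_true hc
  obtain ⟨h5, hc⟩ := cond_eq_true hc
  obtain ⟨h6, hc⟩ := cond_eq_true hc
  obtain ⟨h7, hc⟩ := cond_eq_true hc
  obtain ⟨h8, hc⟩ := cond_eq_true hc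
  obtain ⟨h9, hc⟩ := cond_eq_true hc
  obtain ⟨h10, hc⟩ := cond_eq_true hc
  obtain ⟨h11, h12⟩ := cond_eq_true hc
  have hnil : ρ (Fi22.ev s []) 0 = 0 := by simp [Fi22.ev]
  have key {g : G} : Commute g (s .a) ↔ ρ g 0 = 0 :=
    ⟨h.map_zero_of_commute h1 h2 h3, h.commute⟩
  have hτ : Fi22.ev s (cnj [.b]) = s .b * s .a * (s .b)⁻¹ := by
    rw [ev_cnj h.cox]
    simp [Fi22.ev]
  set σ := Fi22.ev s wS
  have hσ0 : ρ σ 0 = 0 := by simpa [Fi22.ev] using h.eqW_spec h5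
  have hσa : Commute σ (s .a) := key.2 hσ0
  have ha0 : ρ (s .a) 0 = 0 := key.1 (Commute.refl _)
  have hfix : ∀ x < 3510, ρ σ x = x → x = 0 := by
    intro x hx e
    have hx' : Good (pt x) := good_pt (by omega)
    obtain ⟨y, -, -, h13, h14⟩ := h.im_spec hx' hx (allP_spec 3510 good_zero h4 x (Nat.zero_le _)
      (by simpa [Pt.zero] using hx))
    have h15 : y.c = x := h13.symm.trans e
    have h16 : Nat.beq y.c (pt x).c = true := by
      rw [h15]
      exact Nat.beq_refl x
    rw [h16] at h14
    exact (Nat.eq_of_beq_eq_true h14).symm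
  refine ⟨h.cox.sq _, ?_, fun e => ?_, hσa, ⟨Fi22.ev s wN, ?_⟩, fun g hg => ?_, ?_, ?_, ?_, ?_, ?_⟩
  · have := h.same h6
    rwa [ev_powL] at this
  · exact absurd (hfix 1 (by norm_num) (by simp [e])) (by norm_num)
  · have := h.same h7
    rwa [ev_append, ev_append, ev_powL] at this
  · refine key.2 (hfix _ (h.lt g) ?_)
    rw [← Equiv.Perm.mul_apply, ← map_mul, ← hg.eq, map_mul, Equiv.Perm.mul_apply, hσ0]
  · rw [← hτ, key]
    exact fun e => h.neW_spec h11 (e.trans hnil.symm)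
  · rw [← hτ, ← ev_wFp, key]
    exact (h.eqW_spec h12).trans hnil
  · have hP := h.cover_spec_full
      (P := fun c => ∀ g, ρ g 0 = c → ¬ Commute (g * s .a * g⁻¹) (s .a) →
        Commute (fpE σ (g * s .a * g⁻¹)) (s .a) →
        ∃ κ ∈ Subgroup.closure {σ, s .a}, ρ (κ * s .b) 0 = c) h9 ?_ ?_
    · intro g hg1 hg2
      obtain ⟨κ, hκ, e⟩ := hP (ρ g 0) (h.lt g) g rfl hg1 hg2
      refine ⟨κ, hκ, ?_⟩
      rw [← h.eq_of_map_zero e]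
      simp [mul_assoc]
    · intro w hw g hg hg1 hg2
      rw [h.eq_of_map_zero hg, ← ev_cnj h.cox] at hg1 hg2
      have h13 := allL_spec h8 w hw
      refine ⟨1, one_mem _, ?_⟩
      rw [one_mul]
      cases h14 : eqW t w [.b] with
      | true => simpa [Fi22.ev] using (h.eqW_spec h14).symm
      | false =>
        rw [h14] at h13
        cases h15 : eqW t (cnj w) [] with
        | true => exact absurd (key.2 ((h.eqW_spec h15).trans hnil)) hg1
        | false =>
          rw [h15] at h13
          rw [← ev_wFp, key] at hg2
          exact absurd (hg2.trans hnil.symm) (h.neW_spec h13)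
    · intro w hw x hx g hg hg1 hg2
      have hy : Fi22.ev s w ∈ Subgroup.closure {σ, s .a} ∧ Commute (Fi22.ev s w) σ ∧
          Commute (Fi22.ev s w) (s .a) := by
        simp only [List.mem_cons, List.not_mem_nil, or_false] at hw
        rcases hw with rfl | rfl
        · exact ⟨Subgroup.subset_closure (by simp [σ]), Commute.refl _, hσa⟩
        · have : Fi22.ev s [.a] = s .a := by simp [Fi22.ev]
          rw [this]
          exact ⟨Subgroup.subset_closure (by simp), hσa.symm, Commute.refl _⟩
      obtain ⟨hy, hy1, hy2⟩ := hy
      generalize Fi22.ev s w = y at *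
      have hcf (z : G) : Commute (y⁻¹ * z * y) (s .a) ↔ Commute z (s .a) := by
        constructor
        · intro hz
          have := (hy2.mul_left hz).mul_left hy2.inv_left
          simpa [mul_assoc] using this
        · exact fun hz => (hy2.inv_left.mul_left hz).mul_left hy2
      have e1 : y⁻¹ * g * s .a * (y⁻¹ * g)⁻¹ = y⁻¹ * (g * s .a * g⁻¹) * y := by simp [mul_assoc]
      have e2 (z : G) : fpE σ (y⁻¹ * z * y) = y⁻¹ * fpE σ z * y := by
        have hp (k : ℕ) (u : G) : y * (σ ^ k * (y⁻¹ * u)) = σ ^ k * u := by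
          rw [← mul_assoc, (hy1.pow_right k).eq]
          simp [mul_assoc]
        have hp1 := hp 1
        rw [pow_one] at hp1
        simp only [fpE, mul_assoc, hp, hp1]
      obtain ⟨κ, hκ, e⟩ := hx (y⁻¹ * g) (by simp [hg]) (by rwa [e1, hcf]) (by rwa [e1, e2, hcf])
      exact ⟨y * κ, mul_mem hy hκ, by rw [mul_assoc, map_mul, Equiv.Perm.mul_apply, e]⟩
  · set K := Subgroup.closure {σ, s .a, s .b * s .a * (s .b)⁻¹} with hK
    have hP := h.cover_spec_full (P := fun c => ∃ κ ∈ K, ρ κ 0 = c) h10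
      (by simpa [Fi22.ev] using ⟨1, one_mem _, by simp⟩)
      (by
        rintro w hw x ⟨κ, hκ, rfl⟩
        refine ⟨Fi22.ev s w * κ, mul_mem ?_ hκ, by simp⟩
        simp only [List.mem_cons, List.not_mem_nil, or_false] at hw
        rcases hw with rfl | rfl | rfl
        · exact Subgroup.subset_closure (by simp [σ])
        · exact Subgroup.subset_closure (by simp [Fi22.ev])
        · rw [hτ]
          exact Subgroup.subset_closure (by simp))
    rw [eq_top_iff, ← hs, Subgroup.closure_le]
    rintro _ ⟨l, rfl⟩
    obtain ⟨g, hg⟩ := isConj_iff.1 (h.cox.conj l)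
    obtain ⟨κ, hκ, e⟩ := hP _ (h.lt g)
    rw [← hg, ← h.eq_of_map_zero e]
    exact mul_mem (mul_mem hκ (Subgroup.subset_closure (by simp))) (inv_mem hκ)
  · intro g hg
    refine h.ext fun x hx => ?_
    obtain ⟨k, rfl⟩ := h.trans x hx
    rw [← Equiv.Perm.mul_apply, ← map_mul, (hg k).eq, map_mul, Equiv.Perm.mul_apply,
      key.1 (hg (s .a))]

end Ctl

section Aut

variable {G : Type*} [Group G] {a σ b : G} (h : Ctl a σ b)
include h

omit h in
theorem map_fpE (ψ : MulAut G) (x : G) : ψ (fpE σ x) = fpE (ψ σ) (ψ x) := by simp [fpE]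

omit h in
theorem MulAut.commute_iff (ψ : MulAut G) {x y : G} : Commute (ψ x) (ψ y) ↔ Commute x y := by
  rw [commute_iff_eq, commute_iff_eq, ← map_mul, ← map_mul, ψ.injective.eq_iff]

theorem Ctl.commute_of_mem {x y : G} (hx : x ∈ Subgroup.closure {σ, a})
    (hy : y ∈ Subgroup.closure {σ, a}) : Commute x y := by
  have key {u v : G} (h1 : Commute v σ) (h2 : Commute v a) (hu : u ∈ Subgroup.closure {σ, a}) :
      Commute v u := by
    induction hu using Subgroup.closure_induction with
    | mem u hu =>
      rcases hu with rfl | rfl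
      exacts [h1, h2]
    | one => exact Commute.one_right _
    | mul u u' _ _ hu hu' => exact hu.mul_right hu'
    | inv u _ hu => exact hu.inv_right
  exact key (key (Commute.refl _) h.com hx).symm (key h.com.symm (Commute.refl _) hx).symm hy

theorem Ctl.eq_conj_of_fix {ψ : MulAut G} (hσ : ψ σ = σ) (ha : ψ a = a) :
    ∃ κ ∈ Subgroup.closure {σ, a}, ψ = MulAut.conj κ := by
  have e : ψ (b * a * b⁻¹) = ψ b * a * (ψ b)⁻¹ := by simp [ha]
  have h1 : ¬ Commute (ψ b * a * (ψ b)⁻¹) a := by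
    have := h.not_com
    rwa [← MulAut.commute_iff ψ, ha, e] at this
  have h2 : Commute (fpE σ (ψ b * a * (ψ b)⁻¹)) a := by
    have := h.fp_com
    rwa [← MulAut.commute_iff ψ, map_fpE, ha, hσ, e] at this
  obtain ⟨κ, hκ, h3⟩ := h.fp _ h1 h2
  refine ⟨κ, hκ, ?_⟩
  have hm (x : G) (hx : x ∈ Subgroup.closure {σ, a}) : MulAut.conj κ x = x := by
    rw [MulAut.conj_apply, (h.commute_of_mem hκ hx).eq, mul_inv_cancel_right]
  have h4 : ψ.toMonoidHom = (MulAut.conj κ).toMonoidHom := by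
    refine MonoidHom.eq_of_eqOn_dense h.gen ?_
    rintro x (rfl | rfl | rfl)
    · exact hσ.trans (hm _ (Subgroup.subset_closure (by simp))).symm
    · exact ha.trans (hm _ (Subgroup.subset_closure (by simp))).symm
    · exact e.trans h3
  exact MulEquiv.ext fun x => DFunLike.congr_fun h4 x

omit h in
theorem MulAut.conj_eq_conj (hz : ∀ g : G, (∀ x, Commute g x) → g = 1) {x y : G}
    (e : MulAut.conj x = MulAut.conj y) : x = y := by
  refine (inv_mul_eq_one.1 (hz _ fun w => ?_)).symm
  have := DFunLike.congr_fun e w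
  simp only [MulAut.conj_apply] at this
  rw [mul_inv_eq_iff_eq_mul] at this
  have h1 : y⁻¹ * (x * w) = y⁻¹ * (y * w * y⁻¹ * x) := congrArg _ this
  simpa [commute_iff_eq, mul_assoc] using h1

theorem Ctl.eq_conj {ψ : MulAut G} (hσ : ψ σ = σ) : ∃ κ, ψ = MulAut.conj κ := by
  have h0 : Commute (ψ a) σ := by
    have := (MulAut.commute_iff ψ).2 h.com.symm
    rwa [hσ] at this
  have hcj (g : G) (hg : Commute g σ) : g ∈ Subgroup.closure {σ, a} := by
    obtain ⟨κ, hκ, e⟩ := h.eq_conj_of_fix (ψ := MulAut.conj g)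
      (by rw [MulAut.conj_apply, hg.eq, mul_inv_cancel_right])
      (by rw [MulAut.conj_apply, (h.cen g hg).eq, mul_inv_cancel_right])
    rwa [MulAut.conj_eq_conj h.center e]
  have h1 (x : G) (hx : x ∈ Subgroup.closure {σ, a}) : x ^ 11 = 1 ∨ x ^ 11 = a := by
    have hsq : a ^ 2 = 1 := by rw [pow_two, h.sq]
    have ha' : a⁻¹ = a := inv_eq_of_mul_eq_one_right h.sq
    induction hx using Subgroup.closure_induction with
    | mem x hx =>
      rcases hx with rfl | rfl
      · exact .inl h.pow
      · right
        rw [show 11 = 2 * 5 + 1 from rfl, pow_succ, pow_mul, hsq, one_pow, one_mul]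
    | one => simp
    | mul x y hx hy ih ih' =>
      rw [(h.commute_of_mem hx hy).mul_pow]
      rcases ih with e | e <;> rcases ih' with e' | e' <;> simp [e, e', h.sq]
    | inv x hx ih => rcases ih with e | e <;> simp [e, ha']
  have h2 : ψ a * ψ a = 1 := by rw [← map_mul, h.sq, map_one]
  have h3 : ψ a ^ 11 = ψ a := by
    rw [show 11 = 2 * 5 + 1 from rfl, pow_succ, pow_mul, pow_two, h2, one_pow, one_mul]
  rcases h1 _ (hcj _ h0) with e | e
  · rw [h3] at e
    have : a = 1 := by simpa using e
    refine absurd ?_ h.not_com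
    rw [this]
    exact Commute.one_right _
  · rw [h3] at e
    obtain ⟨κ, -, e⟩ := h.eq_conj_of_fix hσ e
    exact ⟨κ, e⟩

open Pointwise in
theorem Ctl.exists_fix_or_inv [Finite G] (hG : Nat.card G = cardG) (φ : MulAut G) :
    ∃ g : G, (MulAut.conj g * φ : MulAut G) σ = σ ∨ (MulAut.conj g * φ : MulAut G) σ = σ⁻¹ := by
  have : Fact (Nat.Prime 11) := ⟨by norm_num⟩
  have hf : (Nat.card G).factorization 11 = 1 := by
    rw [hG, show cardG = 11 * 5869250150400 from rfl, Nat.factorization_mul (by norm_num) (by norm_num)]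
    rw [Finsupp.add_apply, Nat.Prime.factorization_self (by norm_num),
      Nat.factorization_eq_zero_of_not_dvd (by norm_num)]
  have hcard (x : G) (h1 : x ^ 11 = 1) (h2 : x ≠ 1) :
      Nat.card (Subgroup.zpowers x) = 11 ^ (Nat.card G).factorization 11 := by
    rw [hf, Nat.card_zpowers, orderOf_eq_prime h1 h2, pow_one]
  obtain ⟨g, hg⟩ := MulAction.exists_smul_eq G
    (Sylow.ofCard (Subgroup.zpowers σ) (hcard σ h.pow h.ne))
    (Sylow.ofCard (Subgroup.zpowers (φ σ)) (hcard (φ σ) (by rw [← map_pow, h.pow, map_one])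
      (by simpa using h.ne)))
  have hmem : φ σ ∈ MulAut.conj g • Subgroup.zpowers σ := by
    have := congrArg (fun P : Sylow 11 G => (P : Subgroup G)) hg
    simp only [Sylow.coe_subgroup_smul] at this
    have h1 : MulAut.conj g • Subgroup.zpowers σ = Subgroup.zpowers (φ σ) := this
    rw [h1]
    exact Subgroup.mem_zpowers _
  obtain ⟨y, hy, e⟩ := Subgroup.mem_smul_pointwise_iff_exists _ _ _ |>.1 hmem
  obtain ⟨m, hm⟩ := h.nrm
  have hmj (j : ℕ) : MulAut.conj (m ^ j) σ = σ ^ 5 ^ j := by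
    induction j with
    | zero => simp
    | succ j ih =>
      have h1 : MulAut.conj m σ = σ ^ 5 := by
        rw [MulAut.conj_apply, mul_inv_eq_iff_eq_mul, hm]
      rw [pow_succ' m, map_mul, MulAut.mul_apply, ih, map_pow, h1, ← pow_mul, ← pow_succ']
  have hne : y ≠ 1 := by
    rintro rfl
    refine h.ne (φ.injective ?_)
    rw [← e, smul_one, map_one]
  have hk : ∃ k < 11, σ ^ k = y := by
    have ho : IsOfFinOrder σ := isOfFinOrder_iff_pow_eq_one.2 ⟨11, by norm_num, h.pow⟩
    obtain ⟨k, rfl⟩ := ho.mem_powers_iff_mem_zpowers.2 hy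
    exact ⟨k % 11, Nat.mod_lt _ (by norm_num), (pow_eq_pow_mod k h.pow).symm⟩
  have hj : ∃ j, y = σ ^ 5 ^ j ∨ y = (σ ^ 5 ^ j)⁻¹ := by
    obtain ⟨k, hk, rfl⟩ := hk
    have h1 (j : ℕ) (e : 5 ^ j % 11 = k) : σ ^ k = σ ^ 5 ^ j := by
      rw [pow_eq_pow_mod (5 ^ j) h.pow, e]
    have h2 (j : ℕ) (e : (k + 5 ^ j) % 11 = 0) : σ ^ k = (σ ^ 5 ^ j)⁻¹ := by
      rw [eq_inv_iff_mul_eq_one, ← pow_add, pow_eq_pow_mod _ h.pow, e, pow_zero]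
    interval_cases k
    · exact absurd (pow_zero _) hne
    · exact ⟨0, .inl (h1 0 rfl)⟩
    · exact ⟨4, .inr (h2 4 rfl)⟩
    · exact ⟨2, .inl (h1 2 rfl)⟩
    · exact ⟨3, .inl (h1 3 rfl)⟩
    · exact ⟨1, .inl (h1 1 rfl)⟩
    · exact ⟨1, .inr (h2 1 rfl)⟩
    · exact ⟨3, .inr (h2 3 rfl)⟩
    · exact ⟨2, .inr (h2 2 rfl)⟩
    · exact ⟨4, .inl (h1 4 rfl)⟩
    · exact ⟨0, .inr (h2 0 rfl)⟩
  obtain ⟨j, hj⟩ := hj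
  have e' : φ σ = MulAut.conj g y := e.symm
  refine ⟨(m ^ j)⁻¹ * g⁻¹, ?_⟩
  rw [MulAut.mul_apply, e', ← MulAut.mul_apply, ← map_mul, inv_mul_cancel_right, map_inv]
  rcases hj with rfl | rfl
  · left
    rw [← hmj, MulAut.inv_apply_self]
  · right
    rw [← hmj, map_inv, MulAut.inv_apply_self]

theorem Ctl.inner_or [Finite G] (hG : Nat.card G = cardG) (φ₁ φ₂ : MulAut G) :
    (∃ g, φ₁ = MulAut.conj g) ∨ (∃ g, φ₂ = MulAut.conj g) ∨ ∃ g, φ₂ * φ₁ = MulAut.conj g := by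
  obtain ⟨g₁, h1⟩ := h.exists_fix_or_inv hG φ₁
  obtain ⟨g₂, h2⟩ := h.exists_fix_or_inv hG φ₂
  have key {g : G} {φ : MulAut G} (e : (MulAut.conj g * φ : MulAut G) σ = σ) : ∃ g, φ = MulAut.conj g := by
    obtain ⟨k, hk⟩ := h.eq_conj e
    exact ⟨g⁻¹ * k, by rw [map_mul, ← hk, map_inv, inv_mul_cancel_left]⟩
  rcases h1 with h1 | h1
  · exact .inl (key h1)
  rcases h2 with h2 | h2
  · exact .inr (.inl (key h2))
  · refine .inr (.inr (key (g := g₂ * φ₂ g₁) ?_))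
    have e : MulAut.conj (g₂ * φ₂ g₁) * (φ₂ * φ₁) = MulAut.conj g₂ * φ₂ * (MulAut.conj g₁ * φ₁) := by
      ext x
      simp [mul_assoc]
    rw [e, MulAut.mul_apply, h1, map_inv, h2, inv_inv]

end Aut

/-! ### The presentation -/

section Proj

variable {A B : Type*}

/-- The permutation `q` is induced by `p` on the first components. -/
def Proj (p : Equiv.Perm (A × B)) (q : Equiv.Perm A) : Prop := ∀ x, (p x).1 = q x.1

theorem Proj.one : Proj (1 : Equiv.Perm (A × B)) 1 := fun _ => rfl

theorem Proj.mul {p p' : Equiv.Perm (A × B)} {q q' : Equiv.Perm A} (h : Proj p q) (h' : Proj p' q') :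
    Proj (p * p') (q * q') := fun x => by
  rw [Equiv.Perm.mul_apply, h, h', Equiv.Perm.mul_apply]

theorem Proj.pow {p : Equiv.Perm (A × B)} {q : Equiv.Perm A} (h : Proj p q) (n : ℕ) :
    Proj (p ^ n) (q ^ n) := by
  induction n with
  | zero => exact Proj.one
  | succ n ih => exact ih.mul h

theorem Proj.eq [Nonempty B] {p p' : Equiv.Perm (A × B)} {q q' : Equiv.Perm A} (h : Proj p q)
    (h' : Proj p' q') (e : p = p') : q = q' := by
  obtain ⟨b⟩ := ‹Nonempty B›
  ext x
  rw [← h (x, b), ← h' (x, b), e]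

theorem Proj.ev {s : Ltr → Equiv.Perm (A × B)} {s' : Ltr → Equiv.Perm A} (h : ∀ l, Proj (s l) (s' l))
    (w : List Ltr) : Proj (ev s w) (ev s' w) := by
  induction w with
  | nil => exact Proj.one
  | cons l w ih => exact ih.mul (h l)

theorem Rep.proj [Nonempty B] {s : Ltr → Equiv.Perm (A × B)} {s' : Ltr → Equiv.Perm A}
    (h : ∀ l, Proj (s l) (s' l)) (hs : Rep s 1) : Rep s' 1 where
  cox :=
    { sq := fun x => ((h x).mul (h x)).eq Proj.one (hs.cox.sq x)
      com := fun x y e => ((h x).mul (h y)).eq ((h y).mul (h x)) (hs.cox.com x y e)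
      adj := fun x y e => (((h x).mul (h y)).mul (h x)).eq (((h y).mul (h x)).mul (h y))
        (hs.cox.adj x y e) }
  sq := one_mul _
  com l := by rw [one_mul, mul_one]
  hex := ((Proj.ev h _).pow _).eq Proj.one hs.hex
  u := ((Proj.ev h _).pow _).eq Proj.one hs.u
  v := ((Proj.ev h _).pow _).eq Proj.one hs.v

end Proj

/-- The permutation of the points given by a letter. -/
def actP {t : Tb} {n : ℕ} (h : ∀ g, Function.Involutive (actF t n g)) (g : Ltr) : Equiv.Perm ℕ :=
  Function.Involutive.toPerm (fun c => (actF t n g (c, false)).1) fun c => by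
    change (actF t n g ((actF t n g (c, false)).1, false)).1 = c
    rw [actF_fst t n g _ false (actF t n g (c, false)).2]
    exact congrArg Prod.fst (h g (c, false))

theorem act_proj {t : Tb} {n : ℕ} (h : ∀ g, Function.Involutive (actF t n g)) (g : Ltr) :
    Proj (act h g) (actP h g) := fun _ => actF_fst t n g _ _ _

/-- The sign of a letter. -/
def tw {M : Type*} [Monoid M] (ζ : M) : Ltr → M
  | .a => 1
  | .b => 1
  | .c => ζ
  | .d => ζ
  | .e => ζ
  | .f => 1
  | .g => ζ
  | .h => ζ
  | .i => ζ

/-- The generator given by a letter. -/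
def genL : Ltr → GenH
  | .a => .a
  | .b => .b
  | .c => .c
  | .d => .d
  | .e => .e
  | .f => .f
  | .g => .g
  | .h => .h
  | .i => .i

/-- The images of the generators of the presented group. -/
def genM {M : Type*} [Group M] (s : Ltr → M) (ζ : M) : GenH → M
  | .a => s .a
  | .b => s .b
  | .c => s .c * ζ
  | .d => s .d * ζ
  | .e => s .e * ζ
  | .f => s .f
  | .g => s .g * ζ
  | .h => s .h * ζ
  | .i => s .i * ζ
  | .z => ζ

section Hom

variable {M : Type*} [Group M] {s : Ltr → M} {ζ : M} (h : Rep s ζ)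
include h

theorem Rep.zz (x : M) : ζ * (ζ * x) = x := by rw [← mul_assoc, h.sq, one_mul]

theorem Rep.inv : ζ⁻¹ = ζ := inv_eq_of_mul_eq_one_right h.sq

theorem Rep.comm (l : Ltr) : s l * ζ = ζ * s l := (h.com l).symm

theorem Rep.comm_assoc (l : Ltr) (x : M) : s l * (ζ * x) = ζ * (s l * x) := by
  rw [← mul_assoc, h.comm, mul_assoc]

theorem Rep.sq_assoc (l : Ltr) (x : M) : s l * (s l * x) = x := by
  rw [← mul_assoc, h.cox.sq, one_mul]

theorem Rep.pow_com {x y : Ltr} (e : Ltr.cmp x y = .com) : (s x * s y) ^ 2 = 1 := by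
  have h1 : s x * s y = s y * s x := h.cox.com x y e
  rw [pow_two]
  nth_rewrite 2 [h1]
  simp [mul_assoc, h.sq_assoc, h.cox.sq]

theorem Rep.pow_adj {x y : Ltr} (e : Ltr.cmp x y = .adj) : (s x * s y) ^ 3 = 1 := by
  have h1 : s x * (s y * s x) = s y * (s x * s y) := by
    rw [← mul_assoc, ← mul_assoc, h.cox.adj x y e]
  have h2 (w : M) : s x * (s y * (s x * w)) = s y * (s x * (s y * w)) := by
    simpa [mul_assoc] using congrArg (· * w) h1
  simp [pow_succ, mul_assoc, h2, h.sq_assoc, h.cox.sq]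

theorem Rep.zeta_pow {n : ℕ} (e : n % 2 = 0) : ζ ^ n = 1 := by
  rw [pow_eq_pow_mod n (show ζ ^ 2 = 1 by rw [pow_two, h.sq]), e, pow_zero]

theorem Rep.zeta_mul_pow {x : M} (hc : ζ * x = x * ζ) (n : ℕ) : (ζ * x) ^ n = ζ ^ n * x ^ n :=
  Commute.mul_pow (show Commute ζ x from hc) n

theorem Rep.pow_ev {w : List Ltr} {n : ℕ} {y : M} (hw : ev s w ^ n = y) : ev s (revL w) ^ n = y⁻¹ := by
  rw [h.cox.ev_revL, inv_pow, hw]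

theorem Rep.lift_eq_one : ∀ r ∈ relsH, FreeGroup.lift (genM s ζ) r = 1 := by
  have e1 : (s .d * (s .c * (s .b * (s .d * (s .e * (s .f * (s .d * (s .h * s .i)))))))) ^ 10 = 1 := by
    simpa [wH, revL, ev, mul_assoc] using h.pow_ev h.hex
  have e2 : (s .a * (s .b * (s .c * (s .d * (s .e * (s .f * s .h)))))) ^ 9 = 1 := by
    simpa [wE, revL, ev, mul_assoc] using h.pow_ev h.u
  have e3 : (s .b * (s .c * (s .d * (s .e * (s .f * (s .g * s .h)))))) ^ 9 = ζ := by
    simpa [wE', revL, ev, mul_assoc, h.inv] using h.pow_ev h.v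
  have hc (x y : Ltr) (e : Ltr.cmp x y = .com) := h.pow_com e
  have ha (x y : Ltr) (e : Ltr.cmp x y = .adj) := h.pow_adj e
  have s2 (l : Ltr) : s l ^ 2 = 1 := by rw [pow_two, h.cox.sq]
  have z1 : ζ ^ 3 = ζ := by rw [pow_succ, h.zeta_pow rfl, one_mul]
  have z3 (x : M) (hx : x ^ 3 = 1) (hc : ζ * x = x * ζ) : (ζ * x) ^ 3 = ζ := by
    rw [h.zeta_mul_pow hc, hx, mul_one, z1]
  have z2 (x : M) (hx : x ^ 2 = 1) (hc : ζ * x = x * ζ) : (ζ * x) ^ 2 = 1 := by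
    rw [h.zeta_mul_pow hc, hx, mul_one, h.zeta_pow rfl]
  have z9 := h.zeta_mul_pow (x := s .b * (s .c * (s .d * (s .e * (s .f * (s .g * s .h))))))
    (by simp [mul_assoc, h.comm, h.comm_assoc]) 9
  rw [e3, ← pow_succ, h.zeta_pow rfl] at z9
  have z10 := h.zeta_mul_pow
    (x := s .d * (s .c * (s .b * (s .d * (s .e * (s .f * (s .d * (s .h * s .i))))))))
    (by simp [mul_assoc, h.comm, h.comm_assoc]) 10
  rw [e1, h.zeta_pow rfl, one_mul] at z10
  intro r hr
  simp only [relsH, Set.mem_insert_iff, Set.mem_singleton_iff] at hr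
  repeat' (rcases hr with rfl | hr)
  all_goals
    simp only [sa, sb, sc, sd, se, sf, sg, sh, si, sz, map_mul, map_pow, map_inv,
      FreeGroup.lift_apply_of, genM, mul_assoc, h.comm, h.comm_assoc, h.zz, h.inv]
  all_goals first
    | exact hc _ _ rfl
    | exact ha _ _ rfl
    | assumption
    | exact s2 _
    | exact z2 _ (s2 _) (h.com _)
    | exact z2 _ (hc _ _ rfl) (by simp [mul_assoc, h.comm, h.comm_assoc])
    | rw [z3 _ (ha _ _ rfl) (by simp [mul_assoc, h.comm, h.comm_assoc]), h.sq]
    | exact z10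
    | simp [pow_two, h.sq, h.zz]

/-- The homomorphism given by a family of elements satisfying the relations. -/
def Rep.hom : H1 →* M := PresentedGroup.toGroup h.lift_eq_one

end Hom

theorem tw_mul_self {M : Type*} [Group M] {ζ : M} (h : ζ * ζ = 1) (l : Ltr) : tw ζ l * tw ζ l = 1 := by
  cases l <;> simp [tw, h]

theorem genM_genL {M : Type*} [Group M] (s : Ltr → M) (ζ : M) (l : Ltr) :
    genM s ζ (genL l) = s l * tw ζ l := by
  cases l <;> simp [genM, genL, tw]

theorem ev_mem {M : Type*} [Group M] {s : Ltr → M} {K : Subgroup M} (h : ∀ l, s l ∈ K)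
    (w : List Ltr) : ev s w ∈ K := by
  induction w with
  | nil => exact one_mem _
  | cons l w ih => exact mul_mem ih (h l)

section Rels

variable {M : Type*} [Group M] {f : GenH → M} (hf : ∀ r ∈ relsH, FreeGroup.lift f r = 1)
include hf

theorem rep_of_rels : Rep (fun l => f (genL l) * tw (f .z) l) (f .z) := by
  simp only [relsH, Set.mem_insert_iff, Set.mem_singleton_iff, forall_eq_or_imp, forall_eq,
    sa, sb, sc, sd, se, sf, sg, sh, si, sz, map_mul, map_pow, map_inv, FreeGroup.lift_apply_of] at hf
  obtain ⟨k1, k2, k3, k4, k5, k6, k7, k8, k9, k10, k11, k12, k13, k14, k15, k16, k17, k18, k19, k20, k21, k22, k23, k24, k25, k26, k27, k28, k29, k30, k31, k32, k33, k34, k35, k36, k37, k38, k39, k40, k41, k42, k43, k44, k45, k46, k47, k48, k49, k50, k51, k52, k53, k54, k55, k56, k57, k58⟩ := hf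
  have zz : f .z * f .z = 1 := by rwa [← pow_two]
  have zi : (f .z)⁻¹ = f .z := inv_eq_of_mul_eq_one_right zz
  have z1 {x : M} (h : x * (f .z)⁻¹ = 1) : x = f .z := mul_inv_eq_one.1 h
  have zc1 {x : M} (h : f .z * x * (f .z)⁻¹ * x⁻¹ = 1) : f .z * x = x * f .z := by
    rw [mul_inv_eq_one, mul_inv_eq_iff_eq_mul] at h
    exact h
  have fi (x : GenH) : (f x)⁻¹ = f x := by
    refine inv_eq_of_mul_eq_one_right ?_
    rw [← pow_two]
    cases x <;> assumption
  generalize f .z = z at *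
  have sq (l : Ltr) : f (genL l) * f (genL l) = 1 := by
    rw [← pow_two]
    cases l <;> assumption
  have si (l : Ltr) : (f (genL l))⁻¹ = f (genL l) := inv_eq_of_mul_eq_one_right (sq l)
  have zc (l : Ltr) : f (genL l) * z = z * f (genL l) := by
    cases l <;> exact (zc1 (by assumption)).symm
  have com1 (x y : Ltr) (h : (f (genL x) * f (genL y)) ^ 2 = 1) :
      f (genL x) * f (genL y) = f (genL y) * f (genL x) := by
    rw [pow_two] at h
    rw [← inv_eq_of_mul_eq_one_right h, mul_inv_rev, si, si]
  have com (x y : Ltr) (e : Ltr.cmp x y = .com) :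
      f (genL x) * f (genL y) = f (genL y) * f (genL x) := by
    cases x <;> cases y <;> first
      | cases e; done
      | exact com1 _ _ (by assumption)
      | exact (com1 _ _ (by assumption)).symm
  have adj1 (x y : Ltr) {ε : M} (h : (f (genL x) * f (genL y)) ^ 3 = ε) :
      f (genL x) * f (genL y) * f (genL x) = ε * (f (genL y) * f (genL x) * f (genL y)) := by
    rw [← h]
    have h1 (l : Ltr) (u : M) : f (genL l) * (f (genL l) * u) = u := by rw [← mul_assoc, sq, one_mul]
    simp [pow_succ, mul_assoc, h1, sq]
  have tt := tw_mul_self zz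
  have htw (l : Ltr) : tw z l = 1 ∨ tw z l = z := by cases l <;> simp [tw]
  have adj0 (x y : Ltr) (e : Ltr.cmp x y = .adj) : (f (genL x) * f (genL y)) ^ 3 = tw z x * tw z y ∨
      (f (genL y) * f (genL x)) ^ 3 = tw z x * tw z y := by
    cases x <;> cases y <;> first
      | cases e; done
      | simp only [tw, zz, one_mul, mul_one]
        first
        | exact .inl (by assumption)
        | exact .inr (by assumption)
        | exact .inl (z1 (by assumption))
        | exact .inr (z1 (by assumption))
  have zc' (l : Ltr) (x : M) : f (genL l) * (z * x) = z * (f (genL l) * x) := by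
    rw [← mul_assoc, zc, mul_assoc]
  have zz' (x : M) : z * (z * x) = x := by rw [← mul_assoc, zz, one_mul]
  have rev {w x : M} {n : ℕ} {y : M} (h : w ^ n = y) (e : x = w⁻¹) : x ^ n = y⁻¹ := by
    rw [e, inv_pow, h]
  refine ⟨⟨fun l => ?_, fun x y e => ?_, fun x y e => ?_⟩, zz, fun l => ?_, ?_, ?_, ?_⟩
  · rcases htw l with h | h <;>
      simp only [h, mul_assoc, zc, zc', zz, zz', one_mul, mul_one, sq]
  · have h1 := com x y e
    rcases htw x with h2 | h2 <;> rcases htw y with h3 | h3 <;>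
      simp only [h2, h3, mul_assoc, zc, zc', zz, zz', one_mul, mul_one, h1]
  · have h1 : f (genL x) * (f (genL y) * f (genL x)) =
        tw z x * tw z y * (f (genL y) * (f (genL x) * f (genL y))) := by
      rcases adj0 x y e with h | h
      · simpa only [mul_assoc] using adj1 _ _ h
      · have h1 := adj1 _ _ h
        rcases htw x with h2 | h2 <;> rcases htw y with h3 | h3 <;>
          simp only [h2, h3, mul_assoc, zz, zz', one_mul, mul_one] at h1 ⊢ <;>
          simp only [h1, zz']
    rcases htw x with h2 | h2 <;> rcases htw y with h3 | h3 <;>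
      simp only [h2, h3, mul_assoc, zc, zc', zz, zz', one_mul, mul_one] at h1 ⊢ <;>
      simp only [h1, zz']
  · rcases htw l with h | h <;>
      simp only [h, mul_assoc, zc, zc', zz, zz', one_mul, mul_one]
  · simp only [wH, ev, tw, mul_assoc, zc, zc', zz, zz', one_mul, mul_one]
    refine (Commute.mul_pow (by simp only [Commute, SemiconjBy, mul_assoc, zc, zc']) _).trans ?_
    refine (congrArg _ (rev k46 (by simp only [mul_inv_rev, fi, mul_assoc, genL]))).trans ?_
    simp [pow_succ, mul_assoc, zz]
  · simp only [wE, ev, tw, mul_assoc, zc, zc', zz, zz', one_mul, mul_one]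
    rw [rev k47 (by simp only [mul_inv_rev, fi, mul_assoc, genL]), inv_one]
  · simp only [wE', ev, tw, mul_assoc, zc, zc', zz, zz', one_mul, mul_one]
    refine (Commute.mul_pow (by simp only [Commute, SemiconjBy, mul_assoc, zc, zc']) _).trans ?_
    refine (congrArg _ (rev k48 (by simp only [mul_inv_rev, fi, mul_assoc, genL]))).trans ?_
    simp [pow_succ, mul_assoc, zz]

end Rels

/-- The central element of the presented group. -/
def zH : H1 := PresentedGroup.of .z

/-- The generators of the presented group, with adjusted signs. -/
def sH (l : Ltr) : H1 := PresentedGroup.of (genL l) * tw zH l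

theorem rep_sH : Rep sH zH := by
  refine rep_of_rels (f := fun x => (PresentedGroup.of x : H1)) fun r hr => ?_
  have h1 : FreeGroup.lift (fun x => (PresentedGroup.of x : H1)) = PresentedGroup.mk relsH := by
    ext x
    simp [PresentedGroup.of]
  rw [h1]
  exact PresentedGroup.one_of_mem hr

theorem Rep.hom_sH {M : Type*} [Group M] {s : Ltr → M} {ζ : M} (h : Rep s ζ) (l : Ltr) :
    h.hom (sH l) = s l := by
  have h1 (x : GenH) : h.hom (PresentedGroup.of x) = genM s ζ x := PresentedGroup.toGroup.of _
  rw [sH, map_mul, h1, genM_genL]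
  have h2 : h.hom (tw zH l) = tw ζ l := by
    have h3 : h.hom zH = ζ := h1 .z
    cases l <;> simp [tw, h3]
  rw [h2, mul_assoc, tw_mul_self h.sq, mul_one]

theorem closure_sH : Subgroup.closure (Set.range sH) = ⊤ := by
  have h1 : zH ∈ Subgroup.closure (Set.range sH) := by
    rw [← rep_sH.v]
    exact pow_mem (ev_mem (fun l => Subgroup.subset_closure (Set.mem_range_self l)) _) _
  have h2 (l : Ltr) : (PresentedGroup.of (genL l) : H1) ∈ Subgroup.closure (Set.range sH) := by
    have : PresentedGroup.of (genL l) = sH l * tw zH l := by rw [sH, mul_assoc, tw_mul_self rep_sH.sq, mul_one]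
    rw [this]
    refine mul_mem (Subgroup.subset_closure ⟨l, rfl⟩) ?_
    cases l <;> first | exact one_mem _ | exact h1
  rw [eq_top_iff, ← PresentedGroup.closure_range_of, Subgroup.closure_le]
  rintro _ ⟨x, rfl⟩
  cases x
  exacts [h2 .a, h2 .b, h2 .c, h2 .d, h2 .e, h2 .f, h2 .g, h2 .h, h2 .i, h1]

/-- Apply a Coxeter relation at the start of a word. -/
def rewH (w : List Ltr) (k : List Ltr → Bool) : Bool :=
  List.rec (motive := fun _ => Bool) false (fun x v _ =>
    List.rec (motive := fun _ => Bool) false (fun y v _ =>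
      Cp.rec (motive := fun _ => Bool) (k v) (k (y :: x :: v))
        (List.rec (motive := fun _ => Bool) false (fun z v _ =>
          Cp.rec (motive := fun _ => Bool) (k (y :: x :: y :: v)) false false (Ltr.cmp x z)) v)
        (Ltr.cmp x y)) v) w

/-- Apply a Coxeter relation at the position `p` of a word. -/
def rew (p : Nat) : List Ltr → (List Ltr → Bool) → Bool :=
  Nat.rec (motive := fun _ => List Ltr → (List Ltr → Bool) → Bool) rewH
    (fun _ ih w k => List.rec (motive := fun _ => Bool) false
      (fun x v _ => ih v fun v => k (x :: v)) w) p

/-- Applying Coxeter relations at the given positions reduces a word to the empty word. -/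
def rews (l : List Nat) : List Ltr → Bool :=
  List.rec (motive := fun _ => List Ltr → Bool)
    (List.rec (motive := fun _ => Bool) true fun _ _ _ => false)
    (fun p _ ih w => rew p w ih) l

section Rewriting

variable {M : Type*} [Group M] {s : Ltr → M} (hs : Cox s)
include hs

theorem rewH_spec {w : List Ltr} {k : List Ltr → Bool} (h : rewH w k = true) :
    ∃ v, ev s v = ev s w ∧ k v = true := by
  rcases w with _ | ⟨x, _ | ⟨y, v⟩⟩
  · exact absurd h Bool.false_ne_true
  · exact absurd h Bool.false_ne_true
  · change Cp.rec (motive := fun _ => Bool) (k v) (k (y :: x :: v)) _ (Ltr.cmp x y) = true at h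
    cases e : Ltr.cmp x y with
    | eq =>
      rw [e] at h
      obtain rfl := Ltr.eq_of_cmp e
      exact ⟨v, by simp [ev, mul_assoc, hs.sq], h⟩
    | com =>
      rw [e] at h
      exact ⟨_, by simp [ev, mul_assoc, hs.com _ _ e], h⟩
    | adj =>
      rw [e] at h
      rcases v with _ | ⟨z, v⟩
      · exact absurd h Bool.false_ne_true
      · change Cp.rec (motive := fun _ => Bool) (k (y :: x :: y :: v)) false false (Ltr.cmp x z) =
          true at h
        cases e1 : Ltr.cmp x z with
        | eq =>
          rw [e1] at h
          obtain rfl := Ltr.eq_of_cmp e1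
          refine ⟨_, ?_, h⟩
          have := hs.adj _ _ e
          simp only [mul_assoc] at this
          simp [ev, mul_assoc, this]
        | com => rw [e1] at h; exact absurd h Bool.false_ne_true
        | adj => rw [e1] at h; exact absurd h Bool.false_ne_true

theorem rew_spec (p : ℕ) {w : List Ltr} {k : List Ltr → Bool} (h : rew p w k = true) :
    ∃ v, ev s v = ev s w ∧ k v = true := by
  induction p generalizing w k with
  | zero => exact rewH_spec hs h
  | succ p ih =>
    rcases w with _ | ⟨x, w⟩
    · exact absurd h Bool.false_ne_true
    · obtain ⟨v, h1, h2⟩ := ih h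
      exact ⟨x :: v, by simp [ev, h1], h2⟩

theorem rews_spec (l : List ℕ) {w : List Ltr} (h : rews l w = true) : ev s w = 1 := by
  induction l generalizing w with
  | nil =>
    cases w with
    | nil => rfl
    | cons => exact absurd h Bool.false_ne_true
  | cons p l ih =>
    obtain ⟨v, h1, h2⟩ := rew_spec hs p h
    rw [← h1]
    exact ih h2

end Rewriting

def wK : List Ltr := [.i, .d, .e, .c, .d, .b]

def wK' : List Ltr := [.d, .h, .e, .f]

set_option maxRecDepth 1000000 in
theorem rews_wR : rews [
  4, 5, 3, 5, 2, 3, 4, 6, 7, 1, 2, 4, 5, 6, 7, 8, 10, 11, 81, 82, 83, 84, 85, 86, 87, 86, 87, 88,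
  89, 90, 89, 84, 86, 87, 88, 87, 83, 84, 85, 86, 79, 81, 82, 83, 85, 84, 83, 84, 81, 82, 83, 75,
  76, 77, 78, 79, 80, 81, 82, 69, 70, 71, 72, 73, 74, 75, 77, 78, 80, 81, 79, 80, 76, 77, 78, 79,
  77, 78, 71, 72, 73, 74, 75, 77, 76, 71, 73, 74, 67, 69, 70, 71, 69, 57, 58, 59, 60, 61, 62, 63,
  64, 66, 67, 69, 71, 72, 74, 76, 75, 76, 70, 72, 73, 74, 75, 69, 70, 68, 66, 68, 70, 71, 73, 74,
  75, 69, 71, 72, 73, 74, 62, 63, 64, 65, 66, 67, 60, 62, 63, 55, 57, 58, 59, 60, 62, 63, 65, 66,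
  67, 69, 70, 71, 72, 73, 66, 67, 68, 70, 71, 72, 62, 63, 64, 65, 66, 67, 68, 70, 71, 69, 70, 61,
  59, 61, 63, 64, 65, 66, 68, 69, 63, 64, 62, 60, 54, 55, 56, 57, 58, 59, 60, 62, 64, 66, 57, 58,
  59, 60, 61, 62, 55, 57, 58, 59, 54, 55, 53, 42, 43, 44, 45, 46, 47, 48, 49, 51, 53, 55, 56, 58,
  59, 61, 62, 64, 65, 66, 68, 67, 61, 62, 60, 50, 48, 50, 52, 53, 54, 55, 56, 57, 58, 60, 62, 64,
  65, 53, 55, 56, 57, 58, 52, 53, 55, 51, 49, 39, 40, 41, 42, 43, 44, 45, 47, 48, 49, 51, 53, 54,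
  55, 57, 58, 60, 61, 62, 60, 43, 44, 45, 46, 47, 48, 49, 50, 51, 52, 41, 43, 44, 45, 46, 37, 39,
  40, 41, 43, 39, 27, 28, 29, 30, 31, 32, 33, 34, 36, 37, 39, 41, 42, 43, 45, 46, 48, 49, 50, 52,
  53, 55, 56, 57, 58, 60, 62, 63, 65, 67, 66, 67, 61, 63, 64, 65, 66, 60, 61, 59, 57, 59, 61, 62,
  64, 65, 66, 60, 62, 63, 64, 65, 56, 57, 58, 54, 56, 57, 58, 60, 61, 62, 63, 64, 57, 58, 59, 61,
  62, 63, 51, 53, 54, 55, 56, 57, 58, 59, 61, 62, 60, 61, 52, 50, 49, 50, 52, 54, 55, 56, 57, 59,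
  60, 54, 55, 53, 51, 45, 46, 47, 48, 49, 50, 51, 53, 55, 57, 42, 43, 44, 45, 40, 42, 43, 39, 40,
  38, 36, 38, 40, 41, 43, 45, 47, 48, 49, 50, 51, 52, 53, 46, 44, 45, 46, 48, 49, 50, 42, 43, 35,
  36, 33, 35, 36, 38, 39, 40, 41, 42, 43, 45, 46, 38, 40, 41, 42, 43, 44, 35, 36, 37, 38, 40, 36,
  34, 24, 25, 26, 27, 28, 29, 30, 32, 33, 34, 36, 38, 39, 40, 42, 28, 29, 30, 31, 32, 33, 34, 35,
  36, 37, 26, 28, 29, 30, 31, 22, 24, 25, 26, 28, 24, 12, 13, 14, 15, 16, 17, 18, 19, 21, 22, 24,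
  26, 27, 28, 30, 31, 33, 34, 35, 37, 38, 40, 41, 42, 44, 46, 47, 49, 50, 52, 53, 55, 56, 57, 59,
  58, 52, 53, 51, 36, 38, 39, 40, 41, 35, 36, 38, 39, 34, 35, 36, 38, 39, 41, 43, 44, 45, 46, 47,
  48, 49, 51, 53, 55, 56, 44, 46, 47, 48, 49, 43, 44, 46, 42, 40, 30, 31, 32, 33, 34, 35, 36, 38,
  39, 40, 42, 44, 45, 46, 48, 49, 51, 52, 53, 51, 27, 28, 29, 30, 25, 27, 28, 24, 25, 23, 21, 23,
  25, 26, 28, 30, 32, 33, 34, 35, 36, 37, 38, 39, 40, 41, 42, 43, 31, 32, 29, 30, 27, 28, 20, 21,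
  18, 20, 21, 23, 24, 25, 26, 27, 28, 30, 32, 34, 35, 36, 37, 23, 25, 26, 27, 28, 20, 21, 22, 23,
  25, 21, 19, 10, 11, 12, 13, 14, 15, 17, 18, 19, 21, 23, 24, 25, 27, 28, 30, 31, 32, 34, 30, 13,
  14, 15, 16, 17, 18, 19, 20, 21, 22, 11, 13, 14, 15, 16, 9, 10, 11, 13, 9, 0, 1, 2, 3, 4, 5, 7,
  9, 11, 12, 13, 15, 16, 18, 19, 20, 22, 23, 25, 26, 27, 28, 30, 32, 33, 34, 36, 37, 39, 40, 41,
  43, 44, 46, 47, 48, 49, 51, 53, 54, 56, 58, 57, 58, 52, 54, 55, 56, 57, 51, 52, 50, 48, 50, 52,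
  53, 55, 56, 57, 51, 53, 54, 55, 56, 47, 48, 49, 45, 47, 48, 49, 51, 52, 53, 54, 55, 48, 49, 50,
  52, 53, 54, 42, 44, 45, 46, 47, 48, 49, 50, 52, 53, 51, 52, 43, 41, 40, 41, 43, 45, 46, 47, 48,
  50, 51, 45, 46, 44, 42, 36, 37, 38, 39, 40, 41, 42, 44, 46, 48, 49, 51, 45, 38, 37, 38, 40, 41,
  42, 43, 45, 47, 48, 49, 50, 52, 53, 47, 48, 46, 44, 33, 34, 35, 36, 31, 33, 34, 35, 36, 38, 39,
  40, 41, 42, 43, 44, 46, 48, 50, 51, 52, 43, 44, 30, 31, 29, 27, 29, 31, 32, 34, 35, 36, 38, 39,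
  40, 41, 43, 44, 46, 47, 48, 50, 51, 52, 46, 38, 39, 30, 32, 33, 34, 35, 36, 38, 39, 41, 42, 43,
  44, 46, 48, 49, 50, 51, 42, 43, 44, 41, 26, 27, 28, 24, 26, 27, 28, 30, 31, 32, 33, 34, 35, 36,
  38, 39, 41, 43, 44, 46, 47, 48, 49, 50, 40, 27, 28, 29, 31, 32, 33, 35, 36, 37, 38, 40, 42, 43,
  44, 45, 47, 48, 49, 36, 37, 38, 35, 21, 23, 24, 25, 26, 27, 28, 29, 31, 32, 33, 35, 37, 38, 40,
  41, 42, 43, 44, 45, 47, 48, 46, 47, 22, 20, 19, 20, 22, 24, 25, 26, 27, 29, 30, 31, 33, 34, 35,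
  37, 38, 40, 41, 42, 43, 45, 46, 40, 41, 39, 36, 37, 24, 25, 23, 21, 15, 16, 17, 18, 19, 20, 21,
  23, 25, 27, 28, 29, 31, 32, 33, 34, 35, 36, 37, 39, 41, 43, 44, 46, 40, 32, 24, 17, 16, 17, 19,
  20, 21, 22, 24, 26, 27, 28, 29, 30, 32, 34, 35, 36, 37, 38, 40, 42, 43, 44, 45, 47, 48, 42, 43,
  41, 39, 27, 28, 29, 30, 26, 27, 25, 23, 12, 13, 14, 15, 10, 12, 13, 14, 15, 17, 18, 19, 20, 21,
  22, 23, 25, 27, 29, 30, 32, 33, 34, 35, 36, 37, 38, 39, 41, 43, 45, 46, 47, 42, 34, 35, 32, 26,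
  18, 19, 12, 13, 14, 15, 16, 18, 19, 21, 22, 23, 24, 26, 28, 29, 30, 31, 32, 34, 35, 37, 38, 39,
  40, 42, 44, 45, 46, 37, 38, 30, 21, 22, 8, 9, 10, 12, 13, 14, 16, 17, 18, 19, 21, 22, 24, 25,
  26, 28, 29, 30, 32, 33, 34, 35, 37, 38, 40, 41, 42, 44, 45, 46, 48, 47, 48, 33, 34, 35, 36, 32,
  27, 17, 18, 19, 20, 16, 6, 7, 8, 9, 10, 12, 13, 14, 16, 18, 19, 20, 22, 23, 24, 25, 26, 27, 29,
  30, 32, 34, 35, 36, 38, 39, 40, 41, 42, 44, 45, 46, 47, 43, 44, 45, 46, 48, 49, 50, 51, 46, 48,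
  49, 50, 45, 46, 47, 49, 44, 45, 47, 48, 47, 46, 45, 42, 43, 44, 43, 41, 42, 41, 39, 40, 39, 38,
  37, 36, 35, 34, 33, 32, 31, 30, 28, 29, 27, 28, 27, 25, 26, 24, 25, 19, 20, 21, 22, 23, 24, 23,
  22, 21, 18, 19, 20, 19, 17, 18, 17, 16, 15, 14, 13, 12, 11, 10, 9, 8, 7, 6, 4, 5, 3, 4, 3, 2, 1,
  0] ((wK ++ powL 10 wH ++ revL wK) ++ (wK' ++ powL 10 wH ++ revL wK') ++ revL wR) = true := by
  decide +kernel

theorem Rep.ev_wR {M : Type*} [Group M] {s : Ltr → M} {ζ : M} (h : Rep s ζ) : ev s wR = 1 := by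
  have h1 := rews_spec h.cox _ rews_wR
  simpa [ev_append, ev_powL, h.cox.ev_revL, h.hex] using h1

def h27 : Hs :=
  [7555509514138434703298646639839927429427260037505727140129,
  7114559465260818409120346166192139364973698682432978559521, 1690200724431541130890103453554]

def h16 : Hs :=
  [7949463033013747296487245099697109846496777860166425125426, 6299284275]

def h120 : Hs :=
  [7630991752023749529275751822354484119544157742579523548483,
  7928009201713137941454579216826505164079588610171188048756,
  9105066416215064202138179231166462744214388384488924333879,
  7977143339396055194029964175637783590621461390781700195443,
  8369468980515551963583285409176144645000014440835868546373]

def hX : Hs :=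
  [6695575932919002036681774688282878608479566959307052356097,
  8369487737622387566016097965205758689355410918733555905587,
  8420041337943520464676759598687343724238865124246597097317,
  7973984560952305237768083442845487085549656877143324849015,
  7532516219286344352288002001375034998270806280357299844935,
  8317161420679834466978680616607960343529740547733500496008,
  7540591728976509520087079055605028638113020504998428213395,
  7533958898364358318164997187743514509611315876646957364019,
  9206416277654501813769988947419585676557601446364113832072,
  7534056548133449747634378323779701498272289610326642882423,
  9624853035584157153725905548819121171632637589253438081160,
  9232570462895146156697269585368544623639723949486824191863,
  9206415479479748390590277932378215796220827558213944117384,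
  7122221942989896568541781566604317195698773404971218536584,
  7872570071792063408680084441704277057780016489540314497572,
  9624847323640348411586054451046046178089692728536002218001,
  8395622373823253582599260176701720849469255984377490518839,
  9546425559115746426043925412801279478440410805761114409062,
  6872208393669816140849872743585629556070624586984821590152,
  7532415919374816456486134309416449287030966618422041348232,
  7532426301498422160914140147284176304740410210326822814087,
  9200285896403669696459745988777612216794592123639643250995,
  7514642960506983769773389682339583169501717348037225165623,
  8421754076194090536712298227431988835502981359229733123959,
  7508027689556408765958598691190062672993337030459661964373,
  7637140843807834596560411794372160597970638272733902938931,
  8369468581519467894663257032424335184199334748222871795575,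
  7636727414190063080214538185546313767245259955976884553046,
  7112720494019800031689616009635951079805961894318667150147,
  7097677928886109103369086752034480174877617416151202341410,
  7140611795943803241529437473530621700429054870225424757556,
  9059398472368281556667773180105459889865344425834532057908,
  7898687075363839761510105391377649988798133646908422846323,
  9200285497316287705120990492886789033423091322063841150276,
  9100673592711661265599058350057210045227998735985521406519,
  7975502689524835369918459854380472301358714434724000179063,
  9127951060829225819680972376131220559167667332527618872644,
  7975496703219458657839647615653491756940334833669103908632,
  7532611877129967076443846261221987753820013840382920193908,
  7534054528118959136195892743733494573462655348925620429842,
  7952431497776158206719404441694997452165590341186230977155,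
  8393988884232176008416202035344032172930033636349517911316,
  7112522524666758834403248188633172718207824344123330422373,
  7555509537889174463522948650085134524479691721857765016098,
  7897256043557163105938368083947467686783454297722091356467,
  9593824711983529303951296514506735561770462275995682763298,
  9624847049271046604104331979280919787505335891922195542898,
  8371001380966749763232609393097088588441026167375555671831,
  7947738157004436509109739315771684708001620200241920946739,
  7872467905816569012258940178878705363702113393621511324996,
  7091163388618687532749035769482109154927037664864278692113,
  8364691153165120652742722974841083843570345660714314773300,
  6283233736371071204077410307022895723076587058104812049750,
  7218666989763422066863265544135435594333039570925485573120,
  7638672846725603294952075851980248969250226045701968765985,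
  8369367187998368954315891182175166970698959688856126105463,
  7872549717560737485674390451420989141457474915178111198550,
  8421878706720705017081246902115941095308641579761422255187,
  9616842206017303681954441832165896565722605292651691861895,
  6723370002290376057785010484075952204275725731748965217138,
  7633666791284739063877442270737782270409233004724096148034,
  7533958797033913221730508562574677066848543516174518211922,
  6700168304457897168164088483358914509652660649319523828242,
  7846401115060777633454291693056551149370280908029142840385,
  7947726253073267244482251423202015624939571832857706120244,
  7973957423375931942603611733455261668769793763259401389380,
  6769130979498769746652238095061343627443306016904238543684,
  8787942406059890456834803583785118555322372651023714173969,
  7112311805182948465082943426531586076088829919388376581190,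
  7975538610129771895221340328878989399747456337133152272930,
  8369367183881744780865080843133463334822854716658763776272,
  6285370830196675324453791400090179171108867741444030752086,
  8787942031914045538801874736701804852144076217974412017668,
  7924846553480271368203731358676546473651994334024603043894,
  7089631218991166018534056172452695232844969062239094126728,
  7952431422958745965771731886435884432132474112251187696164,
  9206415128530537984013524244052886049535615147714257769748,
  7089733060906431105187469147213567228641678505424131089031,
  6285370825903514526131122504606592057560582424933270045220,
  7630793360581311607418160123495398014639510865338911948864,
  9200260353355908332469146019916357119215457910119837558101,
  6769065853428299481162567027598492210863335415703751063415,
  8312868811410475466406488930291360798711986404577904902673,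
  6375183797484229399897694393169262692287943430732042679364,
  7609369054523166053344879849394318958937961598841408144384,
  6699227632118570443720078643190966927070201526157749683512,
  7956921927936702834197937460993228668342030662618367201553,
  7532629790459310682425455710289738143955270786318104331333,
  8343408724231011746094617444238273411930842802924746527541,
  8790893231752374959901252227300598896868273616642305779025,
  9200255964827299354512130646089280301808757200058799359590,
  7952432171247584099164543473281662615108644418127972745779,
  6381815805355876676421100154794307973108992668326655513941,
  7146524768211200856660170356837270337761010250018176766273,
  7558765020996858639509156776564440201137086288367648597333,
  9206415456094611500761175594945715876269175327050737874227,
  8318775305377361858434999896727455294152979217605445847141,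
  7630793359119809970167010559168092697535737139479973286980,
  7508109932540707984303894229744696545137945979722414777685,
  9157267469492302144702800558476566066859728337558274659125,
  9427095227224187700007854190052996955437399194219839977335,
  8369457709220460975368896292421020698809609891924668876928,
  8761776567676062795662761226702516172379253043695106392152,
  8765057162597447528967299757841654427385673208195857208629,
  8790990209979796123444988864107399923815567321232303351398,
  7951085251338640851513339365436632273023877331053927884390,
  8788032199087003082891760199309901422980114163408412435795,
  7951083879366914633420674009545319230828457181633840152582,
  8778440961864678201601280987112031192342506366249280353603,
  7950791201588763834851328182239513189216648019038954530662,
  6285275044749117108294557485294402243392431549874782159941,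
  6381814706306645310661115545924437469614070768857044484100,
  7532624599205494883052641031897484178905426789520081228097,
  7508109841927493571921240828312832545848115807573608985427,
  7976958583484575614781404951510186561229685345632864523125,
  7954264858330746072942204266968868258251628285847794054518,
  7872819177631602354042363694463127094479481296601371407940,
  6277714733602647913788483350531186078916045268452197418292,
  8369474966654294452007572344289963043481216819526114754564,
  8363338270256331137584533026073604143036260059831921497956,
  7114355506677940430909047371789558037569961324577738072613,
  8787943227713259348715363459892001182928687973666458511141,
  7630787397659643320145078203562133075132020036219529470502,
  7117606497417274380770104776119497753538250868749036442965,
  8248486414094827915188745909161058492077386749771791754854,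
  8323301755736450512595337322353349845014803235667979555936,
  7581585910041767856149853643224558787234936312917814236757,
  8369474846800078293975289776334156542747272156807895077203,
  6842694457014340739602151704043395186531211434875082396261,
  7871408303878199111804529843517614958901788369377529635394,
  7944480838445204257581362444509641416211109823706148655937,
  7120587284099702533995263465209678038475764746726849852499,
  8369170366306191809279461993829833946405115158258432156196,
  7630792986441823911945532330137376434844495176451779597654,
  9206415850603021562687123476603491455687118994792458180181,
  8711412635295363086876824545456612156122664948268286764584,
  9598734734098968807100723670691602658153753417441688904550,
  8643990004655724304228523477749357508163600746350087923302,
  8370797141857321721936611026264826844572799291430304761446,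
  8369474966815531708712415993242277783307587237632266298709,
  9206415878457899768988735286250196974997203993922220021604,
  8735634046585774511160077988116121905092036768526733043304,
  8364588946068505770456902987741226083351158950934379652679,
  9200285146458462882511311180501957483326712857206315885908,
  7508098234097002155715565322739176104134821048162396300896,
  9201823181010293564942287943223052411113700833184588444960,
  7581772261830098394364447751674861298394233874320155881604,
  8363039630013921498603582447355252361780331356484188669525,
  8755862094547789658932052737458909455310755981134330815573,
  7872429593743207355958989786480281399777548762087900472837,
  8318794483218611471185231493969876444985439272654214731537,
  8323301381587078673919854590351659912968328583244477191027,
  8368978846479545895748704363391194195655373152253526758997,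
  9624888928505528583965423206058047651968518623768191575382,
  8761776567676062795662759686427756455379085512429057364776,
  9206415850603021563282617617618937880235851153695668720469,
  9176992014069166686372093932936523966394375135910699608183,
  8787559700084553863844030570160824180364950911493731673652,
  8418413075378412912769171204878881368442192154721245217860,
  9080247949454907451034791361621595688525578581888255620982,
  9206409867312772493615353440413072973102428112872304690434,
  6432494493045231812730149116821575466149012833367465953415,
  7512906139539411141342197267690493846376430761261310302071,
  8838616948576204052978268848568329876963819167418037916981,
  9080240417047004486855041918591089804561933909642587825766,
  7114659386055127191705356892746995806180910303711310865493,
  9232139055119193890234603105327624660194472622621797458469,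
  9108330152698040146547174675392875277712973122322627524471,
  8784877439741863592168099796058240325094395035319078695687,
  7530881582214474569539938432544854134079022481916108808806,
  7944458380474780590428250466952165909140687909501564052546,
  7141843492330323173476519451835757495782770467817473012819,
  9201614059216451998461840871221132869120031786572413482805,
  8784972422912533244396992657572913199171229188966219548535,
  8778846956777218509626158652269506389952178005017032619622,
  9203338821327836117146570209037225136009342224008105776486,
  8782010394718558012724478864743034234575115411303220938887,
  8711412635306781057869729256263751743234896460758515844710,
  8003317084326809755762687809542861927147710061831559538534,
  8371068497790849456928304454503273925559735921568378217540,
  9230911861886078552928799584719731291685203879839093184356,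
  8024555228409369558288857736276566771066383005305524483959,
  7859352297962898376447461495527138887670944334402163066704,
  7534054701137916748524541229324861949244256033309357786980,
  9624889319797878752318346250998526041606187725770136782984,
  8736979375895907125264907015502214511869150752212492257416,
  9520269917709211517615685688604826505041437243482413753958,
  7111595118418362086220545167890481721219302435354975958132,
  6459798851223845348770012743302108389375764001218366885925,
  8361704710563057836213589618296641419621355557399286723634,
  8318436879004740159877921878071377867393737806049450460501,
  9201614059376956309476602082509479627525275490055250715396,
  8784972422912533075616948423083365288819661049973548021543,
  9623254661013055917755274748030889227910314875153905317734,
  8787756804407083752317110031432243923112037335374044956808,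
  8343314787138891487225368669050757627531814920190250415990,
  7508003703196766805353217608956786622959119198976201868292,
  9204780117412779655163070710418413297465166106151128216883,
  7951020673628672265616536882129180677929131235000946554743,
  7099336676239836081257309750961796764289251392016804635766,
  8055613893648806865294368659538784992969148152269995575077,
  8027618910166447422195938886537819266359017310040733742694,
  9624889327106099168937474492931880937144685589056509666912,
  9624889327568149271045636255208858240877888122933327852902,
  7996957603907392659720515481430979168034086074989895256200,
  8812463156367112176504981703534322307721931486574895461956,
  9494110511617900053058403435093088162111628138480130290551,
  6678819899742432945664197656006270836084685919777783842952,
  8053271626818364751795084604468438898255310195202904690961,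
  7629069307189826155583512637921820438115792516619732148740,
  6400212203098322350186779796741215971150937629573152978736,
  9080240409829807376423302089112527886743253320587805860385,
  7148376533547544165369228122450215617069450082238321804626,
  8395623433795955291920964963671549923518711722045604196946,
  9206416246865498306865885292824504082183477572904578020933,
  9623255064769653373539976319136402709012942377315197290632,
  9175461064988306585070492570685075677049466896810268235912,
  9624889326033976796746912446044727233985815476134119630436,
  7143292160326844193932985687396040965039714514337038554454,
  8053979204164774194586286546519519517565101016960424170291,
  9204583923681843611492669862026947985694191102518798743108,
  7557073533169186072421688430276990205556468609086355175283,
  7508033588165646621487404520711002267131409832561498163331,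
  7559085337774560294551112521257798161288617259841444414259,
  9206422263964838134217213600954671769172780355733447665508,
  6486336098013617381511004190995776841258641773891396383622,
  9495644854131101798426739345272514772365204249873193830195,
  9624889327592910503072350284762732361829271788529889347720,
  7872527672074460627389159773336345217666979816478487947316,
  7655530790295378200569737957158594869293853770959001445473,
  9624876157710497986464410404084264968519145389948184769571,
  6695574928747105554727613130649990333197155315624668858504,
  7920274981840627401447585885665316620836762683780930469894,
  6694421422766722040300714160308135970511690310815561417523,
  6361989495502710977243823510811179867435937640927949426961,
  7558579676013628034990579808265501113981306200443924805495,
  7088092482657136197327825193330416421880291014424390747459,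
  7505135485766035040685612817410954666975257623337911918866,
  8029345488650755468748777786272345090459648996990816166775,
  6355553628017969607350328692000681900959122183566310975347,
  9624880692675410998051043669152214201049398973873815569475,
  9494118345260205788311789084875307723998174553933633587335,
  6793699596814484954969999725536007284963256427153862461576,
  8271695765007951529948972034172088814143442438068932920663,
  6484703635739639237623881230414563061950508209987359561572,
  9624889321362974325886252598901293338058700384796782659720,
  9624886932979567645457262392923388279359545616034931635543,
  7931373200123830232747090072193548911236682710916460131208,
  9616715994687310199064040626393637329968641423482177419143,
  7626400595651463957322282310140481587391249872704066062472,
  7946806710314671524497654777777148964882475299231279548535,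
  7540591355021248256856626054516030083327510583223414982725,
  8807590287756758800305313524275796847084236602220137186083,
  9624889327592905854588217814562570871306407421154795157362,
  9612603395297721608482707761861345424963697258122446407304,
  9624887355479138631047662610350464153125107979511585573000,
  9618044168372228512442350280821202643234334735303938688136,
  7148229669399803301916747849198366074286455674559432001672,
  7951365887412781240828640391983556373396615477832792421171,
  9624889323926980204342552772122781606984540602673329112133,
  7883297376700021910557798871359303125824890362531897479528,
  8368988204931130416447999055066181050588915204921355354196,
  9080138246036700658120163437244316659709202031411823923285,
  8761679778276120401627883321299303010654482670662025742455,
  9225833476524020303209344399403406141496140485137661318497,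
  7949486589801616774550298236054397673620981510643976254343,
  8373963932401859067727537211313359827618315404440141828387,
  7114616933817356683575200654164353074891521524390151847973,
  9494626643932614606308068819814189305538207532176327053592,
  7270976176336095274020044783030596357461017985543579260996,
  9053268490758209502855296727525665414966313306730803594035,
  6478195481348595666484969289458105229347011365265697093751,
  6878657318331979092584509806952011089935803402930125748292,
  9497385750037726185580490406184261852446469251189940171911,
  9206009196825893134230220066702772677706556413171936561288,
  9623255039821269037031253796639412640697057296178077010056,
  7661277246387266219524409317064685820522120602110722869384,
  9230935807220986101607329831043014087971594246402764976931,
  8447932750649353380884164070355844549002209961410386495619,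
  9624787534968214562797141459883674742654784578303151868040,
  9519140773236264655619357692935621992704225531290978912392,
  9153724573392839007117258127904264695901095221666803910792,
  9614148688576188327004650783650192576151307991396365398898,
  9198855565220844068177389342535432252046128120236843956360,
  6774022593520248070323450259516102027061310350515693385591,
  9231801812432172674081517452651047536753978404130763868184,
  9619902730774383916959645687246205211183168863480132875299,
  9624889315155874110307856823411318404668439846235284015240,
  6705483451484745521663297364636040660498895232766945014032,
  9206415880125977357816240757388362084317248925312232198417,
  8363549714984604293254158419282567493939195694557955446135,
  7114084958184522690714428681520020927254207227975676789585,
  6878034625124775375565861932688060430958667209133271492744,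
  8055323744714808382269470450448666835237192135353646481672,
  7636738139886795868289282327801583296890479144968189937797,
  9232538643425916033707332334297911283814364121952578385716,
  8387954663937359054871208745277010255889656331079336014627,
  8788127610372541539488342504067813567919992875514114360933,
  9520660474138456343466943694535277287590350037903963673990,
  8447693289532008577089184886866421483438825991243281487189,
  7166364077199438381627520023982089935486553595436490826120,
  8779807821201085115610109022314781916299603526141637566993,
  7481956414329115126699941456666232068965008999686853849462,
  9105233030697662586915802118809032925192765067448840950146,
  9419534726124108790172880335596594951772805639519357650051,
  9600369375554863575648507930413583489707399310958573160312,
  9624841412124691033313107835508119031319779538308089546872,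
  7122312136712880871554569162928514420822416575883308468352,
  9232569663752474634396914349330994537183451644855625222178,
  7123524593836056523422422675937361326681180480017946671238,
  9624883341190680345057244927334803379622635668812459051042,
  9598734737126232776102882861023955798550396187180487180679,
  9600366778335281576507365009163014178661844326698609768311,
  7582064891201785265884151031836251461783795152324104063111,
  6682497864187442625193416185850346155334472226877584476296,
  9624176956618724508096471924025269765591116256814710687857,
  9612629176056222817489716287693796113017997931964821632887,
  8761420876669431329798806045054536413512476885224871049096,
  9206415878567131792766524117785126955681823133277533800584,
  9049820211555038551132296442894177235178057273787083618167,
  7263313510584864555339472611191782378321927114316042307624,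
  9624886147365164371557338543892515651003749725760712610055,
  9206422253052292570902652931374614860625380589950521084040,
  9624888928505529466743053281365980298027851100182769923959,
  8318769788519178662331984227615401252293942696536840688984,
  8344942976021972147620874835498830968735200715756103935028,
  9550943797963769846300723585946486883941319355193018028868,
  9452672091719198059132536979826040381777429920641209370760,
  9616745551805621774381396396860719648362110221628035205248,
  8788128613214643750385430598746921021313377236063928481928,
  8444674697927192067233347970584727797437417696596955977800,
  9624386406884766008408424153022255250662495417213456124037,
  9624793523236820569726508922974344383603901588433198942339,
  9600273594583367761736651642800286632403306621945755633031,
  9206415761647000784150711829688004282222596183314588469362,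
  9614125847389366700278925140426086391252001565254201346183,
  9208047921466298494405726021862893456288973030396936026247,
  6873483180976802535661980643300674917559511848963630708599,
  6846373138851844054219475545711429495339829068762341476232,
  8803181332887197051172786900475773152962447266876099098743,
  7637146828559613446346247901600063866963462238378142029921,
  9206415878567131786959157820704906998573414269692369401719,
  9612527033213738831464865763585536347558145058946635298675,
  9083816634376536764923820075449264022644142523406039348087,
  9441809541400356948694077502088161380732376792668350924663,
  6460183869335458952780968794270071902546737006880117756552,
  9232570458900574780489759652678495768426198517843578025847,
  9624886309494976480209907425853287831853770980659322980488,
  9615592187344822754475941634424361705204801123581024503816,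
  9624889317350221349637145907569276991191131298223368902712,
  8044886414689346396229144301152429906764889912036375885687,
  9624787161223541838954538908356472617853369573005251348612,
  9206391933324305757445746175708534823174920477701794396016,
  9226440389044177216844218208173304178878429732762415363959,
  8443236865128863325961883782845383540078376370770633979778,
  9464743543377559718197375212121986396356327303311234978176,
  8250138661072906639660561056871244825058550841460692906354,
  7879279979655311902034091109577056018590442044170049189703,
  9425658149291064419029360320811629096659856917216591616088,
  9108336164031640210030471868219830553884706194990074136453,
  7532516446913700580982868645488730778989881688342308353876,
  7507822564569702210474425227992117407877963571170093777971,
  7530990429137738668394779708566907281738487165993333433122,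
  9206391933324305741109531507456237626921698574514359141171,
  8835459400875948497366499745832443221530709365979553691511,
  9206510154191638037570151926634345967464554116468880934775,
  9494141822834328922455147847302324264547369270678530783095,
  9227487553507722743898005840241199464660350463974869272712,
  6842828675388503997185865315261447575251498432573684025201,
  9107927849143199510103114848899622097827333428036987352951,
  9060420134052627400043875879635507554046135249921182479159,
  9206422075151386365321001998814344003406054181930081208103,
  7557043258126397793617591783426688580112189767973483280263,
  9206032754681915315084814580022346305750241048924711773955,
  8813714264501533129745005316622259129529461175269424924535,
  9600267092345359691256104672167909146816452965448484550536,
  9551227585718191924198329366382936237970177458653504164208,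
  7931379590027144762965859231108031151723765531280801822600,
  7504841106836479793498309751915681308839845494650628700024,
  9201824280060599353215771476320465587227802977459759167283,
  7506469283114384801932430712004740001773924326499714029108,
  7481950105055802645970939203214902401385042606440823464737,
  7578586366283143569893119356889727580411228642803668099891,
  7924835304278531064618757427137693059839195815502238864211,
  7508002153810162423323884952530040914184013401936830342676,
  7115683273427398205830554304247899672941759839707164280627,
  7532522082464016922410698882202060272270703468483567583778,
  7140202857165081587569449309466092587622529651929515242291,
  7140137374504763426106889214348714633470559242814644237107,
  7540184982548386685786268249793585530914189105833135334455,
  6746256438230329288885331870913609624442750817868944970564,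
  7531181123923154798683679973814048069600546103620891320709,
  7558371305402343349933215181562299942990204139877214401108,
  7898776890776908819499652177928451933814290827726268085076, 19014468]

def rlX : List RW :=
  [.mk false [.h], .mk false [.e, .d, .c, .e, .d, .f, .e, .h, .d, .c, .i, .h, .d, .h],
    .mk false [.d, .b, .i, .f],
    .mk false [.i, .b, .c, .d, .e, .h, .d, .c, .b, .i, .h, .d, .c, .e, .d, .h]]

/-- All the checks on the action on 3510 points. -/
def chkX (t : Tb) : Bool := cond (allP 3510 Pt.zero (chk false t)) (cond (chkS t) (chkA t) false) false

def hO : Hs :=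
  [9206415871229175562862668279141853982305668307008734258790,
  9616716392216111923475814310819890150508518673029851582728,
  7532611978455394692345502223702244021342852848817812310152,
  9206416277654507847747639000212740393003868324779415603336,
  9624870545543853823879262151111925518787443634898632537975,
  9624481013222850047327921603746978916736298363448494356360,
  7637146830117429039861115274738221224011271100242874169480,
  7558574506567488302929972227758018895050335044005190334327,
  9232570466013372890083669145846691364153237455068486730821,
  7637116499575068997360554387163601750930006675700189721463,
  7114048610151666352608337591837586258759166636965959513139,
  8789679257814911486926058765339536200501909708240911029027,
  6691284196800601464471965013320876417123106712595517179494,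
  9200285921346605719817126682410215186683238126503502177926,
  6723364175826073843694337525693222361068543179784746967863,
  8788050981308450470467352292036030222041456061329564770882,
  9624883341281823479430353748188305119425356269018801538662,
  7091163717844678434365429075285476126022625285438514362248,
  9108310623729620048275747957588184089557790595156197646882,
  7950982763610939811910896816348872386750768323544240763767,
  7951015086771435403550559598506440757407204154707067077697,
  7900729584213670289481792350686375103211430334312206434503,
  7146740375065611331863041834368763310943301196668609901363,
  7947726954593983572145022109539251498641505028315175924532,
  7162993108947657824919553169092203409540625239464707637316,
  8369462596578917686543527430022463152758996188075558978594,
  8830934940326575266384580199249559867784198822715543938390,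
  9232570094986800011274657521259399966564647562950066333542,
  7951091262575889433876005727501946764405767138877029972104,
  7950791245433812954774344749602248210974492903241840612164,
  6826348137135938694299713087262259382471111648134228489285,
  7162993130784568425165110181673749029617572804404564861442,
  7114246257981938318571901212436045830466728076964808377410,
  8371001474497861949513347121971999371862350784239440839748,
  9208050415762678986065555442163851033029298202113164600934,
  7637138948142695742944963076561042837864035399191851661111,
  6769058347058432925458794238671602453408719946338299753507,
  7900321013643129825759424197178106290293083419939758686481,
  7879166188312694825153763820006539767125262788369008771635,
  8786313753844391485437497032607918126792092027780650517026,
  7163568193868568979342986767155730264635573780881505281638,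
  8367839930479371325130712425659623602887918511077395350596,
  8369367186841279992193807408230428291939709068672208561493,
  8371001474497861984357929057869728151386420555655307155029,
  9616716368803541213844219039024529317808100750643918431846,
  7140293018663281583657522127850246636246515369132147837064,
  7089841190197194978134609349099390941273295665578998108724,
  9104862532340726394460047207364995255020311516864667984420,
  7952527228867302283061757375456118838834399804817722922323,
  8369367164614342822738564916015985185943105321234073797140,
  8369462618483249031498886211785600799922893284623259796837,
  8787840637316000654596963686199785217876148046152454112598,
  6679126398929772288015814897072412377934723160372705175142,
  6375183844526357860017050941022071570678911019881617178945,
  8371001472939282316877354265273130789743647014428712584192,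
  8740537187272326152228159874434232411336901375365672690773,
  7636757314604856983355995347813877904226087309475304597094,
  7871306137508427540301814124221122245362492368811828851747,
  7901745428401830632689018422370960239603582326997470417169,
  7952430650075331410131429921823795491092353141964300944468,
  8318386637675458077269506612715990467378485052807388148531,
  8419945552484185794083432914976891917108044600821176022084,
  7872480676612766502095663748896313931325900100605914347383,
  7857487888080576963081356283455967509480714362284600987921,
  8787936418298386669504491243989538493462560720925534471476,
  8787942031915450572508093449414705976246272319389677466726,
  7120587281073198702428845196621900445910752533668973262150,
  7532906403611373209021369012800979880609263179280552503074,
  8366594846840580538873553134932779571621365582826255505237,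
  9206415431152786179510475098384834177165728230330468750693,
  7950996329664532796044417403366159966918184564084770764663,
  7900340168466070252189493345342412544432745789062935635014,
  6695862229472293273488449841904343875237275870714518381363,
  7952432171247582710815300964811940923932780359269996581700,
  6700168680161252717168191879666102165983500924261889299797,
  7552832445315051920468879709777117076959082471919608611857,
  8787846249493369901776599115735990429985586090458670642245,
  7532624596865664556844523011414626862373766740358223578726,
  9206415831689847369295294254817855372980795228611287529299,
  8740422297173203528583300729710474101237926832986520970887,
  6290179030668355749396972607202990261961749357489877841510,
  6286909705288570776112849831593443033663220478063130443780,
  8832486963666024634838833251583795393338596693000448066564,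
  8393988111177069961014846218993606896949337591795479168614,
  8394091075441743002569427450208106131120561020285103710754,
  9108233997593075751584627624500742820002242081752089055781,
  8318807255466013252373869097047651285728889103242935609351,
  7954360634809027141175510300796353286440893581498864863028,
  9206415878457902288711467077910147348163096727271153890884,
  8369571146878896726742700290292645264242377554832558286438,
  6381815878419607192161913961180126294351513158403873854820,
  7975515413175094341769689002512129523307587272005683056961,
  7218666995597606237594423953192004958166576767292334674960,
  7534162356150916677789333113746890816917009231714390778913,
  9206403877982320865049972237671952414322806982881419031379,
  7532715215813184129625221279565903200838437551330224924791,
  8761607498158443161805923873853908853664021648984969140051,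
  9206415876819419499432397269434490596819320459045363799381,
  7951008302297768096843367863100913617930153808062426015367,
  9206415128530581104339687685906670054874161700864145114980,
  9176992014068475363313407587506409242921064669641265538695,
  9176992014068432155619741567160781343713422706154318227044,
  8369488136709811387951483821750617400194845844334307599972,
  8369457709214395249329524940376899984723104210585155753813,
  8418298545087674342421506984888393820499364530917076129110,
  8787941332039612225852310123508509031875283623105159059029,
  9206408720102734626298638615217248923979697879629024420932,
  7977156507445925044619500693361971931766773555576751683447,
  9204876952052971029335447929848302761517070859349159855446,
  8027620311650963117283266688480039797493017376486021625207,
  9176992762356532965154674263374854114387457289044246357606,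
  7112931184388518488579763799363080645730356456065649309286,
  9206409493259627516741444459213669047294164938279728011045,
  8787929705513255450675488674434183276242593741996378449783,
  8369468582798280356901494066287409715494476276704481592422,
  8369659744386207527413817482986803865049033127253080539222,
  8003304336915374393899994110027487048340550397572608845157,
  7946091615907297387925330545238674479484188629093675451700,
  7954264855304576751550096500081886508373276456973365429331,
  7192608185929888129837611089890486119096506944136033813587,
  9624787161217786667017400475660750516382192298481714406690,
  9150742789909235614964296032313402700645273087748952590472,
  8787954801250119849998846059687970978090452290299464344919,
  8812462355362786681620914311809829266146140973691242238755,
  8787565691047396274476804399037065668695868177778704086903,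
  9206510909501947919827934926448688997060855967027468452966,
  8395624369162744238286754658524115257195023792403560949351,
  8784972421256925741529282196400164178307986444583448311655,
  8735658385060646867628326587058441242421722903834460120934,
  9624889327495477067498684526010573373958836126863046633031,
  9624888928505886534175580343850313834694469158894688420932,
  9494110396157462862647480345084212476948004100757221889416,
  9206403877981290744850865017025277813516673964440812030088,
  7954265226435001133795937344810539621022337270110583416951,
  9598734712176423684603935091495484396841868213316837852740,
  8786512076888415898778847962689217646105665770592190040199,
  9204583270875116228059369836600696338656885830318072231541,
  8265237472538215175703205042956542436663640894070080173943,
  8812461959107828338550443912078135807832852112255299704389,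
  8789577464037829833216948437693001951008019949346148939575,
  9103737904097674270020093975374150377227943045978413033302,
  6852388183848777125326241857714441134582424548457133336439,
  8709477535440114875101913255898674057314853610202757101431,
  8734107160192828767035899759179727209418243818735827121510,
  7952432146310348724222559009399771408835795446655875442244,
  9203343728855870288784966391088769106786622395646425248563,
  7973981461791650617955847542491708758581154340159116183415,
  8292946372862107581099199619548380830541118844195063542579,
  9181793783366860228764543282794104710636848558649627726708,
  7975528230939800037983450725873769390287001580271722526583,
  9206301336086246352839201146134335791873852536727522194740,
  8787942454483599055825388963511485612814757557816158217830,
  9206510162955004199236020143444470403678219515722004190550,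
  8003304715638454680126694971611765018412588891319252322167,
  7950996331314829852295729283920615989334974896238332699716,
  7951199912555565122945837524352147857723268426247579264630,
  7636948435369932011991866598081120805161652651581349717622,
  9624787161314774094300344474168689094176356256797633578871,
  9200285893383230213453189197127242623481432890928188983432,
  8787930827855216567159902239965700029148538028805210994552,
  7508033588176395580605305266725986866725029063831863130215,
  9181698002767449272529038520286008411348685075795210176563,
  8784972421645898311648523206350842172490555539113057416055,
  9157171688812941552080455986025504923475153137479158544231,
  9428729499275052760305711924375229002011005932764350935927,
  9624378472391990787537318088871257543379908759552179656072,
  6695518114916914719316831240489860743896252752971828373640,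
  9108144154600828357090730765252162937645636034141010559249,
  8372840470608047257214819550962760446334348451383332847991,
  8788037412630054473478198180305845558517897930035540817477,
  8787941704435968137996247109602551757249022445198190802823,
  9229504729760583569766227479788377668321301392245155903335,
  9206391933135529948656955518360658423210274965162020856949,
  8786409934000439779474443722055718078737167189748269676407,
  9569239387464575376167142629675146799421411103795499447091,
  9575633864886902182474214404307974940412422836694924298086,
  8789461783070763397032706736479226605349868181668909971078,
  7637140444719724216083094888826237123218293110469800843110,
  7114048658380843035798809326175639118084174650810802853751,
  8369468981703358123454051475520836176174117825889423340610,
  8369480200287046027315188400444454211563079318260385338180,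
  9624882942189090784452790743910608978624521898200003846742,
  7957534179033389983802639313144683712039381035095276275848,
  8737279808413926352601144138520460975246666408408428721235,
  8790822243895449144250750014974354089668696890004906407799,
  9204871011512339334133355556779144333550057425467348444774,
  8787942405968906394984412405938600786480014614491337033527,
  8395623970069633895151132489818248980115088185077333771332,
  8787941704350401577974557657218048277853604703928241583991,
  9624857399142847795432475753661586266939474475118657763175,
  8735634819796810519135509120204466376551774831909985093768,
  7974391630079967605051499150851770311696789926544861980231,
  9624882942286078212653068169909471489256559128135373124470,
  9624888928505506288660610509822256266655370169395178709384,
  7610974252562895793102396294622128932063617017032581011048,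
  8810930660829101810853575869535206375253275468006866515815,
  9624889327592910475489541422032309288276977646589562024823,
  9206211545834819764406977295905350097448776501895601865844,
  9206033127353034427298232975632304860374735471157890484023,
  9224396793109942253837431846464617626978745625440741980024,
  8810929889156237201659260687429900518386470100942628358260,
  9624889327592791566900638824805181633574143679439193994103,
  7957534178649372523886654975190964046211626845006309189768,
  7508033675867234205199806116648523132367687338312056997972,
  9624889327105741926897381000964612116526982881924878993539,
  9624889202963745020325310393073191514601944452694342666248,
  7950995537141647557625364602231800497531119984825512108328,
  9206032756240850348104312334534913821988500098902724741256,
  7534043453078419504569733479820953818881587213695272309015,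
  9624889327562462555557309764061113882355039166240472262241,
  8814084297636631584005654491931375584364404170395041936455,
  7537330310612502164354080899013191586222825550211177744214,
  9575735331203051335525256379271323854534819483853567260211,
  8812564430753724598252294977144846829214139044999525070984,
  8116984701574989711861683624408109989248249853876177819511,
  7535791406302418983914686519935143111361030473568626303366,
  9108310622839039624714949632831680348040222794379300193844,
  8709958759973387382814185456250637591577306530152864494423,
  9206403107776686500241942536287252549243446147822043747936,
  8787846643727681579899616820626421193333285616594522945143,
  9206223869193675113161423828624156527033504022550512280931,
  9204583311681244286508341206376810681342863633406409205879,
  8791211753355777369978520246536090403343566513581463205751,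
  9623254618817189834689936384059765860376694350110432651094,
  7976874676933687731556001593844088058311535647971932006536,
  9206408720118777781284284176670883011904129371911191229814,
  9623254688701301464607363066870199367228283151190810060423,
  7559085338505311723754736817594092373886719786161154394248,
  9624787161313435962116103105290885173333089588381682656374,
  8787750069618851036429360380988940257948451764285717448840,
  9200273524694874510717890428443185880631893253080100529766,
  7539060724253283080764082228287248211585931814966421443927,
  7140706173879630685441789950112821132484292654672661149235,
  8787948365967635610817986020792885653678728700463768175411,
  9181698005690452518537678885647383110831916486961057462135,
  9624889327592903070945237222402021089379992143339074385719,
  9203146559423421622032413717396119431403711798057726391368,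
  9206415479570334372563950333401490276393210269316618417015,
  9624888928511233486263569062781508719782512830901700298887,
  9623230340351276864030620051250450263044352454415474971992,
  9200286270182689498122983994986281147471341320642413103240,
  9208050540477388706016480004996178227068221423783764309048,
  8369469379699936267074350720777824992485673258517452584759,
  9232568597824546433385732096826372668342009793406597031541,
  9154106770686022147884277744534195456158073249011938505528,
  7533958898362565895748895735097025558066448597971444660101,
  7636948084615271672554977310140821335567877407413176404104,
  9615081354706404719343654041415381992536485811782855893895,
  9616716369281666298778514806709553762037210049931141220488,
  9624857377699438026350661061690067744207780113771159324808,
  9613446693350300473318250320894337608601461522601183679112,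
  7533960417869333517857844741129737895180153182309821483144,
  7956921906306456399705152770200089533192603758483739281544,
  9200285921346617614909648660004575425794071827897135678532,
  9624889128049230694650025010619223287337384571712768643191,
  8395724987601325297149418516681870369237642927455832848247,
  8369467460455388468904007272743179781959771276591815422839,
  9204474718035868873508449011235618912806052643782299711319,
  9108342100388654338854672045559580473403473331921222063718,
  9206032731109110346822262923751802465453525612629798892088,
  7533031791586175428559621680041472389275151111660772873560,
  9108239584806767903234666607508762942636861973311506511715,
  7480212901433226718536172224402847983889826749993247191879,
  9624888928505485277948528665044574366456184923939386307458,
  7658678342673135575555659764610978062926496959095376218248,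
  9153998940454290969405385114073385265181260840947134182213,
  7584831263596522484628221166750911525152557130269291149175,
  9108324163366927678467200688447451577854820511039086678612,
  9623254667142727940582354203885591828557256816567314040951,
  8784972053347485611704183692096613446815941885714000021640,
  8369488136709811387951172264770844160093560796486479341414,
  9494116405852192768112240786270951330206006259430655752023,
  9624889319797878750957127475824981137954389159934138157192,
  9181793738225250209748216737071620247293219346137697323144,
  7957408065770938195594240495446299679644534836596371392375,
  9230552680316093989081078612402809489727435002112126641782,
  9175483484328130490292748105979209503887209110203250804599,
  7533032914310234801916133805386463823630231903553273095780,
  8369679698652349656901342773271817250148266361668057326454,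
  9615080991340560109002679617419764729919087291563441878871,
  7514156879391595123228268628501654304887231949488282634376,
  7531013629002639716884947064679971642803362569155524130675,
  9467961419415531725409888952703715413658929381630541194851,
  9206415880126066216340336476415157777407283850938015774856,
  9206421859031785657533091093250248049131262678341892138071,
  9624889251223740963125612614421574079576343574177403930759,
  9624857399142853022235029676415474069608380248889060840792,
  9154107894701026939836529336110969334681229859465466090120,
  9624889177934794950238211147038968767859846814540621181812,
  8789455519458343876781890432478484742987197163802523296855,
  9624889327562461537012441625754347531904667371409398773621,
  8691376124442885647467868128320958937690722262190481946488,
  9155754130145340277669752636901809378590625552901287995222,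
  9618446560695031562924101693520085295473653594733835401078,
  9624887354080079080249950015155996891485979184038541613192,
  9206414378967924220416362733506381991372200921009823492232,
  7113955246974082283121614071062083734405031459063793538424,
  9227664687409826706446434677454161905062455916108418934914,
  9108342549349801376608033725391171119356972511376692441976,
  9615658261882534559533140610050784330586972968573314675591,
  6277146433173313139563571343071899444744001143054347499319,
  7140618274875716950455577677238396351494050256289782073344,
  7637140444720485383461135257833028393182325967951676080948,
  7952529473733619489941185902693692155293118422888710551671,
  9624889204250164900896321884739480859235999926218308225160,
  9624887731243475172686796023298772086365326119988166271272,
  9624378846895992735015872538387197869300339839912310280312,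
  7950996978363888030751378223730620380027837429733155506312,
  7871612256626959829455628241600808750225110490707439159428,
  9623253169111066473283738339219788298257939569035426678801,
  9624761619632717865471440346199265668157684935178096965768,
  9206419285013447966373467220478548259264710780115410712712,
  8783038426296873363456262237266246083866171637762906927923,
  9154202478312802424229869355881427386440563059111614703446,
  9108138212421381695691013275372188634739774892594467206967,
  7532521714532142331797351691103615273590006444887388944247,
  8418413057035449879993307108581286198466088633886531073912,
  8787744856430688035780185215556441873303392254024156148599,
  9206205559219098624984469325397278884156839759713433510758,
  7114042672075843660861070117659264528022758209154201450295,
  8369769094225610492998166383804361840558196683622010917138,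
  8761806995171501236414922045148498799604033917159670632789,
  8369469730271998294273563560701170142994423188800343008853,
  8271293502472873196077246313606487575821985066288049116488,
  8055613893648805471496314590504005478449823432308590658628,
  9598735110807820601302895553709158565869715367797316798308,
  9200285449007569093758614025896235926987977116092085078152,
  7663295033725639058048228210727506227298469590599652041544,
  8418508889268140057957852575431776622567828893384824813107,
  9624851013779424759114198884503207234191319179677641765751,
  9181692042763772237469463518283992548599369599125650888584,
  6854137389122781434752295590244590575963576314718292433011,
  7540591728976509508809576432789076148736410305791591403793,
  9624887330724484845820000953622931846562895058853220090676,
  9207948371088322128399108422569520332912143080926879451272,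
  9206212368945978053166979916219442522433106220932210919543,
  8787756780658151958833727657972155666754520229368593328243,
  9624889327562485057069120316987168723839395583938394548070,
  9203338116975347655676658855257983847233052721164481615224,
  9547958102886300146567601258281557699559597119550850807923,
  9624889224802174863805685315872582837706448786088858712200,
  7531015034784527118406490132205804319580689148120435663144,
  9624276327951600023888817282543323955698395044029698023954,
  9203332130086198477626958643104159193463148964788080545912,
  6695518114880519818549687578229124857795006819828598601527,
  9206415878664565188795481486686413891040439680361400141953,
  9108323793686161751886875766003290788739189749294848540672,
  8791211753361866501001109400398042912676999436699352643463,
  9618446467158926690270796799529520176104054996142346696309,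
  7539162896437898222080822641284012567873713842828613224584,
  8395438394535164319646382944665908775095403789266201359170,
  9624857379159598918488788971454872548454739964666240530247,
  9624889152992168277221795985381588636074663094450485600584,
  9624889327495476876287996718053968165548339356748396066679,
  9232570463169607043538680847679036651849015915278133318280,
  6461818530660767354332112615113863434829272176938680026935,
  9592305389445205516658976581957589235653640100851407655185,
  9203337742837107262744609754394188206210681291997440062244,
  9618356671913772126349127210492576841374346569765934545011,
  9615075519478429511673289306610214162747569921359861024904,
  9208050529564630575899417815846832385737546688666535004040,
  8665227871242177234422007544265785737100909594667288393591,
  9232570458218696567596616869332898889784029901463897530914,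
  7900831469882641929718666713188643611360001631349928064887,
  9467961536337565765072844142165715520687774519269408641843,
  6694662065154160363091496238898214404768984952790294497415,
  9232570462889798944206912553415282729234159997382526403201,
  7532617869669634112049887971531119300110818010687316985992,
  7090039536631363061027205369096111656344411487128851268147,
  9624838244408381487150419737784645243314205593527063446052,
  7637236225789198506103391100616403678236251910156282460296,
  9547958102886294576490586872011364811041363951051438830402,
  7950996981098986715468687825450832872817932027722900932744,
  7956836972600215348972452353203246180016111605546124609672,
  9208050540378528050700790196000236511203533520450942960707,
  9195688410791932123755972597279325184054998741496144295735,
  9206422263959509737301163322301848611387125535209146023936,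
  7956718345045673300794622163864902877910987700264371226487,
  7637116499575067520898049435481395513376107264967757546563,
  9624881345755504160705318159378097653156171464793690158131,
  8813688354536556155302216240563710970499324107577586317192,
  9101784889314095431151010269965125240285196086533224294263,
  8709568505490597708743086827309068821410503844234741884803,
  9615081356714891606544304915011356079311937920232407048227,
  9598254332192424217559694052977153949504171165892087392392,
  7123351392429172754099920494216135489978270896646519084375,
  9624889319889696386592546129912142242658897922285837239330,
  7636756499099859938543681244110993353374951895052719510596,
  7097804180703244612945800443772631952719230241906555914375,
  6695881683519871634309942195633047396199580475103939953191,
  7951404173583309886379650694225294553667665476271917306129,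
  8683719967812310967831930533617507007334653513246096967492,
  9598351538314699102262258267985790908365715698389731267941,
  9230935430068309314779339802198657939356021364437491607398,
  9494110511252099257010218543238948342627320014780113647415,
  8812163466690214712806675262782004004141034182988249204872,
  8349853029803531905368880836269154022409577102133807248998,
  8369769000683800720919729222151501940142046723861488633988,
  9624870545555628615893898359015267888858868440929652914007,
  9624889204248358540529569468438511114684110601278119704440,
  8810834854549416683873111824269671832351176266994208088594,
  7635607949179976306435831744270566145115893946235137394487,
  6680965393553000381774072741591825888421202694519030755944,
  9232570461330975668739963513074387361345493038981087498513,
  9157172511638269613102338209634120732932989460431266941063,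
  9623242691502659672025330495213042325074848104271084816519,
  9200273574580797331364285673300094146489119538489710827144,
  9208050467109341978850831170991818055200022509265977046360,
  9624844628935490521701075529095603930033071417225609967479,
  7634068673731206812545463653860930710027873432399607461752,
  7508499117370647916091781981887665869633234262473930187655,
  7900352446644869315667186995305437250835759731528218216579,
  9624588814996400307857287175051498839613758089734918801459,
  6461818521891757530353341325648158112000938032179843664008,
  6460183869432892354617277207878648740108038347149160251665,
  6721640737958420346218423335455675379823365536528474832896,
  9200285921343584754214433828760397368758939920393488834849,
  6878657318330440226552788373512710467525436927990941841221,
  6288544370317247968030926203539840057587581047310291339298,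
  6277101909987409796554013301714594128947815681385751412736,
  7637236132143863722025236577257357233984289887665561045128,
  9624498627283200098185135911742578212486226194889104066696,
  9616721637882316308615410972729761043080239405592787498872,
  9624888105406457295719162452226150880368893404580001908872,
  6461818521892083678752233211443491269146350455940188624248,
  9624174162136361696052775470915567721198361744499925913873,
  7530990083857998987354283307014177279048527986483099301768,
  8055613769117879049990085046617378131149560687096708499592,
  6694662072484504493090441500280723076181206010724744700449,
  7532649293404514574409123981042680469315059989013722597393,
  9616721637882342895511832347100382855359581773492176586787,
  7097804180223341380081836210408498923879236452987749798792,
  9232570294527112410003317742980374209205884326000523249698,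
  7629464822075539129645620279617612677860771576787820312455,
  6878657317879428676558774928510212618483164317085441668231,
  8045817553499328699659368561844934391766859523555320170530,
  9441825138643269538960778378625007831026595657690869433428,
  9624889324475801542929950091860499939426800975045756208212,
  6680839305458779815306198643895969444853163128327065703048,
  9208050538553079732627388523151522651796102769559864639809,
  6696049300220416074490749162700997786312397423549495867191,
  9575798387103170727146600286246653066202112103871150227462,
  6877124447117017266226830706096938925480412143828155725704,
  9467957818277400395596102522851151026850092891854113743912,
  6277101747176127235281910963077445655930747102727693174919,
  9207999631526263553044918768396549739339794705558677229889,
  9200285921346599774318629517068596404549625150134753064819,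
  7897166624149646872820857134522364813909278687515743844215,
  7637146830115503742284812681583297543515716049710296090658,
  9624886134894033546177243436126602751822866554198909024119,
  6694662072461668549784652272193283158511250520795440707448,
  6700169104191499458035332393884844631220431684653404424321,
  8369679698650922407836165914438163991853639655002854413384,
  7871714428842333638972707835491221023438258848875825104982,
  7637242610990991970883442955385560783109095315685828150401,
  9206032756240850278414484843931785482767327327980409272183,
  9442094517873665244397582893007532599164687518346842174327,
  9206515051681862890867308186917148840462927075319470113844,
  9200285921346627650244390192338668631019149810107183232787,
  7558676602876025706766120783527115330331563391971925374839,
  7539059233533457672013265585348813016107655174621070132292,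
  9206518044900371379131884842112591591505241268131531535171,
  8029459328125089956279446050698036007083347107446010312565,
  8446296590698461710340683200121809028765114072240657757203,
  7636851904543646660309292036228852874996775776864542414167,
  8240815933200683320062478750013609060764262218995469531255,
  9108029665233275491526894566035690288682414910792073041252,
  9468449069897938375429144674622658017187847247073548728183,
  7637242610990924784086760948278338802465756262334647011464,
  8371001451119193901161533131551504648044817620619747342455,
  7638671443663954839086349173232287597010612512057943549536,
  6695594340594545863632835209898592119598729779809014547266,
  9206414687151092179208755761143595688403456535938489139473,
  7950995533041884663994995687635485450803670105860878141575,
  9624857401064999293732646522151902184607803703403208721476,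
  9547958054656746114653474945703094675068542051907092908168,
  9624378846531087125507837679053242005649086222287863580808,
  9230552635014425637321353786963013759850823577334530476168,
  9616721637882316135796824480682971462752048219602089576307,
  9494110511252144044341393936285781073716659749571582505864,
  9624857422554978599825853137565167460953327212478723164296,
  8814097020202897664625984446588354033286212955630716731688,
  9624886533977845860634583265624499079484097127798259869286,
  6277104528998343893531505492335356285060193187396641585016,
  9616721635050638871806128090935376527855959394709801568392,
  8814097020202897676263628607903257983617292503924997183624,
  9520271055937038781014482331575251399837520418070992552770,
  9543564897192253413180906084274154845609175859651534096520,
  9624378877564735572258244852890947285942365528378270296643,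
  9624787161223520932003162671359396216291063870481234081928,
  7636955268169495271033537676771017360842188490453016592952,
  7565111653435015236592451798099446061458781249720604115847,
  9620081102664715323339892665285796298111075697322626615432,
  8048777526876948233794502797679906992049572678197679982728,
  9178627798046522200262746356397366337627516735373158417476,
  7533960738303576394267039531817959884232840253904475600757,
  9624863019004503474283455655187631150779567082692387833992,
  9470969306707075161825084693471066410584309221163471610248,
  9442094313630327889322636155459533381880815887362984068164,
  9206416277654442252196498192093467783473815463121058550852,
  6694662072096298682596631115613132001600910141859276679031,
  9206518044845178970313306263839399195375430719861831534721,
  6774038906395873025219657137881080922249908527640950605687,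
  6460183894272711237671053155984568787179973013838522238017,
  6694349187796103779385209711156526536882993938199350902784,
  6695498559451753193851392882259190273394877247176382087185,
  7637116501030475481327506884152106087090120467671886659584,
  9624888922659523172951649359748461037647380130273429553970,
  8369487732963222489385754577050507182211672095116450281335,
  7533960767162524769358185199991597460533807165557799678839,
  9467961559721584562955219353486617396410978537972391053448,
  6731537745956304645672245751765006216316040685794835794056,
  6695858960482815453539163022065678573799684424456694407746,
  9572586930950106478284313109214338343803349061429987984456,
  6460183869432892354617277207878648739001313249163041343624,
  9206416277654489920033511123901529896132288397923093315584,
  9203331732655229682670936898018764723451150252228474832759,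
  9624850992039587876614461803571812443544924832878168409971,
  9624844628935490500651886258494565151267744970867785926536,
  9208050517093362165761240109669845964377089724135541012344,
  9592400328395583381843887039193011571417689200681172825975,
  7146844037988053419709485385972760540970150966981986235188,
  9208050517093362165420662373845581057594383618596873470772,
  9624074066903567380509022026918446352248054527591110375287,
  9623230720537260226059695166748227550372308307138097219720,
  9624378993023342532181044213046730888413465694611465271432,
  8045997234797694182774805934396949865323679354616831031432,
  6756057675061853150691031361901586601025848212662732227668,
  7244821586264883626438262507612974932891194303102894491684,
  9206416277636600274218859506604907151008621159419392565825,
  9624888529418530214504502104863406868870790647373463816055,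
  9415697324342380377746551341008327352675372150209356724087,
  9592196095720945280433897860453923616163290412297565534344,
  7951380150395656557775312500600156928488046536306747476104,
  9232552503963026628775992466217003226532440290085904610167,
  8421369519574611437203792442382913922542760127127927075635,
  6473669806419832439414407535473387927766635355566375400715,
  6461818529741587086016970155788349699808213461462201545472,
  7638733196214406960311458349565824763342697978575039496192,
  6747980620408529010370653521138029369935994230141157323571,
  9624888928505530048945004050252884284951422485013528134467,
  7926498355196565248201434087607910052790854838814028035960,
  9206032779624852782619116736876237583358501828744253573188,
  9206032756240850278414505937637695909252096008149787751223,
  7951091312363667617893060105542598647544445498925841332087,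
  9224805850000119856910676853787922968638185508180087804944,
  7975516857317520979341210540246355910190390782032977543991,
  8423412817324026771236699422643085805533287662547520489608,
  9206518037142204630635430892276569324815147602430495384917,
  9598351612778208939867815143057249570170468004996993021815,
  7531015527602783989425984523050567443523664149547358582920,
  9199877207542100099394135254600354913943269203160274077811,
  9108341052764513228163336995389106100023431881970843944824,
  7926475509276620043421195641480944436227902284319816906615,
  7539059233533457672353547952289481073389276805283063564356,
  7244821586356227456267342912228605472844043376492859831107,
  7538676016104976385421749943157891487941793711477919064610,
  6852509113103869589027914760780531098513810713520440297283,
  9624889199802474915788308929680400698212964157631153796983,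
  9624869674743142534411101803835141153841354402125953730696,
  8447524039968627521753740425513376694487715636856629004424,
  7238793769983003060771320850779161907814475325373856385160,
  9624889202883456762424243769636193714198921063738519357576,
  7632345001799738723989429113774540386329918084991223678024,
  9624886544893793003284252707950325601042609253181263743092,
  7090141702998827332270217937661890724922576191917614729352,
  9232570395776420540683880260495041281473807242309512208930,
  9206415903508973758311275280098881923606770320077535803255,
  9232567676110269607397016106497497293830968324589930047079,
  6277104528998345287318775793199180980392386243031891146615,
  7114661631184886259072438166711542167045162292632579770504,
  9616721637882342895618165719306778031894518831751560184904,
  9208050490597555771365099385053284998891584223475732587144,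
  9624889204250135537226211905910043239709558215293649757047,
  9442090969714488287717320894718937046993611260748500312360,
  8787948814939463797968499542250615588968681919183464186964,
  9624174162136361320380035035196384249514542491151435860102,
  9206518044845178621864147933464658468184339784786729465992,
  9108330102823163337347863429965341339302524361465367918455,
  7117044183285661336471736307997733038973301481286569042792,
  8369475765001043213524869928345701282484575551216977003624,
  9208050539795353807182838397601548420389528053989780260997,
  9206422263873874852578362109933155693102940905894196901751,
  9551329419839546123686547309354634514852875268563994148983,
  7975517056491655140546123094234641799766294497153550616712,
  8045997119436112008661360348347667073044244805968150890632,
  9618358262582026808486363240409002995432376137372018444356,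
  7555535455855676844680885419726636690425425253055638824840,
  9620081125951314030813631804417329540167017624070462380168,
  9624176956251889815531789391248340207790974119037808113800,
  7974389735974224388082016245367991636170718226489976883336,
  8031093958663528278703445350213032559345429066845893653367,
  8348320541667650307873643357120053823894067533218040739654,
  9516937693998977727728916549537432697223738462146908029250,
  7162168993396331794666598703123786505668663530897919198788,
  9206415903510092872429129537750936185973844357004546819144,
  9208050535891927539596039372279463422394253812112979804455,
  9232569670962566104149957831649780709298743693014059153271,
  9206414282217253610053049920313692519703959644989296162679,
  7540210008230678832405991165521053900999938187620902011920,
  7636757322394178368439428056167153827690284980143693250560,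
  9421784181320497270198755030842997126825093468405145744435,
  9201513489061965705202471400070918790084966172305748411204,
  9618352173356882867777951748664849129377605606859152303427,
  9592196095720850068321049777623872372437272398203446169736,
  7531015527601355434683208807207143776449800328018874824840,
  7610992238091413245372396048120126097380887881940306790535,
  8053955286209586005261866384783549705145969782383282840627,
  9515696329681700969708724338749116973809090539453220946723,
  9624174162952747376259318125009511070278011950381884999816,
  9471020938637035958987495301839833414935090512766141167496,
  8045817528556367887846951640779605766863502706150763693377,
  8244858735023679118285855901211908384503378969811700958532,
  9206415903510045488151981185014411027675415472558741673032,
  6460183869432892308157439492812905440507988652536183154295,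
  7950899837841696409291224283487430635124732001230770405376,
  7557043607102018950998489562403472080889236693795598796936,
  9624886931826351509753421234674638051343290921586697664371,
  9208050529564829888809961989989287991740020285409025593720,
  9206416277563168366998005684649457634187238427111419508599,
  9624863762637855683238223216995971942114957480664556896327,
  9206032654915785122146489596487665791415054434817738487688,
  7957534171427252153774866518764705296065979699010049618979,
  9624864160167394337379570337446444711282037496658614847621,
  9598734737028799335061862193185440744388730294700566991736,
  7926498045314067217092890130077287157061798279105217595528,
  9232443135702252118262886640233052586060622282729837856900,
  9207571635620750613971230651380577800522450568596085573752,
  7637140469663344455360426902710410645660392563180293945203,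
  6756057674605133889473157111289713059375922247695834628368,
  6555198592869524649406182499914120434656374083840828000292,
  9206415903510045489513110654045040986781805460375662495061,
  9521804858048705153961134960080794919579240106279651316752,
  8368147203110411954447466155234286814915467856618175563912,
  9598734737126230919217895724363150518746327477945836800070,
  8047943534163551386529394926204593234035844820838440501384,
  9206414381995544743009451119934321838517268967970385135667,
  9624889201423054453217883241372338018877353486139966130295,
  9206414381995539174630100449332775030633383194412689081604,
  7190876993372363926033994653569801633868433622938350548855,
  6461818530855982064884177941591360732718171748540522922803,
  6375232533186770879654092740220042338558349351130699928593,
  7661660373374226620560524834689615310273201420224398898240,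
  9624857453222646807162744772166854806960586790088764523400,
  7949362465935149982496935753048892490801912933678010693496,
  9108336158105732138160384733832511392680921383937353327172,
  9618350305807485856097247785528521673944128114598986942583,
  7557043607102018951021107207519322325293144530367022598280,
  7975514661980307062737952265117923382639658588139477414707,
  9624791650955122171051706212843296000000726748333532861764,
  8445901498772273937456323186408065987692802477987169056631,
  9624870545543853822449029133674401777239700339103753602405,
  9624870551143636358749993308765493886067126319050501879672,
  7534056173989052917076534318468996932393520336481851766648,
  9623254665681226401659583142506824594860000634607611692851,
  9616715990638872985901618714633218168161799198021867047048,
  9206422263963323164452574462452588263903669282320424601736,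
  9101791631330754841255475791114768674640540886422282270579,
  9025555858762395239545206673527092831910976761149270558856,
  9200286295491024878116259505734288496091582087621650874391,
  7114048636556465170213367738507486659268550316986848158759,
  9206013209682529193330071408156922937856745433022959277394,
  9624889204186979828212036309353231771566367826799406581623,
  6314698959322590547604540439521468218935773604501789100168,
  7148376531696784861230224447375175988150960487241274130517,
  8045806647774111372361826963938130583634498491910663471924,
  9616711228822552033712344885109260187966546773456148005972,
  9624276329960807992014051787418769867018494204617563474056,
  9621626389261827227651668296767043565798079474701058508680,
  9624882942200910180430454106615429200940120452689909200760,
  9206009206967534731998260588442194258515733758345185228664,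
  9598351614702506048731960740551577142236396205528665112848,
  7123856480272482003782196548402931095471469226364533614728,
  9624384115586648345497283318762444763443425361301726595144,
  8421778163202685770567822718052024778868342355882231867528,
  9206416276193001664970238656115808110673459427181775574613,
  9621531007286470047080884026879391113172433196898563094327,
  9624870545555628615914152444154686022429087285996867258504,
  9572580171384813571797295978738998407131987454966684415863,
  9624863014166771539248154038539479665396611181023180916872,
  7846683691727067236982055125962482717384921635504219785336,
  7532930654405856957946221365737393203277236086971547468928,
  8338730323020395966060310937535544498793532263183692362548,
  8833406917667915742604140374829907781101071443418478577800,
  9206415785031407596825809931896302583098496324512818664770,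
  8814097045042716524109484574277178475948373217093553256307,
  9232570369268137600587791724019070974449060009114203586560,
  9206415878177420340974074931260878408881797245324747027251,
  8761711214199038966320460062187126320911486092415974667315,
  6769339303280556401046516500499407266507913065798014896261,
  9600369325863878157193376286723717610799924403002089436232,
  9515980002759293339575534538812420978273019370301726095240,
  9624852538576263649820369772747465123177237675799694820676,
  9515979977432306195740532462477772952386436042477790508919,
  7555731110403917580085136704829684451172297747505758111796,
  9624793546596490172214690550245624247584193601306583581751,
  8031093866964819284462971549437482749343602644846147762056,
  9624882848658718867065351181747113690355182395317047951686,
  7140714055849303922732086670294904148597848549845089335159,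
  9624888504475237421348647924049782221018208256394449683252,
  7973984390732650704915066628746836521536332850521183844216,
  9624588814808003611058956652941062448782822819344711911560,
  8789575594880022980050947710564967817134473769993725507464,
  7530991182907297446519101235271480298736085017463938910310,
  9108342549342189855007923836792016112108804750802760726323,
  7637146830110935179305689632103999594393625053343647303479,
  8055612301415849822838191643145141718106961657716027127671,
  7090013996592212002288253152857886813737857131250526470980,
  7534060869525847908765543699365507197234056514853891506724,
  9206294554547782058950847188144831980900902738584286806855,
  7655122924554365893273868812956808806350206302088689037670,
  9232570320058075920341056723726355157354078676922826978647,
  9206416276985421568791969852796026514169162041394787219592,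
  9206415903509736252056652265920686025255975253437435115655,
  7090141702970303288994485405386425354366851321144459395168,
  9624889232497870728467640009965951246058692400872422655108,
  9624588814996400286077887631264998545730879289216757893255,
  9621618906259264545133896914662696715717503166141976508552,
  9108336563038913954456583521456092148559664266320197154952,
  9101797522643860497629096586795049399946788912606132515703,
  7532426027089045564962625285880027599048719181533904668808,
  9615592187978318536977222333735482095975098462244024108099,
  9616805861029277659821812224604958864154050894338297661576,
  6769077408255513999284531140878934412107293447571371296904,
  7637146828558186215498892730495871672273123631099611989377,
  9200285896038294308907573013816855998875195864822593058679,
  7531015527602783989425657325951105731945699353363354187912,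
  7146717920164810812533962910256593271037170264719200127111,
  8343339931062001860015530680644567287503764467330324902708,
  9619889238191268077723628287993662303336945565444895967364,
  9623254665780085512205014043028039411627430685466684782728,
  7559085338505692316221803226105321412518747789488563910536,
  9208042191898578450986232598692883892958449949004828018756,
  6775207390424576505250794442888912290295060471582854232200,
  6375202202545903969558340661419824159469661236897312420995,
  7871618647869508528872547577654109459923037953386311070792,
  8372840470407139229491657182899934124472695550159969535105,
  9572568572930657070633113817252994553579944945057536706661,
  8394007569427563766062652480257844748902203531960962746504,
  9232569295253912838811377156330865273481164565067034298504,
  8784979604829036132564671780413569008792336575814161625975,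
  9206415874165499530996180702005987139902696048069519640646,
  9477259415367031795242513409896867868852778155754085975092,
  9232570444249177871625467116381282557999632219462143805491,
  7147897229608322285566094993433703565300057464355707974519,
  9502251371941253617306272715108482319354110356740378755891,
  9206416277625610455001413964397939983309484442318899790663,
  7950899850290335230798000004473650479314862672720183719799,
  6749621986149353242118931614800129176687395298248242967331,
  7270974973714752907164303150490961129071461821795598370947,
  9206032779624846857197190951182558932522767762740748972919,
  8343313990949812737646237462412329929722335669366979786615,
  9222762482080261267300856022249864668010161678641438864196,
  7925248103614540922492161894872400705782232156304505866103,
  7947726259108408080130957139715001900803389290415764288580,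
  9206391933421739192673808943701958665084885771762163532868,
  7580055384886250222988930802300689806786211165356696307831,
  9206032779624115399259649574482692499767585639799825192327,
  9208050540282521943017063533852046768185692721889423864883,
  9132862477991468525678462788063626856570945624900848023351,
  9624857400968231719772516325509186211373390198614547531895,
  7539060636568963707341973064360988939170962538780499085176,
  9624883341282179861260586499629719562942743815852256342850,
  9623254681272011786169032493867250796814006446946902046584,
  7111187998478934142831257662608800770622347060648900789128,
  9206007213182433778024347182083535243385937096567986070048,
  8029074583061665449589296631849629253575974599425436907379,
  9624887732726965198457634830287099872026872259059948942152,
  7508123875461186091948066124156486582911837065176005493880,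
  7975897388245141035864621068035346355818959134329255004291,
  9232532155865820327188461821019296994918899591861133412488,
  9206414381995544750088631089397781368506720830959999486088,
  6852113657335779286223267363101928717755338309257499539319,
  9206416277167351048125882802966521875249317779584204703761,
  8438163092653169422816852437881735117426935896304360392567,
  9232570393096762999344052977314093928689952977091658483848,
  9108342500999978403758650784518121087313754083946413983624,
  9616805906239844986176055457464802403370186700553355552375,
  9232468302767941475728867256427977625221852526697988130952,
  9206415903510023095531962641652536214377048540236794263416,
  9574213311888968801929204902455594443141812268014414366080,
  9108310622269545331967896571316598745512317111721965090680,
  9200285921346598380500786955342031947139330738438818407479,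
  9622840115225067763342854194287933989067412379043157735287,
  9624384112395249885693856001408506263796413998731091212424,
  9200285896403692018982995234595333827915241090923501021320,
  6799906629344244809959965539128097575333576474356847425399,
  9101791530005695536458622266901642744496211950328272685192,
  9206032756240848536238327728845680676948593906024535520119,
  7638775100389269233045430950896354287301389677078491199287,
  8024454738662479149999581890833152310032319779887458579250,
  8029459702269410579784982515767295029033148914033103501124,
  9472878935072680978236475847719581429363348223570993449093,
  9624852540037765264353683333976464114563481133036781139848,
  8317159782214707687778580306917638685120363453058433382264,
  9624889327208622226017117536089306346650563114117915419171,
  9624875381481472666064812727289621909607506081689666811767,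
  9598734738587730041868840777021399714222574624301019333956,
  7140202856070828621146957592356741918523133794869499295880,
  8423412823170029197286594342344675730779727881492175847970,
  9621620028715738291514191954578163010844004448177996646465,
  8318818774924101772249725605044977461351919523483392444552,
  9624882848658742561625556944792864702482231829795186444420,
  9200285897960789887720503100940349135929743108224837834007,
  7636827560122952426111476723771873232156930658287878349623,
  6701728762617671780692134906475971408530718971749226193783,
  9623259054188135256972856573508975793924868462946973926209,
  7532553984511870942486454780326832633303362943950986359608,
  7540689405704498937186354811796263819596799858746044068482,
  9204889760631556647877472268821742461986971203225106462583,
  9624276332494410526292467677103906854926752309108694022178,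
  7951114506881817854291470827238868796511646081067734497143,
  9232468302767941486256524328503151863644186140782239451268,
  7539162896084345513152618243544661075094583970448177398101,
  9127928160073329865380521566271597597800574010450776719907,
  9206422263964433666797399334389614339771233654656863453714,
  7140228648674476949669007079449184590094776252849612948855,
  7637146830117429040855533589963114279104611432575797855027,
  9612425008700683002914974231871162838096548809469503883127,
  7514539304970899820965716990074546193553742563552330745992,
  9624480639023620379202543895262633393157476728810626364210,
  7532617869669634112049893569475833748443758695632514201480,
  7171261800297611982331478002122271312019675452215975441202,
  7560591246408771516876193505842620744434492975590638322210,
  9624887731152134201199750069376467866512503096448360417412,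
  7900728174941692469789824979100090887854970188692716729175,
  9200285921346605721178235036105547053013733936877419119411,
  9495166570754534081843552899362926028641349126473225810995,
  9524664144163242564665236870608668969782133047648388089992,
  8004939376087186214386983917308620457913905546776221808776,
  9570945908561937057487087446462268394776396755436699157587,
  7508512979323944229393757300249011586512468829217647720584,
  9600331088556315786379213733215100909810297104244253689651,
  9200286289639333124145027515555051051704504445290815125640,
  9206391933324684848330732597286991406404296853310755194215,
  9624887732613631313397673866384882220611691204263235044167,
  9618746180101619803781929624789220184662003790266845652311,
  8786512100375967812502153477536658136579234196886331537288,
  9206390336976300844860400811274181868839686443985119250568,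
  9598734738483878335634637890638100307106409891173063013447,
  8761775068175364951430215957626308311378269820649599436936,
  8348216780795735977420811017331082899333067632129068202120,
  7535970220906333823816844544648755279972464385835646023543,
  7555541043114684205257584735581817644499039030451097798792,
  9206498098264766811913879536454400434111725871756467274883,
  7949485478427033249200397918271383331799103361210972141431,
  7508512985564250364824077020156644399567954463160648894600,
  7555988545148330825705791998531680459521089148326899124019,
  7506379863694429272079376796669508636195550508249972746359,
  9624882942255721323290204889117890869869810542145058391364,
  7121723883400241676347335555021270854426414117708717324168,
  9623356831564883348750480141411879150734763894431721665058,
  8346223737046171002392698945795445017847555970585514252168,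
  9206032756240733315304888627128528216744653989496452494405,
  8438414119097182182634742529437592029630420176880415245347,
  9624787162678927055547245959436952662333721374153351132757,
  8389084922068975692313646512805640437910009878207397398648,
  8369654180346689796733597967903549923519488762859114498150,
  9623230721998755172816742357084362689043044268619350968407,
  8343411664383421288447968481897454218574269771156000635016,
  9624791301748929378906454251021217922469491779926203258965,
  7951001514683030702052379095821927576497192830634770528120,
  7950977569439807439453042778383843797958877337870918833237,
  8317574849897627693869879970902734260968393308797477672001,
  9232564482820392795463133792377448016896697326132554905731,
  7637138948148866184549973968344589101564841857581973993608,
  9624888928482694107634374648103312294200649689410088502886,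
  9198855566843137034521901382379619712161014402325671261969,
  9517039921631168149648252434119339956585242965535550375987,
  9200285896501101400702577103628343844900921483238318823236,
  9471021188454860585171124776189037347693640610129458530438,
  9108336558563222782084697301963802474455843513802070447175,
  8317281520654008307047069921096748578760442922124238685799,
  9624876955518765167290706900502557581830126158833163588999,
  7931355638652772142000029933024503864042437399401137928055,
  9622654067528135777193330609467835852791325075669653862442,
  6299247095217012571157578422859449770473605460578608043912,
  9624889251217892031235732976274978245295936344197293443186,
  7557066056132922875668102383335415831996270187004985296231,
  9108336188894290002589964265548861829273075506081403446067,
  10646553043426026242614149344656933945499276999793357305719,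
  9232569970182219745741144396868520327508158594545594160144,
  6453747762019462683675495540747723099007661457524282324791,
  9232556969120618179976009837890109692956346776193284170402,
  7638774709100777646380891730741005865321761923235070699383,
  9200285921340563612940958667635221501613960003594242700087,
  9108438322520721569049528021524126325094309346792269099575,
  9206415903509736252079259514035647362574482742014492746504,
  7531013632035231826548703859410237551309498220826116715383,
  9200285802873651545786804222030670505318016057814928602437,
  9232570444188662278625327560026529180631528057732812976931,
  8317574849781952328921042743727887688643111987372804346899,
  9206422263850659800033929358607899222215575488964040479879,
  9523437821700459837368695731288684153810891801613102692211,
  9208024699204131722272301957522385415539445212523647174792,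
  7539059233533450610473254936406840434591253018215894709111,
  7115688597626571271273682136073817973674792975509964993330,
  6329410517886008150394827566058220117608565858347879965473,
  9206032754779348299892043824860173449766362717687724322816,
  9232570469131218704769869547046128255220049938430740870179,
  9624785689588773344923452284286935421809180203267780020016,
  9208050545889485044868165375241856714903857757481017489288,
  8441399793119150235752866409400856939940003937098665252727,
  7164722779712194870089348064521215850887504707443508152452,
  7533785194115955874881031554140594763507871727017317843520,
  8319005179434501807310835678585395584896557082261280019523,
  9208032176611906017206859387916462539431484248342289483912,
  7146844034785715099077097213147762644886760813244434646899,
  9624864583999106092235570140745796839562556714036623673141,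
  9624888530975300749953048673528011040773580073994783258488,
  7931092642815869819303192398382123206208408405708345144183,
  9467962283038188242207503186472421849354196965089877381265,
  7949360891503585621800781885005636078244507850837573793655,
  9518738933073159900028399091166554447880153083609801311556,
  7631008965979232211104362139086523662349505236231737870472,
  7637116499575068916055753735270369184504992132725801694003,
  7637138948240211027253128933446483791943851286486223893315,
  7951091310902499206828621537469493431195733244478506891298,
  7636659694084693160398837240990820459237329472143265768050,
  9570952639781402437139426565578175033110915068396640163703,
  9624378472750235533144775548041609606908603034404725950600,
  9624889302288736631494098932012469856676624553619465123704,
  9206415880125709531070323409474895994312895855614584391815,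
  7532516125407725303499587953230476769803159108586214683463,
  9618356292460347400652356980361238237660038534558421055351,
  9621330417549477146379102026369171837480505719003194620040,
  9572491149955991670280217436430725483086650804936676440200,
  9200286295370779352698608789111505657122514952520895592584,
  9206415878664565217470184194040467281327246253246293160755,
  9206511261627488168000890288618592163897064671301483373858,
  7146717926114026952881816371133621757137075337204488239240,
  9104958289826741439764643059559435542296071600580874806067,
  9200285921255285541950476429264484784534248613467334858103,
  8440262415900736760440427523681386071754218405013445882935,
  7238661697482616874787300167416397786471868236252877916275,
  9206414383548383183839038540868289056748626589330072417079,
  7975611239654545175887123788198950255792655200640318343287,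
  7114144813502280876520728985953766745087752823040704546115,
  8787840263263305769547558030168915318688140716170985948970,
  7637116499574712196705332202939126866480196639974382602102,
  9572580570494245080119915462817480494836768447673797916738,
  9624882936348840796038049165513179085089672693126490716296,
  7146717826634064127290763057948829875508426868619501582199,
  7533972360158506713939721613389202922728297358828769456948,
  7533031018644487532785260050376327459300844651360708338179,
  7536079870095601525840655211066817315084408033507630609271,
  7925325459500603271268759201890144720101751235241875552312,
  9624844778833941186049415702107918775967773105298262467186,
  9206415903468321932130049031624142483009957470286118357112,
  9624378519131497792710163461835615589776141463737716930359,
  9500661384421282244577338781665006318409047717386768578424,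
  9224397253511857002872375174400617319796329430217614976904,
  7564518141523143333973884600377810086212456333373153511283,
  9573831686048659532601685554473122128768526143149274859653,
  9616613876980951897624745806748481855615007380148284000392,
  9616811805225834331136200548832615820932827103899297468983,
  9075667271448457007333820077135617510886082669628217325432,
  9232570444254888419883701966212599058289113431312300393317,
  9157477388991266972771539110982044157186491553474848970549,
  9206518044814734115265424006886245654767633573920153802632,
  9624755678528913651348348461665630590098365869074862868595,
  7530991177426572459118820463971131006953160961604609079176,
  7900421633639393631984829143158474981135008916681956471346,
  9222770478960614468548455911300697439102682632213451842628,
  8364565044762068427598330526539698511212459001301751597175,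
  9623254690595925103001514148659660059555590670720185160981,
  7555534963633152989602929933328545911368072973354471470903,
  9206518043473236691226844990634049554807502284244198302307,
  9624876154987175392261886016335082400187143213309031933751,
  9600369374001757652735197183969979971364164246298980480887,
  9624426177334306386299545670520405808234011278537278306168,
  9624588814813283228164148552683132813422695510195736552040,
  9623255038160047413870692615231788830316748539872775993224,
  8683228686771232065399362202036942280945978692331901577096,
  9624876980826699121319346938777339722388573067585137095223,
  7636757322388001410491596577090375100834092281197126449016,
  7539036708474405713894267430338440138870269705966853501987,
  6329327951553883915841068666685474858161898602207392379714,
  7637116499574712196604399141576956757956695755811312640578,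
  7532617846384444201876530799587209266905807198803815072564,
  8024542593521004857862259046900145814191018734606220298373,
  7637242511494589285654041421639564584705782378993245762627,
  6455093558120820450853537443448779943772906731565505598295,
  6407868326193198164111035830852304748472961677368108812342,
  7637146829912643921621681261673602494377628719954153074773,
  9208050166332969458135832917386272805054597911214154803063,
  9557002130312372833772895770730763262961232230132101642039,
  7556971765893288823929131222511126770095545869340498233477,
  7900346460328453811817388751666517115713162977257102665267,
  7529554468337759255693902159983171738485580449068456620851,
  9232570443782588009751985397119360681007357700075899271030,
  7115593126548830930184697783466289656561644629538439202952,
  7637140351184737406178799546779629775818474828620991059012,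
  9715650746373608224275902858455849911493891248170084021111,
  7140611795944189414285449097668374348757938586788191238280,
  9232570445745315526705039666957079269161366268598756258612,
  8367834692737560255135176373544043184927213959442698040183,
  9183419980138268743944591608306379301568574778068176295269,
  7532521708707904282068931485834378799004035633399303006295,
  9206415880097053569712184464087743350116943951686686421795,
  9594203053055920947612149701892219838111843476424292267895,
  9206415880120357870554938829585655624419521336910754052232,
  9618752959763012179114243009238147705095432240564503279479,
  9624889275737314771661248898486402324535984376938527876216,
  9624787162678930190228416871561765122837246160194302867319,
  9198242567560433627277773205395214470086111423893191804808,
  9624679407607966442295841888308797327208324205926154454899,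
  8024860220215367845799028894786600820873842127502227896456,
  7923206324328069171771459147115936084405626959199566591863,
  7116928470104930104095495617373954418810760821150040933460,
  7146436844262780006608665474574177228591456921545821402163,
  9624787176814767642015923242936514621381647760418935154484,
  9600367428450824375744589237746096246785483182258439796600,
  10303682679979965808922868343938275848591798652763103529096,
  7117209804664292357798199322004437159280907291366759019394,
  9200284393620697726241117885015457433348926137507215852610,
  7807235876198273346501801809823522358107059634373680919587,
  9623254659837027605767868873884392304836767142962033742427,
  9200285890558042252550902466198600944224747716898690988168,
  7951090115387426508931904549780861537134761636605272994851,
  9101797615704955319821699699746225371493005386074343953237,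
  9206391934882859960479664137121063394663608280560643027767,
  7532611158418718253581036767654613857567985705011270333495,
  7952515256246666907703968684975256912622771957776807069826,
  9101821461920411029699466492415738597551946869716961023316,
  9595670114245860763384555098603846183342730344153841104692,
  7557043513931646383099227773254845730769744576994793191560,
  9624601959735324708441963154155724554855637254910608897912,
  7975515435206041127977344537488536405431120625985538979960,
  8392354270808758555005099759497847987484524210866970915703,
  7952528002179049695596802521420986931051787385744019174468,
  9206518044837662161842418026931532731267357263708917425492,
  9075463361453978428142533509496049383800636790013875812151,
  7949361220364200803049435415347209779497625090727356172424,
  7950803177237058645452407127471137442764300871751321203796,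
  7924847026985400210013736216123265801871722720469551563844,
  9520270215483073014434109949300566938544280578801496704068,
  8711004767900836562579547478634417702088094596470502815624,
  7557043601621410111747506006967420004934584600823815488579,
  9206518044717322694761252504810684709342643626949393723954,
  7950983508988884073620815278468146418730167365260202768243,
  9208050515534338255342836935537352045222220120430247167028,
  9206518044838994248442626655940519862917100347866246318183,
  7146614163590676390995487886297794897959177733414968625011,
  9232570445529537791834495597950161445041844413754727731764,
  9206414381989835759478023067582080237769113009252669552520,
  6381720097448303073016621479068226916373352412899499521847,
  7877254659629316263412885180828667809765939534214298931473,
  7931355643322371170329584623277594431021749851177821160500,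
  9600369018564605814911759036574603110500205931283331975219,
  7530989616177922640088295025585237523930534831309748402039,
  6403264456998061012243021191901994719911072655348996733059,
  9623356757223159390188162654325832864364375583364780361858,
  9230455306009329493751030942389407365610663924060149725048,
  7533958890959416898091297356231078608552671149385717409670,
  9156665521006017588805970297842988106415320231284371113027,
  7950995132407773304303067693556727078572517387133108390024,
  7532611883337512936927116018643277596895032802540402542452,
  7974275900573849763476370682183673165777257577590191957010,
  7557067546864212353821703783593162074062355829833961125429,
  9232564482527522323530130439353072013977467743568820126515,
  9206032754779348298171114038112189990996210719614536480567,
  7532611976873623765570940850324367937708420908227597910579,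
  9204653508691306227657128185219075846830895741920777356355,
  7508007766171293143053657163771986636625652116725267920755,
  7530989563904947823089385187968144369815731401654427468324,
  7538677605854453849635367507636378035532683870119552753955,
  7317979092140877931260113783790918809731399183407076553522,
  7531015034979684005965442942276974181187534509458857604990,
  8651658479061552050881871213655320786433138064521432364867,
  9232180953984829807833372301978674543617961088617321883765,
  9623063103374671395531146786403082695298612532738093430583,
  9206032756240828093817227177499771200665276494723454302344,
  7555688306723106578399230840041491814555573655255958108020,
  9624882848659099366292211299961856249962190560104143860259,
  9208048569891699604562491798577182985066027044515039639687,
  7951091262586262160203169217679158746201164718369561343859,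
  8344457801213701793221183128000617936837270751426200540176,
  8421760108900470360068820574944933658835588255816119239762,
  7975514662152715517987805715902932307126632344476932409463,
  7538749441948300750204279219573615438282312083754221531716,
  8369462617040013364334759719085746763828360112401907414835,
  9103708624196843352514708432641586981520547280417356862821,
  9232538542233668925839299469857180329196326514143345997684,
  8343302392392441074443528219168016550656360702722958652279,
  7951002290758270087633254650540879277332288743867850834756,
  7825924614549950159826118181414321594881042640161574503764,
  7532619476932771924630259395824891700238004599506730304292,
  9208050517092976363571885541566644300797096832704767542066,
  7924930735975926642014772095505005340884798618791534932851,
  7539036784959293914597805925726060134857456502518960116804,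
  8393982525232795705269193236365996031500030141192291431234,
  8415622638088158347233120214253720728340232758644994946083,
  9623356806743731705086876795407503208314938988350735349623,
  7555509938048032587988281317767125609394144772902236682104,
  9208048944121778717749144022391892051383814484187072831779,
  7950791945596974287463676522061810851001259704506092320567,
  7636755724594240225137638630554207570576168432052210831428,
  8320417125735192279975972645838394853141016071014861453175,
  7900218496609615499109474681457737185958063315552649229093,
  7555511111561145623226980760664989594173901146977684693283,
  9206492503160724882193696844796146405812631758292727907379,
  6695575165705235561024354827406403622101788505585999902519,
  9208050135544025075107959532227618561850591607595406214180,
  7531015034979417755997656165455812389733817012714969986871,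
  6695574885096921193491092841049154339009530016493179730040,
  7631010369021272456529098888847236342458870243088220308516,
  7533958797119219474057329344953638016246334648525517960002,
  6694349185044272273353549240421637907254317439891611468306,
  7532529195689896942409124313406359095016171790957554176276,
  7898700224591438587042007112430053415352899886527326533427,
  7533984332755539148610070726340263181759915216670835360290,
  8343320373144342830603439015661154250038145589385118172228,
  7952528426020967928106511098493400602768015539348340610117,
  7508385676788468585872442869458138184124041790767402144597,
  9108336158104566552523766547235649299438360683304064258611,
  7637146655517798783355220649698753273075799826966287364983,
  7532522433612716398196778916050457693370667307887201826679,
  6723364787647241467201618589050448978008505816787540194114,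
  8320326980221359264511853434294478671376015824984538751554,
  7924842433398977337239769118169399693329594306469267911987,
  7555533560568075044208235480413804582973402683502248620851,
  7140610392883945750948501162985998057673414107230518081667,
  6723364788035527080983299974627889047463361874869136466740,
  8367834692457440409945876416590574892633177887765665292866,
  7973982966064282641922588846425355384026882689137987970405,
  6672689894284813802347957803460579570531600319547655411028,
  6723358450661761522952553441298381727661540900880247898385,
  7924846554650906871599582451601388804386102351686915990050,
  6329410590691783244468646173219863381384588530452772561221,
  8317160150240610872943401659615394912657742213635247444241,
  7114060233479524896357626066281876414437526084928078488613,
  9230911863536976121356751913593412544605364957806072190020,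
  7534054929153582287055137133349416090979878803853645673335,
  6277101736945614542777198111746360531101751758434172289842,
  9101803128843873194298424412010658138798273469701358372132,
  6381720117909993716746749686036985541639190429028715033463,
  7557137767157609846252350022443432434766498041578629697857,
  7846791844405670179823156867456805870334033665147194654992,
  8317159799501936121426866032024134458425533002207792988160,
  7950988773408481849132927813537705184932377827515239257430,
  8366211632251609842497326162409701445782085010455474295877,
  7561664939567400000883522188571828200997953253612550772309,
  7187710236379338829665937491955468531725719631034223637843,
  9199872441877538766794718412596480639851221173585166292274,
  7950988747182023569614435751509120332002970433982097015618,
  9075642553166449637017315219829687141431931858987816915216,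
  7950791945584777266193458984165457836394227190699044120435,
  7508008539287417008917449786044066918559154508388476457028,
  7897179371561057233391732729915746591039922633355951686196,
  7952431876591740591170204674796875103535249235949125846050,
  6723454233197702660606087821525669328224717069751809229892,
  7949557619653525368571676934142228540522700088068929713954,
  6725094876661581167358763718055148087012637378456498419511,
  6277103330273563244793129430728709509965097915077678604836,
  7950982810596292072822832857585887524399352341419566318404,
  7091054796219183468791033720388924517245106730954399175493,
  7140109409047641184338102161351453434896074086625102143794,
  7901655559113284937827275107219912719684982867690335183393,
  7872435977656911822282210719022488315374036475556029075524,
  7975514664891916055508523383865241296185887765197802976273,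
  7898877541089638738220013336145966029480320738864186734391,
  7186195650067714431452126150895709018467042278908868445252,
  7112618281248112668899354030134673049215327605484724228354,
  7117107663066612093408645222599307431921167363106346856994,
  7897166625616833887004785005649698320588163666668970787906,
  6377121015036498900940639921674663555379793001753037980706,
  9108214467266485398717544080001987219102486448655163462673,
  7952432221117829066911354583778210348254580859807575013239,
  7161562731168693699554553583418115887948266580047402710357,
  6694258997343570671695718230959186860826070626509458326854,
  7140305391639093078948935253435241625877155920916630208513,
  7637116349819847089752308517043170269920971587721575543604,
  8024555267576831519200283259839034592530230443856160323383,
  7483572020176667301228938212978891454516277154911248065300,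
  8294292558610794928701919024962595244742856298895840322082,
  7162993110232180824923765492720138684697463004588675318051,
  7947726932878528568748465603321480190030288902787171632194,
  7846377170792266876127280603079312818622032066661517103172,
  7952527977344935551871557398213015652061335926187336680516,
  6723454233094874002417136279224559129312183732381761615671,
  7533958797033223350627151866408730433517627641456562020930,
  6700167883447946015056558943219902673799189113049073328419,
  7952432269443383602676805712821098961234991890149518160961,
  6671054907199386727203540333499918830239902994949603681620,
  7874357584562661425500329818048242254854425354149952487697,
  7138753339549233281831794374282176191097202167464958641186,
  7872531410595650313296522461605094732819543203949876429652,
  7508002510440914987616222241582212909610070984409261285921,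
  7506379115320195393111204083633641927959651692277315801651,
  7096066604039496825391760797631154452269637624467972961604,
  7089630847775106593278132838715089153204413914477080154370,
  7112528908693498791547820260334052823466675558225460470306,
  7580136000561815901568492612298482465351603002950051500290,
  7140388801004410270581538691763378371365041268402990227987,
  7949463335281574197014054317733942124954282584829246710817,
  7975521067650241098868804812622448888239571063791134195716,
  7946092666829288682317128503741207051617098872843591225604,
  8781199449281901788452052623289881214209873957876239905859,
  8049279577011384814722781924500275342990584300198835663714,
  7950900149616931819002726272863907554380559199702074336584,
  7947912530031065968654619089459462193093921188892329136979,
  7953856938219351281724307266471593354207131990364753510977,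
  6749308309240994626931204036570794642250909014432691790661,
  7946109485972439951616638140798530460826789187821759513636,
  7951072160565780346171139754310419674527000279998932206659,
  7950586959554425694899466536099167753891331666432271454788,
  9206216828962615451446078888755477230329145129345770411077,
  7194044899203821106306109482769426063278960131522569716807,
  6769130580401396998257045975779166573607395322529323426849,
  7874274201801904404512436969480137938349836066445651620929,
  7951085321474657424507617328628233678793661764139227563042,
  7560108498783346809163462120835308446710355145483342927157,
  6671050912554010560511338547567839084858555317191865430899,
  7921858560937769777538565704589872017900175303349398156308,
  6700167881986444541057015874521039220043903406510765507652,
  9469978373125533197051467951710783821789504455786746889281,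
  7949461445445414925526853928316202640234124644641381949730,
  7508091999818183092097526027142338087496411531106804003636,
  6826354145374521940168908033106149089039816046776766636593,
  8289586482409740449127900730172565594063230712696405247042,
  9107927523411397024251620023480433713964708463040069247266,
  6778636439620916276734289509763536679566083473961345578866,
  9078618872094713586898831312359898433335888999404496175652,
  6749493579395481988811337162466969558492823550865425188164,
  7141831893731624489945002197901682035386060745606789538612,
  9624691372937541195149653047384627187391408172341137720375,
  7162986324279122512777303920770881064776712040670393043080,
  6382007390849234344760976106835604730730307605532051272770,
  8392540471427026832695310120052024129419124932643924283713,
  7951001517508205990453730345072345345621230365187036680789,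
  6774326366053626013554334700721785242010690617861936137573,
  6698635390738715766846279398855950207225555006167681417254,
  7555508717413644511817691555922824252301472712556413977600,
  7955286589083312824380674207559439089922610532858579788067,
  7117107688094427525973903230647001355600132656858449384519,
  7558268101089713171230558037195597439987291313430250144836,
  6798559258897355984759550094184975508120805158872513066053,
  7586357351812850270735924453777211927008980961865385595445,
  7901746100303575638911511296468934558205948075936116380226,
  6769058295893434764174695286619817690894325887615402852420,
  7952430649732677666778050937523485071840384404846786192449,
  8343518699208738259987256037175934801296939697144070493236,
  6277108310136006141901046676617549583334497965318330471492,
  7945989379413992091142169830065563016610489641303592140800,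
  8393881126140746551020495071613731739898071490728893169924,
  6376816092815399964014538255899256759205715160705766786661,
  8318775305377048144636218792797842088653939112328107720704,
  7871300151094961736962338272096817210244494938954538497092,
  8343320375872441496377583020583717138449798740970792300817,
  9520449759320670086668910793865183216530188393533636186789,
  7163004632510138926378200129831136157548749297354832684324,
  7926456516696325739625965059439668178550907976517553570882,
  7874358307908824004354682892795649822644046083202543009875,
  6283232116633314442154517971314749200994106581864092550178,
  6383263770451640173065502540493287498751534089013019284544,
  6767501805065823798511031317677472017197473962673048916289,
  8238721944898996139273856257884856605181421688625645491217,
  8783039215489916930364751991659612822048401432348431900752,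
  7852914226370869491726529688738342266250642352394962276456,
  6381815875507690446249736557860777111160574662336839681028,
  6767908926971939967884530198810462294058360058393699553601,
  6283622332118061024718825249145773665847799065562374611268,
  7847935207536835239021597353128101254295055647940135829508,
  7846377549796935459283056948356511049071718503851592269824,
  8029267735374865179038493604245102516363744727787310957892,
  8344839706299441281372601534107874746231671912747197670418,
  8369480929564112773357941108154986912678176602910450083157,
  6682113095536632893294779432643692018743704532987114700805,
  7946109487542902942854008103990093754360691954323338588436,
  7923410633675212145750129033069733231828768134196304041043,
  8840149371230811124200066885886357797310102265176313385587,
  6767908874534953476062624740907323345470096600940210784392,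
  7949461843070912756828880409105579392161272177748147699968,
  8421752995731872050356076349134403024207198015360793052160,
  7534156374522658605842718503640340026486108966593215136129,
  8391018901170807589647533055423089685471137755826418579255,
  8313155755602027307742257475871996167133369377063578265173,
  7532528466399085398212445855404588926892854808391809238016,
  6277581154691779180958250104439490254670974460507375875891,
  6277108120781722893605328461687735514876421873542314082368,
  6375194944413679748924481651683464331602868730219888644608,
  6700172396656727758327474488003080982543319607916633276736,
  7483487090398203522731215890451448766320912657321750184772,
  8685341851648941920526959854476245779288381109119554420800,
  9621606841044065941966881010261363384247310781182251575139,
  6700102407899176867675603855441854273711810021263688075400,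
  7970629113472079893086385920844183070424901120065827784500,
  8737363666352087307420192684013551878866612861193835205699,
  6375313248877870930886187014034874007260045542067692191814,
  6350968113992545439334663464143761193308343457177028215808,
  6694349184872954806948830292343920294529069275911272219712,
  7944458380817605468803398993793070561073753277931097035025,
  7558371296280114978843568227402009966078673443207490372679,
  7559085263688180390577714417530945447290513914409686927432,
  8366385274893576577129524414635426267627435493002824594501,
  8318775375188060620406128594879284490593543959991318693765,
  7872455041478537864901761022921746562728523705325204100420,
  6303256307219302195263957520204178667850872134892389676097,
  7534162356150916677425036068277471146477506179836594426177,
  8740537207739416266271233388521454539217092629375421339445,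
  7950969995743454418791964463084191909350292450306046715496,
  8761883198915358958686117507199308509437772135677677551684,
  6774603937269512325727011757524121226124731194212624699491,
  7581562713008871182674122897255146806767517684191291973926,
  8369462244350243923324434346998376058612491491942772069205,
  8786397535979608843731818271764598700817580264950168027990,
  6479799016903261704898035594833686654403945061074139890792,
  7946679401377543139713745987448619098862599612200692814145,
  6277103306793241314921089015772119593996137287216179253332,
  7846401120710779617065583197853658873995550485796477993024,
  7949469017964953143968041511340494601447588901209244721425,
  8318788100751490330705911734816663821922655777187473740084,
  8443028788393928793263264773761966716517135660743373701956,
  8370904924485092074078106449839281347428009933410331002470,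
  9621523823621987234413391729973640400583203361339093693285,
  7846402332278148998740469569717589666652147207157783413776,
  6401718869812600149976923017666512563141834959533437568000,
  8001573894033102648046085025442192598629533287535716925712,
  8763320310945233190927456769839673241996786106200552113254,
  8367930000170293060305431181614029421028456847992079869523,
  7532629860611388833302593527744167219147144145733046142309,
  6375231029986683077646400817706838606523442694091554779987,
  7944480837068954350704615480711152193838563135223417287744,
  7924943129218383577291875762708064713528771570983363753043,
  9624685788644384341306931839770423448084098917220925657459,
  7926450154779698483193814345669679880029621988231213319512,
  6677798137833869893635779577813885692292586400306810794804,
  7854569633418528442054582170617270683470794432817878007816,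
  10329140053498375958065720226441515771969828253795555165969,
  6507486480190602301741328972842267289082090365420809946274,
  7508104296812273935226922217295051978700713466904181109843,
  9598709593040112877402131580639041657898761621779177223987,
  7877035708756335904951286454502415209951917679726763864867,
  6407969691543704222229270169288189550645133553270127592515,
  9107927475187535623414995487159265836495553698774362846212,
  8713916509420576129999393277182032064265411155779438262135,
  7857730357133880705893895902495084227669875445617902712615,
  7534174322950971455637780659061689951750726882689414542336,
  8317166206706441464270401120460013517428084563047694549815,
  6478249260029168510822960250258241599860192019574617883443,
  9109459995933612125147905548305648435944958937996594249792,
  6401233874198317580416970792242869802443610026489512489796,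
  7190500610047442253649964034214271369901348798563807872020,
  8023022430130627246704215461212296808658283640223340693056,
  8318896677369426193416547467028435057729189394156065600052,
  6375219363291439946404823120129320949385842121063097718597,
  7926090958966947351449089130544668646803842499555379983424,
  7846377169257731245844425675843768954147724627123340849971,
  8366212008137008029707493257532196267205889836316820258816,
  7950893365120783758654130135752521457993876573884396164453,
  6375564679505159855678447652971545164052018817226067166276,
  7851263997312746897145969759798144376099780423973513876480,
  7978681825448734130773436058775959068133067400557320488019,
  10985235733291275824937848070710229692044872326169432909670,
  7846401306304423283461057687188574287583491807812001285571,
  7846907034097358393066578556204115974511632016397692078150,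
  6284789380441505286992611712822887652520214081830617564160,
  6481453555727612912259190481083436939909162458751286117440,
  6375589716489691114463458337265274453626531034705468735492,
  7535587474003192114581091895997180893819887682263651210048,
  7557120137516288507537122204606819674443435331392306956373,
  6284790951921545125736422979358958130665646177330158125875,
  8393988932376116341333094568455854523275126860935237730304,
  8786308468957040247890034916480442904794820529470406223461,
  7952631268870393566185273212122990080921003445905386718054,
  7853227098844093439934934359990429174476526188129661629523,
  7559077456151705143435890219133402721186854518178337542976,
  8318416269973329816580521917802435527136153079877838590789,
  7532516121004933758298729238081161174994454603949248116597,
  7636755701193487058449804788039893330972673566663061550084,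
  7980227085585734304294373682764853461390133231085059143541,
  7580035830999151766869406344038708401755455912815857264501,
  9206390313682529399935284822368530042961212877265833383223,
  9206422262403731480495982654406047436473938413652739830328,
  7142124853123165915795398112660495751223532870103558797191,
  9101791578321260570537576554879975718209205115504432461619,
  9232570444187401851413956409928268948077869783963133245303,
  7508105423899860275803717284678885536488744716165797349512,
  7532707683124516084907734446011861505831590592323077235511,
  7630506419507202047351621137482473892869241708049509725269,
  7846760391331835404429907312241179177053966618019489858611,
  7975413295310363488268052311027542556280942771724084261940,
  9227667680387484468633702579577701523576380521158674686787,
  8787840216209087423640938204707341661241248431224428918599,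
  7924745534099183075816263771878225618986122107024532911174,
  8787757252893664323240299166985975639754497666422173479988,
  8761864463754308981083640824988421610613896195584990409830,
  8366391967121376852132595002848931175071557889890137162854,
  8443022030313728831364881549946355381355465809316256367728,
  9618555686607713248779818887630771545672670918329133065814,
  7508098356060718829421407580151908122176214724932066821460,
  7141735721010898830064095161766156058945519065202978661171,
  8317345400047878109739726790277648737531782507672647377715,
  7557036048214121503805981822908038009936733122383427491925,
  8789378768407914540158695977715740201432291836393964122676,
  8789577089795263806126841255408806764308908748963182757734,
  8367937607396498993709556759840947311650064223497892484454,
  8415425115949311826037427604366143840533752769132830610211,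
  8398892864110428578695759503934377224792788713794891502981,
  7114150550366598505161935035631617865973967086478510348420,
  7244819966538139103953618946213798837118456084178178089794,
  9131322775517333986115467746356507643321589628307715007347,
  8298685645723801896831642516339692413066475103920408757622,
  9230935689813686886385374782749429211531746516819651294581,
  7140202851410775615065501842250639442187973300280437012279,
  8369450274509494200830376573980889587399519531876888033075,
  8447932744802967277526515828675996594227641745848795345699,
  7629278892833427735743488434755434977585995376995196242056,
  7638170371752504805556165110298854198771047101159310520867,
  8315633313450230302471867555748233783545067149475899979570,
  9467962190597399344034656025935246928312061628159115872308,
  9595465787168901673946211185178884233771617471547583897890,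
  7507899988993641191497017373918257240055912271101333485414,
  7114048633444327703146047650207940379813797916640521888371,
  9075955454839166805301902592065020795620739014179835486753,
  7195372692554332160201429548246853625878636589763256603170,
  7089528774942552068107332970567790518055309021152571499042,
  7580252858059845766894688658250683876567795994583361528354,
  7138568563645049877370091089169209386862310775892834682195,
  7976861582175865079033391376005579895953855994120373412130,
  9198242294655070097781034643261839991581940973925059421814,
  8026189956143078344751493303830284258247843690714242713463,
  9104887250546317252969879539692588625083543860614292325461,
  6452010559692816978696852213013534905382328518997866535027,
  9206030880997566748868188321625441325322831327440033444387,
  9203338797473800808140770623871404499818764552451870107426,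
  9551041793749651832651614417522957540366354012482843342661,
  7114367030367484120257675744620660261675426507969480131384,
  6696098785495940043564417550885142074071730467773415249269,
  7114335602658748631669848805163405141820545651358450520337,
  6704770167074064278978666564455396586569669489353525900115,
  9049488743038498229744004131167627040570685817578739344161,
  7243186548651272366290168222287380917624763789708371710225,
  8291407418817625037887501731515212020616369832809842483490,
  8814186767510826039982821175979347222681909227442266203221,
  9546426748210723352635377923725439392946383871024998938760,
  9174011081131576868634496337330624877141819350141016285528,
  8814096993609658959133512800922412217708515732664324593254,
  8347989997929924049220306304628985910569309148220033693542,
  7241071901901779334413145745444054756020417400956447376485,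
  6696188182598072589688245193509736676213462925834384254837,
  8421550538025329541571759704941268702253628817670000383767,
  6842694781272835912082276883976379568048039650438539204439,
  7217335792963101079862675098670936337775656778183118115345,
  6695575324751027326202915128486017431195782833209707034487,
  8372648459514014738356340611268034221428081957545365894936,
  9054494089729822956840903624345402148350164329039473480071,
  8264850618260557444792488794913797662216006892504225370385,
  8735645272370163758686651388563145101941385961311292654929,
  8029248589526836028170956803534145843329868694026125119846,
  9057865943758436806171336992578599013890054393275267445845,
  9551042080335419463473488762499724850777201735778595967317,
  6701705271024505773729616116527440891972496964070268802184,
  8828834143282681870321784578896457602575426222700468729880,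
  8368224206703731928556259805915970157354189885863565428839,
  8272939325676339016068549408426266390148474366613948495428, 453684672916447014025586805]

def h364 : Hs :=
  [8369470152834750182774978406842271583846413511865644613648,
  6731537746407998929405330612618803285139109667036611442519,
  9206415880126066216340336476413961102395215107646942618146,
  9200285921346617614909648660004884910646481049453730205959,
  9208050538895617690810690990778967580702844985780556005383,
  9624787161223430242673159861903754763446427015811570300727,
  7410768007146684039910850895273020607900810369096645834888,
  9108336188894668748666453345595300002113949212325471356979,
  8369468955663195728933992145102209726226095559109389726583,
  7975514664892986491278072411035045412433509813069154846853,
  9206032704794470362961932660154141793251397073391158785908,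
  7140407531707183256920502149308883201540907285756847010851,
  7897256371658191098657592954244255359801138131393247781684,
  7535791357962895238577657794399036423533243533683009536546,
  8369462618499991558895607586620181895641950883242907345779,
  7871311746568715899631769966432310930199414207309265772885,
  7973981771724888888894738754971796738723354857477288182801,
  7872819085563088508209583429566769684155013846072657532245,
  7846887999606934927783160079766332703983165919213027066995,
  7560113288191227777509298465493725109561934862560124023808,
  8023021231408880221481084665634033295754625077163060581171,
  7560311381511972027374847100889519908300050401804084802355,
  8369480901795987282845636383074569185994360132817623655237,
  7563178378679423116241281486797922525738911262668836066645,
  9321639588871269266768019677901627244127885709349214164786,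
  9149202786537066844510550832742451408927336872196348015735,
  9100367187145279567369776841976072020367896979382933615701,
  8291311754437609578781277729151985936557443948613405385264,
  9206415873988469149376064651409607776369261386659709744471,
  7558676673034195352717737801399949783887504778549741962581,
  9195676381622523970238829242781974554442767251725508285508,
  9206109384134336328044021117464972807331767682490960401780,
  7532522481460432703637764780980800025385165009567127717751,
  9034583921218808183694524483807425006505503834982384210228,
  7539036778626835542514207979775137521543384041943169447747,
  7557042036055120451247245892469486330451992239394643944243,
  9108334943299458165074977323530866735742404725463512991061,
  7532426395399924283131316906511271921929600728295917437495,
  7509432483176504223650794255919100355623848297034861982515,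
  470782630056567615523563141322965327231869341752388428594]

def h243 : Hs :=
  [8369468955658176590182510722389546700586182495407297824904,
  9157074831591972941963116460081677619760105867403861443892,
  7637242611083758866295288471992002938701571089406865213303,
  7540695391528112608590774595271690984323013434396050491527,
  9232570319473261206856677650238270250843385094498342614835,
  7114044642564435347473752413350496010555153669906196034423,
  9232570370822279329410547541078139057214375857846033549448,
  9108342549252368404546520203005953448123455597915377522005,
  9623254665688742867831782955543906859271352690479871566199,
  9619788820655503476358110340764681795654291464146453231480,
  9206518019970727092667300690996772390470065095388565960840,
  7950708187016699233299565608058232054614239688936281044851,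
  9200286295472780058945872128914185554322760549344842647635,
  6695576381673839584130991945991898413651181950772710967431,
  7631010861553034604296255554362609322460616737791220590601,
  7189718642353974529852777239645486895365814415789800239939,
  9624480662018252934647488834451629269913516658115377111586,
  7898692737154086713741266389703633855053126342887584528248,
  9108336070421693754206070312368120489797289089025368564788,
  7117216144744760222385876822147186664188115841582475916098,
  7114246931544773316008830302456915733393048501244188181538,
  9208050509298710914531553092400104096745881079863546689396,
  9206396695776073965261032351966346965177055276982799054707,
  6695677375542125326916971991152392484411275561725271212199]

set_option maxRecDepth 1000000 in
theorem run_h364 : run rls [.a, .b, .c, .d, .e, .f, .h, .i] [.b, .c, .d, .e, .f, .h, .i] 364 h364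
    (fun _ => true) = true := by decide +kernel

set_option maxRecDepth 1000000 in
theorem run_h243 : run rls [.b, .c, .d, .e, .f, .h, .i] [.b, .c, .d, .e, .f, .h] 243 h243
    (fun _ => true) = true := by decide +kernel

set_option maxRecDepth 1000000 in
theorem run_h27 : run rls [.b, .c, .d, .e, .f, .h] [.c, .d, .e, .f, .h] 27 h27 (fun _ => true) =
    true := by decide +kernel

set_option maxRecDepth 1000000 in
theorem run_h16 : run rls [.c, .d, .e, .f, .h] [.d, .e, .f, .h] 16 h16 (fun _ => true) = true := by
  decide +kernel

set_option maxRecDepth 1000000 in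
theorem run_h120 : run rls [.d, .e, .f, .h] [] 120 h120 (fun _ => true) = true := by decide +kernel

/-- All the checks on the action on 14080 signed points. -/
def chkO (t : Tb) : Bool :=
  cond (app t .a false Pt.zero (is false 0)) (allP 14080 Pt.zero (chk true t)) false

set_option maxHeartbeats 0 in
set_option maxRecDepth 1000000 in
theorem run_hX_hO : run rlX lts [.a, .c, .d, .e, .f, .g, .h, .i] 3510 hX chkX = true ∧
    run rls lts [.a, .b, .c, .d, .e, .f, .h, .i] 14080 hO chkO = true :=
  ⟨by decide +kernel, by decide +kernel⟩

section Bound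

variable {M : Type*} [Group M] {s : Ltr → M}

theorem Rep.relOK_rls (h : Rep s 1) : RelOK s rls := by
  have h1 := h.ev_wR
  have h2 : ev s wU = 1 := by rw [wU, ev_powL, h.u]
  have h3 : ev s wV = 1 := by rw [wV, ev_powL, h.v]
  intro r hr
  simp only [rls, List.mem_cons, List.not_mem_nil, or_false] at hr
  rcases hr with rfl | rfl | rfl | rfl | rfl | rfl <;> simp [h.cox.ev_revL, h1, h2, h3]

theorem Rep.card_step (h : Rep s 1) {gs sub : List Ltr} {n m : ℕ} {hl : Hs}
    (hr : run rls gs sub n hl (fun _ => true) = true)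
    (hK : Finite (Subgroup.closure (Set.image s {g | g ∈ sub})) ∧
      Nat.card (Subgroup.closure (Set.image s {g | g ∈ sub})) ≤ m) :
    Finite (Subgroup.closure (Set.image s {g | g ∈ gs})) ∧
      Nat.card (Subgroup.closure (Set.image s {g | g ∈ gs})) ≤ n * m := by
  obtain ⟨x, t, ht, -⟩ := run_spec h.cox h.relOK_rls
    (K := Subgroup.closure (Set.image s {g | g ∈ sub}))
    (fun g hg => Subgroup.subset_closure ⟨g, hg, rfl⟩) hr
  obtain ⟨h1, h2⟩ := ht.card_le h.cox hK.1
  exact ⟨h1, h2.trans (Nat.mul_le_mul_left n hK.2)⟩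

theorem Rep.card_closure_le (h : Rep s 1) :
    Finite (Subgroup.closure (Set.range s)) ∧ Nat.card (Subgroup.closure (Set.range s)) ≤ cardG := by
  have h0 : Finite (Subgroup.closure (Set.image s {g | g ∈ ([] : List Ltr)})) ∧
      Nat.card (Subgroup.closure (Set.image s {g | g ∈ ([] : List Ltr)})) ≤ 1 := by
    have : Set.image s {g | g ∈ ([] : List Ltr)} = ∅ := by simp
    rw [this, Subgroup.closure_empty]
    exact ⟨inferInstance, by simp⟩
  have h1 := h.card_step run_h364 (h.card_step run_h243 (h.card_step run_h27 (h.card_step run_h16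
    (h.card_step run_h120 h0))))
  obtain ⟨x, t, ht, -⟩ := run_spec h.cox h.relOK_rls
    (K := Subgroup.closure (Set.image s {g | g ∈ [.a, .b, .c, .d, .e, .f, .h, .i]}))
    (fun g hg => Subgroup.subset_closure ⟨g, hg, rfl⟩) run_hX_hO.2
  obtain ⟨h2, h3⟩ := ht.card_le h.cox h1.1
  have h4 : Set.image s {g | g ∈ lts} = Set.range s := by
    rw [← Set.image_univ]
    congr 1
    ext g
    simp [mem_lts]
  rw [h4] at h2 h3
  exact ⟨h2, h3.trans ((Nat.mul_le_mul_left _ h1.2).trans (by norm_num [cardG]))⟩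

end Bound

theorem tot_of_run {rl : List RW} {sub : List Ltr} {n : ℕ} {hl : Hs} {k : Tb → Bool}
    (h : run rl lts sub n hl k = true) : ∃ t, Tot t n ∧ k t = true := by
  obtain ⟨x, t, ht, h1⟩ := run_spec (M := PUnit.{1}) (s := fun _ => 1) (K := ⊤)
    ⟨fun _ => rfl, fun _ _ _ => rfl, fun _ _ _ => rfl⟩ (fun _ _ => rfl) (fun _ _ => trivial) h
  exact ⟨t, ht.tot, h1⟩

theorem exists_rep_3510 : ∃ t, ∃ h : ∀ g, Function.Involutive (actF t 3510 g), Tot t 3510 ∧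
    Rep (act h) 1 ∧ chkS t = true ∧ chkA t = true := by
  obtain ⟨t, ht, h1⟩ := tot_of_run run_hX_hO.1
  obtain ⟨h1, h2⟩ := cond_eq_true h1
  obtain ⟨h2, h3⟩ := cond_eq_true h2
  have hc (c : ℕ) (hc : c < 3510) : chk false t (pt c) = true :=
    allP_spec 3510 good_zero h1 c (Nat.zero_le c) (by simpa [Pt.zero] using hc)
  obtain ⟨h4, -⟩ := involutive_of_chk ht (by norm_num) hc
  have h5 := rep_of_chk ht (by norm_num) hc h4
  rw [zeta_false] at h5
  exact ⟨t, h4, ht, h5, h2, h3⟩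

theorem exists_rep_14080 : ∃ t, ∃ h : ∀ g, Function.Involutive (actF t 14080 g),
    Rep (act h) (zeta 14080 true) ∧ act h .a (0, false) = (0, false) ∧
    ∀ g x, act h g x ≠ flip x := by
  obtain ⟨t, ht, h1⟩ := tot_of_run run_hX_hO.2
  obtain ⟨h0, h1⟩ := cond_eq_true h1
  have hc (c : ℕ) (hc : c < 14080) : chk true t (pt c) = true :=
    allP_spec 14080 good_zero h1 c (Nat.zero_le c) (by simpa [Pt.zero] using hc)
  obtain ⟨h4, h5⟩ := involutive_of_chk ht (by norm_num) hc
  refine ⟨t, h4, rep_of_chk ht (by norm_num) hc h4, ?_, h5⟩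
  obtain ⟨s', β, -, -, e, h6⟩ := app_spec ht good_zero (by simp [Pt.zero]) h0
  exact e.trans (is_spec h6)

/-- The letters that the symmetry of the diagram interchanges. -/
def tau : Ltr → Ltr
  | .a => .g
  | .b => .f
  | .c => .e
  | .d => .d
  | .e => .c
  | .f => .b
  | .g => .a
  | .h => .h
  | .i => .i

theorem tau_tau (l : Ltr) : tau (tau l) = l := by cases l <;> rfl

theorem cmp_tau (x y : Ltr) : Ltr.cmp (tau x) (tau y) = Ltr.cmp x y := by cases x <;> cases y <;> rfl

def wT : List Ltr := [.h, .i, .h, .f, .b]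

set_option maxRecDepth 1000000 in
theorem rews_tau : rews [
  0, 2, 3, 4, 1, 2, 3, 1, 2, 3, 1, 2, 3, 4, 0, 1, 2, 3, 4, 5, 87, 89, 88, 84, 85, 86, 87, 84, 85,
  86, 83, 84, 85, 81, 82, 83, 84, 82, 83, 80, 81, 82, 78, 79, 80, 81, 80, 77, 78, 79, 75, 76, 77,
  78, 77, 74, 75, 76, 72, 73, 74, 75, 74, 71, 72, 73, 69, 70, 71, 72, 71, 68, 69, 70, 66, 67, 68,
  69, 68, 65, 66, 67, 63, 64, 65, 66, 65, 62, 63, 64, 60, 61, 62, 63, 62, 59, 60, 61, 57, 58, 59,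
  60, 59, 56, 57, 58, 54, 55, 56, 57, 56, 53, 54, 55, 51, 52, 53, 54, 53, 50, 51, 52, 48, 49, 50,
  51, 50, 47, 48, 49, 45, 46, 47, 48, 47, 44, 45, 46, 42, 43, 44, 45, 44, 41, 42, 43, 39, 40, 41,
  42, 41, 38, 39, 40, 36, 37, 38, 39, 38, 35, 36, 37, 33, 34, 35, 36, 35, 32, 33, 34, 30, 31, 32,
  33, 32, 29, 30, 31, 27, 28, 29, 30, 29, 26, 27, 28, 24, 25, 26, 27, 26, 23, 24, 25, 21, 22, 23,
  24, 23, 20, 21, 22, 18, 19, 20, 21, 20, 17, 18, 19, 15, 16, 17, 18, 17, 14, 15, 16, 12, 13, 14,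
  15, 14, 11, 12, 13, 9, 10, 11, 12, 11, 8, 9, 10, 6, 7, 8, 9, 8, 5, 6, 7, 4, 5, 6, 5, 3, 4, 2, 3,
  2, 1, 0] ((wT ++ revL (powL 10 wH) ++ revL wT) ++ revL (powL 10 (wH.map tau))) = true := by
  decide +kernel

section Theta

variable {M N : Type*} [Group M] [Group N] {s : Ltr → M} {ζ : M}

theorem ev_map (f : M →* N) (s : Ltr → M) (w : List Ltr) : f (ev s w) = ev (fun l => f (s l)) w := by
  induction w with
  | nil => exact map_one f
  | cons l w ih => simp [ev, ih]

theorem Rep.map (h : Rep s ζ) (f : M →* N) : Rep (fun l => f (s l)) (f ζ) where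
  cox :=
    { sq := fun x => by rw [← map_mul, h.cox.sq, map_one]
      com := fun x y e => by rw [← map_mul, h.cox.com x y e, map_mul]
      adj := fun x y e => by simp only [← map_mul, h.cox.adj x y e] }
  sq := by rw [← map_mul, h.sq, map_one]
  com l := by rw [← map_mul, h.com, map_mul]
  hex := by rw [← ev_map, ← map_pow, h.hex, map_one]
  u := by rw [← ev_map, ← map_pow, h.u, map_one]
  v := by rw [← ev_map, ← map_pow, h.v]

theorem ev_mul_central {e : M} (he : ∀ l, e * s l = s l * e) (w : List Ltr) :
    ev (fun l => s l * e) w = ev s w * e ^ w.length := by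
  induction w with
  | nil => simp [ev]
  | cons l w ih =>
    have h1 : Commute (e ^ w.length) (s l) := Commute.pow_left (he l) _
    simp only [ev, ih, List.length_cons, pow_succ]
    rw [mul_assoc, ← mul_assoc (e ^ _), h1.eq]
    simp only [mul_assoc]

theorem commute_ev {e : M} (he : ∀ l, e * s l = s l * e) (w : List Ltr) : Commute e (ev s w) := by
  induction w with
  | nil => exact Commute.one_right e
  | cons l w ih => exact ih.mul_right (he l)

theorem ev_mul_central_pow {e : M} (he : ∀ l, e * s l = s l * e) (w : List Ltr) (n : ℕ) :
    ev (fun l => s l * e) w ^ n = ev s w ^ n * e ^ (w.length * n) := by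
  rw [ev_mul_central he, Commute.mul_pow, pow_mul]
  exact (commute_ev he w).symm.pow_right _

theorem ev_tau (w : List Ltr) : ev (fun l => s (tau l)) w = ev s (w.map tau) := by
  induction w with
  | nil => rfl
  | cons l w ih => simp [ev, ih]

theorem Rep.zeta_pow_odd (h : Rep s ζ) (n : ℕ) : ζ ^ (2 * n + 1) = ζ := by
  rw [pow_succ, pow_mul, pow_two, h.sq, one_pow, one_mul]

theorem Rep.zeta_pow_even (h : Rep s ζ) (n : ℕ) : ζ ^ (2 * n) = 1 := by
  rw [pow_mul, pow_two, h.sq, one_pow]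

theorem Rep.ev_tau_wE (h : Rep s ζ) : ev s (wE.map tau) ^ 9 = ζ := by
  have h1 : ev s (wE.map tau) = s .h * (ev s wE')⁻¹ * (s .h)⁻¹ := by
    rw [← h.cox.ev_revL]
    simp [wE, wE', revL, tau, ev, mul_assoc, h.cox.sq]
  rw [h1, conj_pow, inv_pow, h.v, inv_eq_of_mul_eq_one_right h.sq, ← h.com, mul_inv_cancel_right]

theorem Rep.ev_tau_wE' (h : Rep s ζ) : ev s (wE'.map tau) ^ 9 = 1 := by
  have h1 : ev s (wE'.map tau) = s .h * (ev s wE)⁻¹ * (s .h)⁻¹ := by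
    rw [← h.cox.ev_revL]
    simp [wE, wE', revL, tau, ev, mul_assoc, h.cox.sq]
  rw [h1, conj_pow, inv_pow, h.u, inv_one, mul_one, mul_inv_cancel]

theorem Rep.ev_tau_wH (h : Rep s ζ) : ev s (wH.map tau) ^ 10 = 1 := by
  have h1 := rews_spec h.cox _ rews_tau
  simpa [ev_append, ev_powL, h.cox.ev_revL, h.hex] using h1

/-- The symmetry of the diagram, with a change of signs, preserves the relations. -/
theorem Rep.theta (h : Rep s ζ) : Rep (fun l => s (tau l) * ζ) ζ := by
  have he (l : Ltr) : ζ * s (tau l) = s (tau l) * ζ := h.com _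
  have he' (l : Ltr) (x : M) : ζ * (s (tau l) * x) = s (tau l) * (ζ * x) := by
    rw [← mul_assoc, he, mul_assoc]
  have hz (x : M) : ζ * (ζ * x) = x := by rw [← mul_assoc, h.sq, one_mul]
  refine ⟨⟨fun x => ?_, fun x y e => ?_, fun x y e => ?_⟩, h.sq, fun l => ?_, ?_, ?_, ?_⟩
  · simp only [mul_assoc, he, he', h.sq, mul_one, h.cox.sq]
  · have := h.cox.com (tau x) (tau y) (by rwa [cmp_tau])
    simp only [mul_assoc, he, he', h.sq, hz, mul_one, this]
  · have := h.cox.adj (tau x) (tau y) (by rwa [cmp_tau])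
    simp only [mul_assoc] at this
    simp only [mul_assoc, he, he', h.sq, hz, mul_one]
    simp only [← mul_assoc] at this ⊢
    rw [this]
  · rw [← mul_assoc, he]
  · rw [ev_mul_central_pow he, ev_tau, h.ev_tau_wH, one_mul]
    exact h.zeta_pow_even 45
  · rw [ev_mul_central_pow he, ev_tau, h.ev_tau_wE]
    refine (congrArg _ (h.zeta_pow_odd 31)).trans h.sq
  · rw [ev_mul_central_pow he, ev_tau, h.ev_tau_wE', one_mul]
    exact h.zeta_pow_odd 31

end Theta

/-- An automorphism induces an automorphism of the quotient by the center. -/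
theorem MulAut.exists_induced {Γ G : Type*} [Group Γ] [Group G] {π : Γ →* G}
    (hπ : Function.Surjective π) (hk : π.ker = Subgroup.center Γ) (φ : MulAut Γ) :
    ∃ ψ : MulAut G, ∀ x, ψ (π x) = π (φ x) := by
  have hm : π.ker.map (φ : Γ →* Γ) = π.ker := by
    rw [hk]
    exact Subgroup.characteristic_iff_map_eq.1 inferInstance φ
  let e := QuotientGroup.quotientKerEquivOfSurjective π hπ
  have he (x : Γ) : e x = π x := rfl
  refine ⟨(e.symm.trans (QuotientGroup.congr π.ker π.ker φ hm)).trans e, fun x => ?_⟩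
  simp only [MulEquiv.trans_apply, ← he, MulEquiv.symm_apply_apply]
  rfl

section Main

theorem map_zH {M : Type*} [Group M] {s : Ltr → M} {ζ : M} {f : H1 →* M} (h : Rep s ζ)
    (hf : ∀ l, f (sH l) = s l) : f zH = ζ := by
  rw [← rep_sH.v, map_pow, ev_map, funext hf, h.v]

theorem commute_zH (x : H1) : Commute zH x := by
  have hx : x ∈ Subgroup.closure (Set.range sH) := by rw [closure_sH]; trivial
  induction hx using Subgroup.closure_induction with
  | mem x hx =>
    obtain ⟨l, rfl⟩ := hx
    exact rep_sH.com l
  | one => exact Commute.one_right _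
  | mul x y _ _ h1 h2 => exact h1.mul_right h2
  | inv x _ h1 => exact h1.inv_right

theorem zpowers_le_center : Subgroup.zpowers zH ≤ Subgroup.center H1 := by
  rw [Subgroup.zpowers_le, Subgroup.mem_center_iff]
  exact fun g => (commute_zH g).eq.symm

/-- The action of the presented group on the signed points. -/
theorem exists_signed : ∃ (f : H1 →* Equiv.Perm (ℕ × Bool)), f zH = zeta 14080 true ∧
    f (sH .a) (0, false) = (0, false) ∧ ∀ g x, f (sH g) x ≠ flip x := by
  obtain ⟨t, h, h1, h2, h3⟩ := exists_rep_14080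
  refine ⟨h1.hom, map_zH h1 h1.hom_sH, ?_, fun g x => ?_⟩
  · rw [h1.hom_sH, h2]
  · rw [h1.hom_sH]
    exact h3 g x

theorem zH_ne_one : zH ≠ 1 := by
  obtain ⟨f, h1, -⟩ := exists_signed
  intro h
  rw [h, map_one] at h1
  exact absurd (congrArg Prod.snd (DFunLike.congr_fun h1 (0, false))) (by simp [zeta_apply])

theorem not_isConj (g : Ltr) : ¬ IsConj (sH .a) (sH g * zH) := by
  obtain ⟨f, h1, h2, h3⟩ := exists_signed
  intro h
  obtain ⟨c, hc⟩ := isConj_iff.1 h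
  have e : f (sH g) (f zH (f c (0, false))) = f c (0, false) := by
    rw [← Equiv.Perm.mul_apply, ← map_mul, ← hc]
    simp [h2]
  have e1 : f zH (f c (0, false)) = f c (f zH (0, false)) := by
    rw [← Equiv.Perm.mul_apply, ← Equiv.Perm.mul_apply, ← map_mul, ← map_mul, (commute_zH c).eq]
  have e2 : f zH (f c (0, false)) ≠ f c (0, false) := by
    rw [e1, (f c).injective.ne_iff, h1]
    simp [zeta_apply]
  obtain ⟨x, hx⟩ : ∃ x, x = f c (0, false) := ⟨_, rfl⟩
  rw [← hx] at e e2
  have e3 : f zH x = flip x := by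
    rw [h1, zeta_apply] at e2 ⊢
    by_cases hl : x.1 < 14080
    · simp [hl]
    · simp [hl] at e2
  rw [e3] at e
  exact h3 g _ (e.trans (by simp))

theorem card_zpowers_zH : Nat.card (Subgroup.zpowers zH) = 2 := by
  rw [Nat.card_zpowers]
  exact orderOf_eq_prime (by rw [pow_two, rep_sH.sq]) zH_ne_one

theorem closure_map {G : Type*} [Group G] {f : H1 →* G} (hf : Function.Surjective f) :
    Subgroup.closure (Set.range fun l => f (sH l)) = ⊤ := by
  rw [Set.range_comp' f sH, ← MonoidHom.map_closure, closure_sH, ← MonoidHom.range_eq_map]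
  exact MonoidHom.range_eq_top.2 hf

theorem finite_of_map_zH {G : Type*} [Group G] {f : H1 →* G} (hf : Function.Surjective f)
    (h : f zH = 1) : Finite G ∧ Nat.card G ≤ cardG := by
  have h1 := rep_sH.map f
  rw [h] at h1
  obtain ⟨h2, h3⟩ := h1.card_closure_le
  rw [closure_map hf] at h2 h3
  rw [Subgroup.card_top] at h3
  exact ⟨Finite.of_equiv _ Subgroup.topEquiv.toEquiv, h3⟩

/-- The simple quotient of the presented group. -/
theorem exists_simple : ∃ (G : Type) (_ : Group G) (_ : Finite G) (π : H1 →* G) (σ : G),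
    Function.Surjective π ∧ π zH = 1 ∧ Nat.card G = cardG ∧ Ctl (π (sH .a)) σ (π (sH .b)) := by
  obtain ⟨t, h, ht, h1, h2, h3⟩ := exists_rep_3510
  have h4 : Rep (actP h) 1 := Rep.proj (act_proj h) h1
  let f := h4.hom
  have hf (l : Ltr) : f (sH l) = actP h l := h4.hom_sH l
  let π := f.rangeRestrict
  have hπ : Function.Surjective π := f.rangeRestrict_surjective
  have hz : π zH = 1 := Subtype.ext (map_zH h4 hf)
  obtain ⟨hG, hc⟩ := finite_of_map_zH hπ hz
  have hp : Pm t 3510 (fun l => π (sH l)) f.range.subtype :=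
    { tot := ht
      pos := by norm_num
      act := fun l x => DFunLike.congr_fun (hf l) x
      cox := (rep_sH.map π).cox }
  have hs := hp.stab_of_chk (closure_map hπ) hc h2
  exact ⟨_, _, hG, π, _, hπ, hz, hs.card, hs.ctl (closure_map hπ) h3⟩

theorem card_and_center : Finite H1 ∧ Nat.card H1 = cardG * 2 ∧
    Subgroup.center H1 = Subgroup.zpowers zH := by
  obtain ⟨G, _, _, π, σ, hπ, hz, hc, hC⟩ := exists_simple
  have : (Subgroup.zpowers zH).Normal := ⟨fun x hx g => by
    have := Subgroup.mem_center_iff.1 (zpowers_le_center hx) g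
    rwa [this, mul_inv_cancel_right]⟩
  have hf : Finite (Subgroup.zpowers zH) := Nat.finite_of_card_ne_zero (by rw [card_zpowers_zH]; decide)
  obtain ⟨h1, h2⟩ := finite_of_map_zH (QuotientGroup.mk'_surjective (Subgroup.zpowers zH))
    ((QuotientGroup.eq_one_iff _).2 (Subgroup.mem_zpowers zH))
  have h3 := Subgroup.card_eq_card_quotient_mul_card_subgroup (Subgroup.zpowers zH)
  rw [card_zpowers_zH] at h3
  have hF : Finite H1 := Nat.finite_of_card_ne_zero (by
    rw [h3]
    exact Nat.mul_ne_zero Nat.card_pos.ne' two_ne_zero)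
  have hle : Subgroup.zpowers zH ≤ π.ker := by rwa [Subgroup.zpowers_le]
  have h4 := Subgroup.card_mul_index π.ker
  rw [Subgroup.index_ker, MonoidHom.range_eq_top.2 hπ, Subgroup.card_top, hc] at h4
  have h5 := Subgroup.card_le_of_le hle
  rw [card_zpowers_zH] at h5
  have h6 : Nat.card π.ker = 2 := by
    have : Nat.card π.ker * cardG ≤ 2 * cardG := by rw [h4, h3]; omega
    have := Nat.le_of_mul_le_mul_right this (by norm_num [cardG])
    omega
  refine ⟨hF, by rw [← h4, h6, mul_comm], le_antisymm ?_ zpowers_le_center⟩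
  rw [Subgroup.eq_of_le_of_card_ge hle (by rw [h6, card_zpowers_zH])]
  intro x hx
  refine hC.center _ fun y => ?_
  obtain ⟨y, rfl⟩ := hπ y
  exact ((commute_iff_eq _ _).2 (Subgroup.mem_center_iff.1 hx y).symm).map π

theorem ker_eq_center {G : Type*} [Group G] {π : H1 →* G} (hπ : Function.Surjective π)
    (hz : π zH = 1) (hc : Nat.card G = cardG) : π.ker = Subgroup.center H1 := by
  obtain ⟨hF, h1, h2⟩ := card_and_center
  have h3 := Subgroup.card_mul_index π.ker
  rw [Subgroup.index_ker, MonoidHom.range_eq_top.2 hπ, Subgroup.card_top, hc, h1, mul_comm] at h3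
  have h4 := Nat.eq_of_mul_eq_mul_left (by norm_num [cardG]) h3
  rw [h2]
  exact (Subgroup.eq_of_le_of_card_ge ((Subgroup.zpowers_le (H := π.ker)).2 hz)
    (by rw [h4, card_zpowers_zH])).symm

theorem mem_center_iff {x : H1} : x ∈ Subgroup.center H1 ↔ x = 1 ∨ x = zH := by
  rw [card_and_center.2.2, Subgroup.mem_zpowers_iff]
  constructor
  · rintro ⟨k, rfl⟩
    rcases Int.even_or_odd' k with ⟨m, rfl | rfl⟩
    · left
      rw [zpow_mul, zpow_two, rep_sH.sq, one_zpow]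
    · right
      rw [zpow_add, zpow_mul, zpow_two, rep_sH.sq, one_zpow, one_mul, zpow_one]
  · rintro (rfl | rfl)
    exacts [⟨0, zpow_zero _⟩, ⟨1, zpow_one _⟩]

/-- An automorphism that is trivial modulo the center is trivial. -/
theorem eq_one_of_modEq {φ : MulAut H1} (h : ∀ x, x⁻¹ * φ x ∈ Subgroup.center H1) : φ = 1 := by
  have hc {z : H1} (hz : z ∈ Subgroup.center H1) (x : H1) : z * x = x * z :=
    (Subgroup.mem_center_iff.1 hz x).symm
  obtain ⟨e, he⟩ : ∃ e, e = (sH .a)⁻¹ * φ (sH .a) := ⟨_, rfl⟩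
  have hz : e ∈ Subgroup.center H1 := he ▸ h _
  have key (l : Ltr) : φ (sH l) = sH l * e := by
    obtain ⟨g, hg⟩ := isConj_iff.1 (rep_sH.cox.conj l)
    obtain ⟨c, hc'⟩ : ∃ c, c = g⁻¹ * φ g := ⟨_, rfl⟩
    have h1 : φ g = g * c := by rw [hc', mul_inv_cancel_left]
    have h2 : φ (sH .a) = sH .a * e := by rw [he, mul_inv_cancel_left]
    have h3 : c ∈ Subgroup.center H1 := hc' ▸ h g
    rw [← hg, map_mul, map_mul, map_inv, h1, h2, ← hc h3, mul_inv_rev, mul_assoc, mul_assoc, mul_assoc,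
      mul_assoc, mul_assoc, hc h3, mul_assoc, mul_assoc, mul_assoc, mul_assoc, inv_mul_cancel, mul_one,
      hc hz, ← hc hz]
  have h1 : e = 1 := by
    rcases mem_center_iff.1 hz with h0 | h0
    · exact h0
    have h2 := congrArg φ rep_sH.u
    have h3 := ev_map φ.toMonoidHom sH wE
    simp only [MulEquiv.coe_toMonoidHom, key] at h3
    rw [map_pow, map_one, h3, ev_mul_central_pow (fun l => hc hz _), rep_sH.u, one_mul, h0] at h2
    rw [h0]
    exact (rep_sH.zeta_pow_odd 31).symm.trans h2
  have h2 : φ.toMonoidHom = (1 : MulAut H1).toMonoidHom := by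
    refine MonoidHom.eq_of_eqOn_dense closure_sH ?_
    rintro _ ⟨l, rfl⟩
    simp [key, h1]
  exact MulEquiv.ext fun x => DFunLike.congr_fun h2 x

theorem inner_or (φ₁ φ₂ : MulAut H1) : φ₁ ∈ (MulAut.conj (G := H1)).range ∨
    φ₂ ∈ (MulAut.conj (G := H1)).range ∨ φ₂ * φ₁ ∈ (MulAut.conj (G := H1)).range := by
  obtain ⟨G, _, _, π, σ, hπ, hz, hc, hC⟩ := exists_simple
  have hk : π.ker = Subgroup.center H1 := ker_eq_center hπ hz hc
  have key {φ : MulAut H1} {ψ : MulAut G} (h : ∀ x, ψ (π x) = π (φ x)) (h1 : ∃ g, ψ = MulAut.conj g) :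
      φ ∈ (MulAut.conj (G := H1)).range := by
    obtain ⟨g, rfl⟩ := h1
    obtain ⟨g, rfl⟩ := hπ g
    refine ⟨g, ?_⟩
    have h2 : (MulAut.conj g)⁻¹ * φ = 1 := eq_one_of_modEq fun x => by
      rw [← hk, MonoidHom.mem_ker, map_mul, map_inv, inv_mul_eq_one]
      simp [← h, mul_assoc]
    exact inv_mul_eq_one.1 h2
  obtain ⟨ψ₁, h1⟩ := MulAut.exists_induced hπ hk φ₁
  obtain ⟨ψ₂, h2⟩ := MulAut.exists_induced hπ hk φ₂
  rcases hC.inner_or hc ψ₁ ψ₂ with h | h | h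
  · exact .inl (key h1 h)
  · exact .inr (.inl (key h2 h))
  · exact .inr (.inr (key (fun x => by simp [h1, h2]) h))

theorem exists_outer : ∃ θ : MulAut H1, θ ∉ (MulAut.conj (G := H1)).range := by
  have h := rep_sH.theta
  have h0 := h.hom_sH
  have hz : h.hom zH = zH := map_zH h h0
  have h2 : h.hom.comp h.hom = MonoidHom.id H1 := by
    refine MonoidHom.eq_of_eqOn_dense closure_sH ?_
    rintro _ ⟨l, rfl⟩
    simp only [MonoidHom.comp_apply, MonoidHom.id_apply]
    rw [h0, map_mul, h0, hz, tau_tau, mul_assoc, rep_sH.sq, mul_one]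
  refine ⟨h.hom.toMulEquiv h.hom h2 h2, ?_⟩
  rintro ⟨g, hg⟩
  have h3 := (DFunLike.congr_fun hg (sH .a)).trans (h0 .a)
  exact not_isConj _ (isConj_iff.2 ⟨g, h3⟩)

theorem index_inner : (MulAut.conj (G := H1)).range.index = 2 := by
  obtain ⟨θ, h⟩ := exists_outer
  refine Subgroup.index_eq_two_iff.2 ⟨θ, fun φ => ?_⟩
  by_cases hφ : φ ∈ (MulAut.conj (G := H1)).range
  · exact .inr ⟨hφ, fun h1 => h ((Subgroup.mul_mem_cancel_left _ hφ).1 h1)⟩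
  · exact .inl ⟨((inner_or θ φ).resolve_left h).resolve_left hφ, hφ⟩

theorem card_inner : Nat.card (MulAut.conj (G := H1)).range = cardG := by
  obtain ⟨hF, h1, h2⟩ := card_and_center
  have h3 : (MulAut.conj (G := H1)).ker = Subgroup.center H1 := by
    ext x
    rw [MonoidHom.mem_ker, Subgroup.mem_center_iff, MulEquiv.ext_iff]
    exact forall_congr' fun y => by
      rw [MulAut.conj_apply, MulAut.one_apply, mul_inv_eq_iff_eq_mul, eq_comm]
  have h4 := Subgroup.card_mul_index (MulAut.conj (G := H1)).ker
  rw [Subgroup.index_ker, h3, h2, card_zpowers_zH, h1] at h4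
  omega

end Main

end

end Fi22

/-- The finitely presented group `H1` is finite of order `2^18 * 3^9 * 5^2 * 7 * 11 * 13`,
and its automorphism group has the same cardinality:
`|Aut(H1)| = |H1| = 2^18 * 3^9 * 5^2 * 7 * 11 * 13`. -/
theorem H1_finite_card_and_card_aut :
    Finite H1 ∧
    Nat.card H1 = 2 ^ 18 * 3 ^ 9 * 5 ^ 2 * 7 * 11 * 13 ∧
    Nat.card (MulAut H1) = 2 ^ 18 * 3 ^ 9 * 5 ^ 2 * 7 * 11 * 13 := by
  have h := Subgroup.card_mul_index (MulAut.conj (G := H1)).range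
  rw [Fi22.index_inner, Fi22.card_inner] at h
  refine ⟨Fi22.card_and_center.1, ?_, ?_⟩
  · rw [Fi22.card_and_center.2.1]
    norm_num [Fi22.cardG]
  · rw [← h]
    norm_num [Fi22.cardG]
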